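/- The canonical homomorphism from the amalgamated free product H1 *_{H1∩H2} H2 (the pushout of the two inclusion homomorphisms H1∩H2 ↪ H1 and H1∩H2 ↪ H2) to Aut(R), induced by the inclusions of H1 and H2 into Aut(R), is injective, and its image equals Stab([x3]) = {σ ∈ Tame(k^3) : σ(x3) = α·x3 + β for some α ∈ k^*, β ∈ k}. -/

import Mathlib

open MvPolynomial

/-- The group of `k`-algebra automorphisms of `k[x1,x2,x3]`. -/
abbrev Aut3 (k : Type) [Field k] := MvPolynomial (Fin 3) k ≃ₐ[k] MvPolynomial (Fin 3) k

/-- `σ` is an affine automorphism: `σ(x_i) = Σ_j a_{ij}·x_j + b_i` with `(a_{ij}) ∈ GL_3(k)`. -/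
def IsAffine (k : Type) [Field k] (σ : Aut3 k) : Prop :=
  ∃ (A : Matrix (Fin 3) (Fin 3) k) (b : Fin 3 → k), IsUnit A ∧
    ∀ i, σ (X i) = (∑ j, C (A i j) * X j) + C (b i)

/-- `σ` is an elementary automorphism: `σ(x1) = x1 + P(x2,x3)`, `σ(x2) = x2`, `σ(x3) = x3`. -/
def IsElementary (k : Type) [Field k] (σ : Aut3 k) : Prop :=
  ∃ P ∈ supported k ({1, 2} : Set (Fin 3)),
    σ (X 0) = X 0 + P ∧ σ (X 1) = X 1 ∧ σ (X 2) = X 2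

/-- The tame automorphism group `Tame(k^3)`. -/
noncomputable def Tame (k : Type) [Field k] : Subgroup (Aut3 k) :=
  Subgroup.closure {σ | IsAffine k σ ∨ IsElementary k σ}

/-- Membership in `H1`: `σ(x1) = a·x1 + t(x3)`, `σ(x2) = d·x2 + P(x1,x3)`,
`σ(x3) = α·x3 + β` with `a, d, α ∈ k^*`. -/
def MemH1 (k : Type) [Field k] (σ : Aut3 k) : Prop :=
  ∃ (a d α β : k) (t P : MvPolynomial (Fin 3) k),
    a ≠ 0 ∧ d ≠ 0 ∧ α ≠ 0 ∧
    t ∈ supported k ({2} : Set (Fin 3)) ∧ P ∈ supported k ({0, 2} : Set (Fin 3)) ∧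
    σ (X 0) = C a * X 0 + t ∧ σ (X 1) = C d * X 1 + P ∧ σ (X 2) = C α * X 2 + C β

/-- Membership in `H2`: `σ(x1) = a(x3)·x1 + b(x3)·x2 + t(x3)`,
`σ(x2) = c(x3)·x1 + d(x3)·x2 + t'(x3)`, `σ(x3) = α·x3 + β` with
`a·d − b·c` a nonzero constant and `α ∈ k^*`. -/
def MemH2 (k : Type) [Field k] (σ : Aut3 k) : Prop :=
  ∃ (a b c d t t' : MvPolynomial (Fin 3) k) (α β : k),
    a ∈ supported k ({2} : Set (Fin 3)) ∧ b ∈ supported k ({2} : Set (Fin 3)) ∧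
    c ∈ supported k ({2} : Set (Fin 3)) ∧ d ∈ supported k ({2} : Set (Fin 3)) ∧
    t ∈ supported k ({2} : Set (Fin 3)) ∧ t' ∈ supported k ({2} : Set (Fin 3)) ∧
    (∃ u : k, u ≠ 0 ∧ a * d - b * c = C u) ∧ α ≠ 0 ∧
    σ (X 0) = a * X 0 + b * X 1 + t ∧ σ (X 1) = c * X 0 + d * X 1 + t' ∧
    σ (X 2) = C α * X 2 + C β
/-- The two-element family of groups `{↥A, ↥B}` associated to subgroups `A B ≤ G`. -/
def amalgFam {G : Type*} [Group G] (A B : Subgroup G) : Bool → Type _ :=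
  fun i => Bool.rec (motive := fun _ => Type _) ↥B ↥A i

instance {G : Type*} [Group G] (A B : Subgroup G) : ∀ i, Group (amalgFam A B i) :=
  fun i => by cases i <;> dsimp [amalgFam] <;> infer_instance

/-- The inclusions of `A ⊓ B` into `A` and `B`. -/
def amalgIncl {G : Type*} [Group G] (A B : Subgroup G) :
    ∀ i, ↥(A ⊓ B) →* amalgFam A B i :=
  fun i => by
    cases i
    · exact Subgroup.inclusion inf_le_right
    · exact Subgroup.inclusion inf_le_left

/-- The amalgamated free product `A *_{A ⊓ B} B`, i.e. the pushout of the two inclusion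
homomorphisms `A ⊓ B ↪ A` and `A ⊓ B ↪ B`. -/
def AmalgProd {G : Type*} [Group G] (A B : Subgroup G) : Type _ :=
  Monoid.PushoutI (amalgIncl A B)

noncomputable instance {G : Type*} [Group G] (A B : Subgroup G) : Group (AmalgProd A B) := by
  unfold AmalgProd; infer_instance

/-- The canonical homomorphism `A *_{A ⊓ B} B →* G` induced by the inclusions of `A` and `B`
into `G`. -/
noncomputable def amalgToGroup {G : Type*} [Group G] (A B : Subgroup G) :
    AmalgProd A B →* G :=
  Monoid.PushoutI.lift
    (fun i => by cases i; exacts [B.subtype, A.subtype])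
    (A ⊓ B).subtype
    (by intro i; cases i <;> rfl)

namespace TameStab

section

/-- The polynomial ring in three variables. -/
abbrev Poly3 (k : Type) [Field k] := MvPolynomial (Fin 3) k

theorem exists_weights : ∃ W : Fin 3 → NNReal, (∀ i, 1 ≤ W i ∧ W i < 2 ∧ W 2 ≤ W i) ∧
    Function.Injective fun m : Fin 3 →₀ ℕ => ∑ i, (m i : NNReal) * W i := by
  obtain ⟨t, ht, htr⟩ : ∃ t ∈ Set.Ioo (0 : ℝ) 1, Transcendental ℤ t := by
    by_contra! h
    have h1 : Set.Ioo (0 : ℝ) 1 ⊆ {x : ℝ | IsAlgebraic ℤ x} := fun x hx => by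
      simpa [Transcendental] using h x hx
    have h2 := (Algebraic.countable ℤ ℝ).mono h1
    have := Cardinal.Real.Ioo_countable_iff.1 h2
    norm_num at this
  lift t to NNReal using ht.1.le
  have h0 : 0 < t := by exact_mod_cast ht.1
  have h1 : t < 1 := by exact_mod_cast ht.2
  refine ⟨![1 + t, 1 + t ^ 2, 1], ?_, ?_⟩
  · have h2 : t ^ 2 < 1 := pow_lt_one₀ zero_le h1 (by norm_num)
    have h3 : (1 : NNReal) + 1 = 2 := by norm_num
    intro i
    fin_cases i <;> simp [← h3, h1, h2]
  · intro m n h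
    simp only [Fin.sum_univ_three, Matrix.cons_val_zero, Matrix.cons_val_one, Matrix.cons_val] at h
    have h' := congrArg NNReal.toReal h
    push_cast at h'
    obtain ⟨a, ha⟩ : ∃ a : ℤ, a = (m 1 : ℤ) - n 1 := ⟨_, rfl⟩
    obtain ⟨b, hb⟩ : ∃ b : ℤ, b = (m 0 : ℤ) - n 0 := ⟨_, rfl⟩
    obtain ⟨c, hc⟩ : ∃ c : ℤ, c = (m 0 : ℤ) + m 1 + m 2 - n 0 - n 1 - n 2 := ⟨_, rfl⟩
    have hp : (Polynomial.C a * Polynomial.X ^ 2 + Polynomial.C b * Polynomial.X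
        + Polynomial.C c) = 0 := by
      by_contra hne
      refine htr ⟨_, hne, ?_⟩
      simp [ha, hb, hc]
      linarith
    have c0 := congrArg (Polynomial.coeff · 0) hp
    have c1 := congrArg (Polynomial.coeff · 1) hp
    have c2 := congrArg (Polynomial.coeff · 2) hp
    simp only [Polynomial.coeff_add, Polynomial.coeff_C_mul, Polynomial.coeff_X_pow,
      Polynomial.coeff_X, Polynomial.coeff_C, Polynomial.coeff_zero] at c0 c1 c2
    norm_num at c0 c1 c2
    ext i
    fin_cases i <;> simp <;> omega

/-- Weights of the variables, with pairwise distinct weights of monomials. -/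
noncomputable def W : Fin 3 → NNReal := exists_weights.choose

theorem one_le_W (i : Fin 3) : 1 ≤ W i := (exists_weights.choose_spec.1 i).1
theorem W_lt_two (i : Fin 3) : W i < 2 := (exists_weights.choose_spec.1 i).2.1
theorem W_two_le (i : Fin 3) : W 2 ≤ W i := (exists_weights.choose_spec.1 i).2.2

/-- The weight of a monomial. -/
noncomputable def wt (m : Fin 3 →₀ ℕ) : NNReal := ∑ i, (m i : NNReal) * W i

theorem wt_injective : Function.Injective wt := exists_weights.choose_spec.2

theorem wt_add (m n : Fin 3 →₀ ℕ) : wt (m + n) = wt m + wt n := by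
  simp [wt, add_mul, Finset.sum_add_distrib]

@[simp] theorem wt_zero : wt 0 = 0 := by simp [wt]

@[simp] theorem wt_single (i : Fin 3) : wt (Finsupp.single i 1) = W i := by
  simp [wt, Finsupp.single_apply]

theorem wt_ge (m : Fin 3 →₀ ℕ) (i : Fin 3) : (m i : NNReal) * W i ≤ wt m :=
  Finset.single_le_sum (f := fun i => (m i : NNReal) * W i) (fun _ _ => zero_le) (Finset.mem_univ i)

theorem W_two_le_wt {m : Fin 3 →₀ ℕ} (h : m ≠ 0) : W 2 ≤ wt m := by
  obtain ⟨i, hi⟩ := Finsupp.ne_iff.1 h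
  refine (W_two_le i).trans (le_trans ?_ (wt_ge m i))
  have : (1 : NNReal) ≤ m i := by
    have : 1 ≤ m i := Nat.one_le_iff_ne_zero.2 (by simpa using hi)
    exact_mod_cast this
  exact le_mul_of_one_le_left zero_le this

variable {k : Type} [Field k]

/-- The weighted degree. -/
noncomputable def deg (f : Poly3 k) : ℝ := (f.support.sup wt : NNReal)

theorem deg_nonneg (f : Poly3 k) : 0 ≤ deg f := NNReal.coe_nonneg _

theorem deg_le_iff {f : Poly3 k} {r : ℝ} (hr : 0 ≤ r) :
    deg f ≤ r ↔ ∀ m, coeff m f ≠ 0 → (wt m : ℝ) ≤ r := by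
  lift r to NNReal using hr
  simp [deg]

theorem wt_le_deg {f : Poly3 k} {m : Fin 3 →₀ ℕ} (h : coeff m f ≠ 0) : (wt m : ℝ) ≤ deg f :=
  (deg_le_iff (deg_nonneg f)).1 le_rfl m h

theorem exists_deg_eq {f : Poly3 k} (h : f ≠ 0) : ∃ m, coeff m f ≠ 0 ∧ deg f = wt m := by
  obtain ⟨m, hm, h2⟩ := Finset.exists_mem_eq_sup f.support (by simpa using h) wt
  exact ⟨m, by simpa using hm, by simp [deg, h2]⟩

@[simp] theorem deg_zero : deg (0 : Poly3 k) = 0 := by simp [deg]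

@[simp] theorem deg_C (a : k) : deg (C a : Poly3 k) = 0 := by
  refine le_antisymm ((deg_le_iff le_rfl).2 fun m hm => ?_) (deg_nonneg _)
  rw [coeff_C] at hm
  have : m = 0 := by by_contra h; exact hm (if_neg (Ne.symm h))
  simp [this]

@[simp] theorem deg_one : deg (1 : Poly3 k) = 0 := by simpa using deg_C (1 : k)

theorem deg_X (i : Fin 3) : deg (X i : Poly3 k) = W i := by
  refine le_antisymm ((deg_le_iff (NNReal.coe_nonneg _)).2 fun m hm => ?_) ?_
  · rw [coeff_X] at hm
    have : Finsupp.single i 1 = m := by by_contra h; exact hm (if_neg h)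
    simp [← this]
  · rw [← wt_single]
    exact wt_le_deg (by simp)

theorem deg_add_le (f g : Poly3 k) : deg (f + g) ≤ max (deg f) (deg g) := by
  refine (deg_le_iff (le_max_of_le_left (deg_nonneg f))).2 fun m hm => ?_
  rw [coeff_add] at hm
  by_cases h : coeff m f = 0
  · exact le_max_of_le_right (wt_le_deg (by simpa [h] using hm))
  · exact le_max_of_le_left (wt_le_deg h)

@[simp] theorem deg_neg (f : Poly3 k) : deg (-f) = deg f := by simp [deg]

theorem deg_sub_le (f g : Poly3 k) : deg (f - g) ≤ max (deg f) (deg g) := by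
  simpa [sub_eq_add_neg] using deg_add_le f (-g)

theorem deg_add_eq_left {f g : Poly3 k} (h : deg g < deg f) : deg (f + g) = deg f := by
  refine le_antisymm ((deg_add_le f g).trans (max_le le_rfl h.le)) ?_
  have := deg_sub_le (f + g) g
  rw [add_sub_cancel_right] at this
  rcases le_max_iff.1 this with h' | h'
  · exact h'
  · exact absurd h' h.not_ge

theorem deg_add_eq_right {f g : Poly3 k} (h : deg f < deg g) : deg (f + g) = deg g := by
  rw [add_comm, deg_add_eq_left h]

open Classical in
/-- The coefficient of `f` at the monomial of weight `r`. -/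
noncomputable def cf (r : ℝ) : Poly3 k →ₗ[k] k :=
  if h : ∃ m, (wt m : ℝ) = r then lcoeff k h.choose else 0

theorem cf_wt (m : Fin 3 →₀ ℕ) (f : Poly3 k) : cf (wt m) f = coeff m f := by
  have h : ∃ n, ((wt n : NNReal) : ℝ) = wt m := ⟨m, rfl⟩
  have h2 : h.choose = m := wt_injective (NNReal.coe_injective h.choose_spec)
  rw [cf, dif_pos h, h2, lcoeff_apply]

theorem cf_of_not {r : ℝ} (h : ¬ ∃ m, (wt m : ℝ) = r) (f : Poly3 k) : cf r f = 0 := by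
  rw [cf, dif_neg h]; rfl

theorem le_deg_of_cf_ne {f : Poly3 k} {r : ℝ} (h : cf r f ≠ 0) : r ≤ deg f := by
  by_cases hr : ∃ m, (wt m : ℝ) = r
  · obtain ⟨m, rfl⟩ := hr
    exact wt_le_deg (by rwa [cf_wt] at h)
  · exact absurd (cf_of_not hr f) h

theorem cf_eq_zero_of_lt {f : Poly3 k} {r : ℝ} (h : deg f < r) : cf r f = 0 := by
  by_contra h'
  exact absurd (le_deg_of_cf_ne h') h.not_ge

theorem exists_wt_eq_of_cf_ne {f : Poly3 k} {r : ℝ} (h : cf r f ≠ 0) : ∃ m, (wt m : ℝ) = r := by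
  by_contra hr
  exact h (cf_of_not hr f)

theorem cf_deg_ne {f : Poly3 k} (h : f ≠ 0) : cf (deg f) f ≠ 0 := by
  obtain ⟨m, hm, h2⟩ := exists_deg_eq h
  rwa [h2, cf_wt]

theorem deg_lt_of_cf_eq_zero {f : Poly3 k} {r : ℝ} (h : deg f ≤ r) (h0 : cf r f = 0) (hr : 0 < r) :
    deg f < r := by
  refine lt_of_le_of_ne h fun h' => ?_
  have hf : f ≠ 0 := by rintro rfl; simp at h'; exact hr.ne h'
  exact cf_deg_ne hf (h'.symm ▸ h0)

theorem cf_mul {f g : Poly3 k} {r s : ℝ} (hf : deg f ≤ r) (hg : deg g ≤ s) :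
    cf (r + s) (f * g) = cf r f * cf s g := by
  classical
  have key : ∀ m : Fin 3 →₀ ℕ, (wt m : ℝ) = r + s → ∀ p ∈ Finset.HasAntidiagonal.antidiagonal m,
      coeff p.1 f * coeff p.2 g ≠ 0 → (wt p.1 : ℝ) = r ∧ (wt p.2 : ℝ) = s := by
    intro m hm p hp h
    have h1 := wt_le_deg (left_ne_zero_of_mul h)
    have h2 := wt_le_deg (right_ne_zero_of_mul h)
    have h3 : (wt p.1 : ℝ) + wt p.2 = r + s := by
      rw [← hm, ← Finset.HasAntidiagonal.mem_antidiagonal.1 hp, wt_add]; push_cast; rfl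
    constructor <;> linarith
  by_cases hr : ∃ m, (wt m : ℝ) = r
  · by_cases hs : ∃ m, (wt m : ℝ) = s
    · obtain ⟨m, rfl⟩ := hr
      obtain ⟨n, rfl⟩ := hs
      rw [← NNReal.coe_add, ← wt_add, cf_wt, cf_wt, cf_wt, coeff_mul]
      refine Finset.sum_eq_single (m, n) (fun p hp hne => ?_) fun h => ?_
      · by_contra h
        obtain ⟨h1, h2⟩ := key (m + n) (by rw [wt_add]; push_cast; rfl) p hp h
        exact hne (Prod.ext (wt_injective (NNReal.coe_injective h1))
          (wt_injective (NNReal.coe_injective h2)))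
      · simp at h
    · rw [cf_of_not hs, mul_zero]
      by_contra h
      obtain ⟨m, hm⟩ := exists_wt_eq_of_cf_ne h
      rw [← hm, cf_wt, coeff_mul] at h
      obtain ⟨p, hp, h1⟩ := Finset.exists_ne_zero_of_sum_ne_zero h
      exact hs ⟨_, (key m hm p hp h1).2⟩
  · rw [cf_of_not hr, zero_mul]
    by_contra h
    obtain ⟨m, hm⟩ := exists_wt_eq_of_cf_ne h
    rw [← hm, cf_wt, coeff_mul] at h
    obtain ⟨p, hp, h1⟩ := Finset.exists_ne_zero_of_sum_ne_zero h
    exact hr ⟨_, (key m hm p hp h1).1⟩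

theorem deg_mul_le (f g : Poly3 k) : deg (f * g) ≤ deg f + deg g := by
  classical
  refine (deg_le_iff (add_nonneg (deg_nonneg f) (deg_nonneg g))).2 fun m hm => ?_
  rw [coeff_mul] at hm
  obtain ⟨p, hp, h1⟩ := Finset.exists_ne_zero_of_sum_ne_zero hm
  rw [← Finset.HasAntidiagonal.mem_antidiagonal.1 hp, wt_add]
  push_cast
  exact add_le_add (wt_le_deg (left_ne_zero_of_mul h1)) (wt_le_deg (right_ne_zero_of_mul h1))

theorem deg_mul {f g : Poly3 k} (hf : f ≠ 0) (hg : g ≠ 0) : deg (f * g) = deg f + deg g := by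
  refine le_antisymm (deg_mul_le f g) (le_deg_of_cf_ne ?_)
  rw [cf_mul le_rfl le_rfl]
  exact mul_ne_zero (cf_deg_ne hf) (cf_deg_ne hg)

theorem deg_pow_le (f : Poly3 k) (n : ℕ) : deg (f ^ n) ≤ n * deg f := by
  induction n with
  | zero => simp
  | succ n ih =>
    rw [pow_succ]
    refine (deg_mul_le _ _).trans ?_
    push_cast
    linarith

theorem cf_pow {f : Poly3 k} {r : ℝ} (hf : deg f ≤ r) (n : ℕ) :
    cf (n * r) (f ^ n) = cf r f ^ n := by
  induction n with
  | zero =>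
    have := cf_wt 0 (1 : Poly3 k)
    simpa using this
  | succ n ih =>
    have h : deg (f ^ n) ≤ n * r :=
      (deg_pow_le f n).trans (mul_le_mul_of_nonneg_left hf (Nat.cast_nonneg n))
    rw [pow_succ, pow_succ, ← ih, ← cf_mul h hf]
    congr 1
    congr 1
    push_cast
    ring

theorem deg_pow {f : Poly3 k} (hf : f ≠ 0) (n : ℕ) : deg (f ^ n) = n * deg f := by
  refine le_antisymm (deg_pow_le f n) (le_deg_of_cf_ne ?_)
  rw [cf_pow le_rfl]
  exact pow_ne_zero _ (cf_deg_ne hf)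

theorem deg_smul {f : Poly3 k} {a : k} (ha : a ≠ 0) : deg (a • f) = deg f := by
  by_cases hf : f = 0
  · simp [hf]
  · rw [smul_eq_C_mul, deg_mul (by simpa using ha) hf, deg_C, zero_add]

theorem deg_smul_le (a : k) (f : Poly3 k) : deg (a • f) ≤ deg f := by
  by_cases ha : a = 0
  · simp [ha, deg_nonneg]
  · rw [deg_smul ha]

theorem ne_zero_of_deg_pos {f : Poly3 k} (h : 0 < deg f) : f ≠ 0 := by
  rintro rfl
  simp at h

theorem exists_smul_deg_lt {f g : Poly3 k} (h : deg f = deg g) (hg : 0 < deg g) :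
    ∃ a : k, a ≠ 0 ∧ deg (f + a • g) < deg g := by
  have h1 := cf_deg_ne (ne_zero_of_deg_pos hg)
  have h2 := cf_deg_ne (ne_zero_of_deg_pos (h ▸ hg : 0 < deg f))
  rw [h] at h2
  refine ⟨-(cf (deg g) f / cf (deg g) g), by simp [h1, h2], deg_lt_of_cf_eq_zero ?_ ?_ hg⟩
  · exact (deg_add_le _ _).trans (max_le h.le (deg_smul_le _ _))
  · rw [map_add, map_smul]
    simp [div_mul_cancel₀ _ h1]

theorem W_two_le_deg {f : Poly3 k} (h : 0 < deg f) : (W 2 : ℝ) ≤ deg f := by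
  obtain ⟨m, -, h2⟩ := exists_deg_eq (ne_zero_of_deg_pos h)
  rw [h2] at h ⊢
  exact_mod_cast W_two_le_wt (by rintro rfl; simp at h)

theorem eq_C_of_deg_eq_zero {f : Poly3 k} (h : deg f = 0) : f = C (coeff 0 f) := by
  ext m
  rw [coeff_C]
  split_ifs with h0
  · rw [h0]
  · by_contra h1
    have h2 := wt_le_deg h1
    have h3 : (W 2 : ℝ) ≤ wt m := by exact_mod_cast W_two_le_wt (Ne.symm h0)
    have h4 : (1 : ℝ) ≤ W 2 := by exact_mod_cast one_le_W 2
    linarith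

/-- The possible values of `deg` below a given bound are finite in number. -/
theorem finite_wt_le (r : ℝ) : {s : ℝ | s ≤ r ∧ ∃ m, (wt m : ℝ) = s}.Finite := by
  have h : {m : Fin 3 →₀ ℕ | (wt m : ℝ) ≤ r}.Finite := by
    refine Set.Finite.subset (Finset.finite_toSet
      (Finset.Iic (Finsupp.equivFunOnFinite.symm fun _ : Fin 3 => ⌈r⌉₊))) fun m hm => ?_
    simp only [Finset.coe_Iic, Set.mem_Iic]
    intro i
    have h1 : (m i : ℝ) * W i ≤ wt m := by exact_mod_cast wt_ge m i
    have h2 : (1 : ℝ) ≤ W i := by exact_mod_cast one_le_W i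
    have h3 : (m i : ℝ) ≤ r := by
      have : (0 : ℝ) ≤ m i := Nat.cast_nonneg _
      have : (wt m : ℝ) ≤ r := hm
      nlinarith
    have h4 := h3.trans (Nat.le_ceil r)
    simpa using (by exact_mod_cast h4 : m i ≤ ⌈r⌉₊)
  refine (h.image fun m => (wt m : ℝ)).subset ?_
  rintro s ⟨h1, m, rfl⟩
  exact ⟨m, h1, rfl⟩

theorem deg_mem_values (f : Poly3 k) : ∃ m, (wt m : ℝ) = deg f := by
  by_cases hf : f = 0
  · exact ⟨0, by simp [hf]⟩
  · obtain ⟨m, -, h⟩ := exists_deg_eq hf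
    exact ⟨m, h.symm⟩

end

section

open Matrix
variable {k : Type} [Field k]

/-- The logarithmic gradient `(x_i ∂f/∂x_i)_i`. -/
noncomputable def grad (f : Poly3 k) : Fin 3 → Poly3 k := fun i => X i * pderiv i f

theorem coeff_grad (f : Poly3 k) (i : Fin 3) (m : Fin 3 →₀ ℕ) :
    coeff m (grad f i) = m i * coeff m f := by
  induction f using MvPolynomial.induction_on' with
  | monomial s a =>
    rw [grad, X_mul_pderiv_monomial, coeff_smul, coeff_monomial]
    split_ifs with h
    · simp [h]
    · simp
  | add p q hp hq =>
    simp only [grad] at hp hq ⊢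
    rw [map_add, mul_add, coeff_add, coeff_add, hp, hq]
    ring

@[simp] theorem grad_C (a : k) : grad (C a : Poly3 k) = 0 := by
  ext1 i; simp [grad]

theorem grad_add (f g : Poly3 k) : grad (f + g) = grad f + grad g := by
  ext1 i; simp [grad, mul_add]

theorem grad_smul (a : k) (f : Poly3 k) : grad (a • f) = (C a : Poly3 k) • grad f := by
  ext1 i; simp [grad, smul_eq_C_mul]; ring

theorem grad_mul (f g : Poly3 k) : grad (f * g) = f • grad g + g • grad f := by
  ext1 i; simp [grad]; ring

theorem deg_grad_le (f : Poly3 k) (i : Fin 3) : deg (grad f i) ≤ deg f := by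
  refine (deg_le_iff (deg_nonneg f)).2 fun m hm => wt_le_deg ?_
  rw [coeff_grad] at hm
  exact right_ne_zero_of_mul hm

/-- The maximal degree of the coordinates of a vector of polynomials. -/
noncomputable def vd (v : Fin 3 → Poly3 k) : ℝ := max (deg (v 0)) (max (deg (v 1)) (deg (v 2)))

theorem vd_le_iff {v : Fin 3 → Poly3 k} {r : ℝ} : vd v ≤ r ↔ ∀ i, deg (v i) ≤ r := by
  simp [vd, Fin.forall_fin_succ]

theorem deg_le_vd (v : Fin 3 → Poly3 k) (i : Fin 3) : deg (v i) ≤ vd v := vd_le_iff.1 le_rfl i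

theorem vd_nonneg (v : Fin 3 → Poly3 k) : 0 ≤ vd v := (deg_nonneg _).trans (deg_le_vd v 0)

theorem exists_vd_eq (v : Fin 3 → Poly3 k) : ∃ i, vd v = deg (v i) := by
  by_contra! h
  have h' : ∀ i, deg (v i) < vd v := fun i => lt_of_le_of_ne (deg_le_vd v i) (h i).symm
  have : vd v < vd v := max_lt (h' 0) (max_lt (h' 1) (h' 2))
  exact this.false

@[simp] theorem vd_zero : vd (0 : Fin 3 → Poly3 k) = 0 := by simp [vd]

@[simp] theorem vd_neg (v : Fin 3 → Poly3 k) : vd (-v) = vd v := by simp [vd]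

theorem vd_add_le (u v : Fin 3 → Poly3 k) : vd (u + v) ≤ max (vd u) (vd v) :=
  vd_le_iff.2 fun i => (deg_add_le _ _).trans (max_le_max (deg_le_vd u i) (deg_le_vd v i))

theorem vd_add_eq_left {u v : Fin 3 → Poly3 k} (h : vd v < vd u) : vd (u + v) = vd u := by
  refine le_antisymm ((vd_add_le u v).trans (max_le le_rfl h.le)) ?_
  have := vd_add_le (u + v) (-v)
  rw [add_neg_cancel_right, vd_neg] at this
  rcases le_max_iff.1 this with h' | h'
  · exact h'
  · exact absurd h' h.not_ge

theorem vd_add_eq_right {u v : Fin 3 → Poly3 k} (h : vd u < vd v) : vd (u + v) = vd v := by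
  rw [add_comm, vd_add_eq_left h]

theorem vd_smul_le (f : Poly3 k) (v : Fin 3 → Poly3 k) : vd (f • v) ≤ deg f + vd v :=
  vd_le_iff.2 fun i => (deg_mul_le _ _).trans (by have := deg_le_vd v i; simp [this])

theorem vd_smul {f : Poly3 k} {v : Fin 3 → Poly3 k} (hf : f ≠ 0) (hv : 0 < vd v) :
    vd (f • v) = deg f + vd v := by
  refine le_antisymm (vd_smul_le f v) ?_
  obtain ⟨i, hi⟩ := exists_vd_eq v
  rw [hi] at hv ⊢
  rw [← deg_mul hf (ne_zero_of_deg_pos hv)]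
  exact deg_le_vd (f • v) i

theorem vd_C_smul_le (a : k) (v : Fin 3 → Poly3 k) : vd ((C a : Poly3 k) • v) ≤ vd v := by
  simpa using vd_smul_le (C a) v

theorem deg_dot_le (u v : Fin 3 → Poly3 k) : deg (u ⬝ᵥ v) ≤ vd u + vd v := by
  have h : ∀ i, deg (u i * v i) ≤ vd u + vd v := fun i =>
    (deg_mul_le _ _).trans (add_le_add (deg_le_vd u i) (deg_le_vd v i))
  rw [vec3_dotProduct]
  exact (deg_add_le _ _).trans (max_le ((deg_add_le _ _).trans (max_le (h 0) (h 1))) (h 2))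

theorem vd_cross_le (u v : Fin 3 → Poly3 k) : vd (u ⨯₃ v) ≤ vd u + vd v := by
  have h : ∀ i j, deg (u i * v j) ≤ vd u + vd v := fun i j =>
    (deg_mul_le _ _).trans (add_le_add (deg_le_vd u i) (deg_le_vd v j))
  rw [cross_apply, vd_le_iff]
  intro i
  fin_cases i <;> exact (deg_sub_le _ _).trans (max_le (h _ _) (h _ _))

theorem vd_grad_le (f : Poly3 k) : vd (grad f) ≤ deg f := vd_le_iff.2 (deg_grad_le f)

/-- The cross product of the gradients. -/
noncomputable def cr (f g : Poly3 k) : Fin 3 → Poly3 k := grad f ⨯₃ grad g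

/-- The degree of the cross product of the gradients. -/
noncomputable def D (f g : Poly3 k) : ℝ := vd (cr f g)

theorem cr_anticomm (f g : Poly3 k) : cr f g = - cr g f := (cross_anticomm _ _).symm

@[simp] theorem cr_self (f : Poly3 k) : cr f f = 0 := cross_self _

theorem D_comm (f g : Poly3 k) : D f g = D g f := by
  rw [D, cr_anticomm, vd_neg]; rfl

theorem D_nonneg (f g : Poly3 k) : 0 ≤ D f g := vd_nonneg _

theorem D_le (f g : Poly3 k) : D f g ≤ deg f + deg g :=
  (vd_cross_le _ _).trans (add_le_add (vd_grad_le f) (vd_grad_le g))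

theorem cr_add_left (f g h : Poly3 k) : cr (f + g) h = cr f h + cr g h := by
  simp [cr, grad_add]

theorem cr_add_right (f g h : Poly3 k) : cr h (f + g) = cr h f + cr h g := by
  simp [cr, grad_add]

theorem cr_smul_left (a : k) (f g : Poly3 k) : cr (a • f) g = (C a : Poly3 k) • cr f g := by
  simp [cr, grad_smul]

theorem cr_smul_right (a : k) (f g : Poly3 k) : cr f (a • g) = (C a : Poly3 k) • cr f g := by
  simp [cr, grad_smul]

@[simp] theorem cr_C_left (a : k) (g : Poly3 k) : cr (C a) g = 0 := by simp [cr]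

@[simp] theorem cr_C_right (a : k) (g : Poly3 k) : cr g (C a) = 0 := by simp [cr]

/-- The sum of the weights of the variables. -/
noncomputable def Wt : ℝ := W 0 + W 1 + W 2

theorem three_le_Wt : 3 ≤ Wt := by
  have h0 : (1 : ℝ) ≤ W 0 := by exact_mod_cast one_le_W 0
  have h1 : (1 : ℝ) ≤ W 1 := by exact_mod_cast one_le_W 1
  have h2 : (1 : ℝ) ≤ W 2 := by exact_mod_cast one_le_W 2
  simp only [Wt]; linarith

/-- The Jacobian determinant of `a, b, c` is a nonzero constant. -/
def Keller (a b c : Poly3 k) : Prop :=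
  ∃ u : k, u ≠ 0 ∧ grad a ⬝ᵥ cr b c = C u * (X 0 * X 1 * X 2)

theorem Keller.rot {a b c : Poly3 k} (h : Keller a b c) : Keller b c a := by
  obtain ⟨u, hu, h⟩ := h
  exact ⟨u, hu, by rw [← h]; exact (triple_product_permutation _ _ _).symm⟩

theorem Keller.swap {a b c : Poly3 k} (h : Keller a b c) : Keller a c b := by
  obtain ⟨u, hu, h⟩ := h
  exact ⟨-u, by simpa using hu, by rw [cr_anticomm, dotProduct_neg, h]; simp⟩

theorem grad_of_mem_adjoin {b c ψ : Poly3 k} (h : ψ ∈ Algebra.adjoin k {b, c}) :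
    ∃ P Q : Poly3 k, grad ψ = P • grad b + Q • grad c := by
  induction h using Algebra.adjoin_induction with
  | mem x hx =>
    rcases hx with rfl | rfl
    · exact ⟨1, 0, by simp⟩
    · exact ⟨0, 1, by simp⟩
  | algebraMap r => exact ⟨0, 0, by simp [algebraMap_eq]⟩
  | add x y _ _ hx hy =>
    obtain ⟨P, Q, h1⟩ := hx
    obtain ⟨P', Q', h2⟩ := hy
    exact ⟨P + P', Q + Q', by rw [grad_add, h1, h2]; module⟩
  | mul x y _ _ hx hy =>
    obtain ⟨P, Q, h1⟩ := hx
    obtain ⟨P', Q', h2⟩ := hy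
    exact ⟨x * P' + y * P, x * Q' + y * Q, by rw [grad_mul, h1, h2]; module⟩

theorem Keller.add_left {a b c ψ : Poly3 k} (h : Keller a b c)
    (hψ : ψ ∈ Algebra.adjoin k {b, c}) : Keller (a + ψ) b c := by
  obtain ⟨u, hu, h⟩ := h
  obtain ⟨P, Q, hPQ⟩ := grad_of_mem_adjoin hψ
  refine ⟨u, hu, ?_⟩
  rw [← h, grad_add, hPQ, add_dotProduct, add_dotProduct, smul_dotProduct, smul_dotProduct,
    cr, dot_self_cross, dot_cross_self]
  simp

theorem Keller.smul_left {a b c : Poly3 k} {r : k} (hr : r ≠ 0) (h : Keller a b c) :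
    Keller (r • a) b c := by
  obtain ⟨u, hu, h⟩ := h
  refine ⟨r * u, mul_ne_zero hr hu, ?_⟩
  rw [grad_smul, smul_dotProduct, h, C_mul, smul_eq_mul]
  ring

theorem deg_XXX : deg (X 0 * X 1 * X 2 : Poly3 k) = Wt := by
  rw [deg_mul (mul_ne_zero (X_ne_zero _) (X_ne_zero _)) (X_ne_zero _),
    deg_mul (X_ne_zero _) (X_ne_zero _), deg_X, deg_X, deg_X, Wt]

theorem deg_C_mul_XXX {u : k} (hu : u ≠ 0) : deg (C u * (X 0 * X 1 * X 2) : Poly3 k) = Wt := by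
  rw [← smul_eq_C_mul, deg_smul hu, deg_XXX]

theorem Keller.Wt_le {a b c : Poly3 k} (h : Keller a b c) : Wt ≤ deg a + D b c := by
  obtain ⟨u, hu, h⟩ := h
  rw [← deg_C_mul_XXX hu, ← h]
  exact (deg_dot_le _ _).trans (add_le_add (vd_grad_le a) le_rfl)

theorem Keller.deg_pos {a b c : Poly3 k} (h : Keller a b c) : 0 < deg a := by
  refine lt_of_le_of_ne (deg_nonneg a) fun h0 => ?_
  obtain ⟨u, hu, h⟩ := h
  rw [eq_C_of_deg_eq_zero h0.symm, grad_C, zero_dotProduct] at h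
  have h1 := deg_C_mul_XXX hu
  rw [← h, deg_zero] at h1
  have := three_le_Wt
  linarith

theorem Keller.D_pos {a b c : Poly3 k} (h : Keller a b c) : 0 < D b c := by
  refine lt_of_le_of_ne (D_nonneg b c) fun h0 => ?_
  have hz : cr b c = 0 := by
    have hc : ∀ i, deg (cr b c i) = 0 := fun i =>
      le_antisymm ((deg_le_vd _ i).trans h0.symm.le) (deg_nonneg _)
    ext1 i
    rw [eq_C_of_deg_eq_zero (hc i)]
    have : coeff 0 (cr b c i) = 0 := by
      have hg : ∀ j (f : Poly3 k), coeff 0 (grad f j) = 0 := fun j f => by simp [coeff_grad]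
      have hm : ∀ j l, coeff 0 (grad b j * grad c l) = 0 := fun j l => by
        rw [← constantCoeff_eq, map_mul, constantCoeff_eq, hg, zero_mul]
      rw [cr, cross_apply]
      fin_cases i <;> simp [hm]
    rw [this]; simp
  obtain ⟨u, hu, h⟩ := h
  rw [hz, dotProduct_zero] at h
  have h1 := deg_C_mul_XXX hu
  rw [← h, deg_zero] at h1
  have := three_le_Wt
  linarith

section CharZero
variable [CharZero k]

theorem deg_sum_grad {f : Poly3 k} : deg (grad f 0 + grad f 1 + grad f 2) = deg f := by
  have hc : ∀ m, coeff m (grad f 0 + grad f 1 + grad f 2)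
      = ((m 0 + m 1 + m 2 : ℕ) : k) * coeff m f := fun m => by
    simp only [coeff_add, coeff_grad]; push_cast; ring
  refine le_antisymm ((deg_le_iff (deg_nonneg f)).2 fun m hm => wt_le_deg ?_)
    ((deg_le_iff (deg_nonneg _)).2 fun m hm => ?_)
  · rw [hc] at hm
    exact right_ne_zero_of_mul hm
  · by_cases h0 : m = 0
    · simp [h0, deg_nonneg]
    · refine wt_le_deg ?_
      rw [hc]
      refine mul_ne_zero (Nat.cast_ne_zero.2 fun h => h0 ?_) hm
      ext i
      fin_cases i <;> simp <;> omega

/-- Among `deg a + D b c`, `deg b + D a c`, `deg c + D a b`, the maximum is attained twice. -/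
theorem Keller.two_max {a b c : Poly3 k} (h : Keller a b c) :
    deg a + D b c ≤ max (deg b + D a c) (deg c + D a b) := by
  by_contra! hlt
  obtain ⟨hl1, hl2⟩ := max_lt_iff.1 hlt
  have hb := h.rot.swap.Wt_le
  set E : Poly3 k → Poly3 k := fun f => grad f 0 + grad f 1 + grad f 2 with hE
  have key : (grad a ⬝ᵥ cr b c) • (1 : Fin 3 → Poly3 k)
      = E a • cr b c + (E b • cr c a + E c • cr a b) := by
    ext1 i
    simp only [hE, cr, cross_apply, vec3_dotProduct]
    fin_cases i <;> simp <;> ring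
  have h1 : vd ((grad a ⬝ᵥ cr b c) • (1 : Fin 3 → Poly3 k)) = Wt := by
    obtain ⟨u, hu, h⟩ := h
    rw [h]
    simp [vd, deg_C_mul_XXX hu]
  have h2 : vd (E a • cr b c) = deg a + D b c := by
    rw [vd_smul _ h.D_pos, hE, deg_sum_grad]; rfl
    refine ne_zero_of_deg_pos ?_
    rw [hE, deg_sum_grad]; exact h.deg_pos
  have h3 : vd (E b • cr c a) ≤ deg b + D a c := by
    refine (vd_smul_le _ _).trans ?_
    rw [hE, deg_sum_grad, D_comm]; rfl
  have h4 : vd (E c • cr a b) ≤ deg c + D a b := by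
    refine (vd_smul_le _ _).trans ?_
    rw [hE, deg_sum_grad]; rfl
  rw [key, vd_add_eq_left, h2] at h1
  · linarith
  · rw [h2]
    exact (vd_add_le _ _).trans_lt (max_lt (h3.trans_lt hl1) (h4.trans_lt hl2))

end CharZero

/-- The chain rule for polynomials in two elements. -/
theorem grad_aeval (b c : Poly3 k) (φ : MvPolynomial (Fin 2) k) :
    grad (aeval ![b, c] φ) = aeval ![b, c] (pderiv 0 φ) • grad b
      + aeval ![b, c] (pderiv 1 φ) • grad c := by
  induction φ using MvPolynomial.induction_on with
  | C a => simp [algebraMap_eq]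
  | add p q hp hq => simp only [map_add, grad_add, hp, hq]; module
  | mul_X p i hp =>
    rw [map_mul, grad_mul, hp]
    fin_cases i <;> simp [pderiv_X] <;> module

theorem cr_aeval_right (b c : Poly3 k) (φ : MvPolynomial (Fin 2) k) :
    cr (aeval ![b, c] φ) c = aeval ![b, c] (pderiv 0 φ) • cr b c := by
  rw [cr, grad_aeval]
  simp [cr]

/-- A lower bound on the degree of `ψ(b, c)` in terms of a partial derivative. -/
theorem deg_pderiv_le {b c : Poly3 k} (hD : 0 < D b c) (φ : MvPolynomial (Fin 2) k)
    (h : aeval ![b, c] (pderiv 0 φ) ≠ 0) :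
    deg (aeval ![b, c] (pderiv 0 φ)) + D b c ≤ deg (aeval ![b, c] φ) + deg c := by
  rw [D, ← vd_smul h hD, ← cr_aeval_right]
  exact D_le _ _

theorem Keller.deg_pderiv_le {a b c : Poly3 k} (hK : Keller a b c) (φ : MvPolynomial (Fin 2) k)
    (h : aeval ![b, c] (pderiv 0 φ) ≠ 0) :
    deg (aeval ![b, c] (pderiv 0 φ)) + Wt ≤ deg (aeval ![b, c] φ) + D c a := by
  obtain ⟨u, hu, hK⟩ := hK.rot
  have h1 : grad (aeval ![b, c] φ) ⬝ᵥ cr c a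
      = aeval ![b, c] (pderiv 0 φ) * (C u * (X 0 * X 1 * X 2)) := by
    rw [← hK, grad_aeval, add_dotProduct, smul_dotProduct, smul_dotProduct, cr, dot_self_cross]
    simp
  have h2 : deg (C u * (X 0 * X 1 * X 2) : Poly3 k) = Wt := deg_C_mul_XXX hu
  rw [← h2, ← deg_mul h (ne_zero_of_deg_pos (by rw [h2]; linarith [three_le_Wt])), ← h1]
  exact (deg_dot_le _ _).trans (add_le_add (vd_grad_le _) le_rfl)

end

section

variable {k : Type} [Field k]

theorem add_mul_le_natDegree [CharZero k] {l : k} (hl : l ≠ 0) (p j : ℕ) :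
    ∀ (a : ℕ) (T : Polynomial k), T ≠ 0 → (Polynomial.X - Polynomial.C l) ^ j ∣ T →
      (∀ i, T.coeff i ≠ 0 → ∃ n, i = a + p * n) → a + j * p ≤ T.natDegree := by
  induction j with
  | zero =>
    intro a T h0 _ h
    obtain ⟨n, hn⟩ := h _ (Polynomial.leadingCoeff_ne_zero.2 h0)
    rw [hn]; simp
  | succ j ih =>
    intro a T h0 hd h
    set S : Polynomial k := Polynomial.X * T.derivative - Polynomial.C (a : k) * T with hS
    have hc : ∀ i, S.coeff i = ((i : k) - a) * T.coeff i := by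
      intro i
      rw [hS, Polynomial.coeff_sub, Polynomial.coeff_C_mul]
      cases i with
      | zero => simp
      | succ i => rw [Polynomial.coeff_X_mul, Polynomial.coeff_derivative]; push_cast; ring
    have hS0 : S ≠ 0 := by
      intro hz
      have hT : ∀ i, i ≠ a → T.coeff i = 0 := by
        intro i hi
        have := hc i
        rw [hz, Polynomial.coeff_zero] at this
        rcases mul_eq_zero.1 this.symm with h1 | h1
        · exact absurd (by exact_mod_cast sub_eq_zero.1 h1) hi
        · exact h1
      have hT' : T = Polynomial.monomial a (T.coeff a) := by
        ext i
        rw [Polynomial.coeff_monomial]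
        split_ifs with h1
        · rw [h1]
        · exact hT i (Ne.symm h1)
      have hev : T.eval l = 0 := by
        obtain ⟨Q, hQ⟩ := (dvd_pow_self _ (Nat.succ_ne_zero j)).trans hd
        rw [hQ]; simp
      rw [hT', Polynomial.eval_monomial] at hev
      rcases mul_eq_zero.1 hev with h1 | h1
      · rw [h1] at hT'; exact h0 (by simpa using hT')
      · exact pow_ne_zero _ hl h1
    have hdS : (Polynomial.X - Polynomial.C l) ^ j ∣ S := by
      refine dvd_sub (Dvd.dvd.mul_left ?_ _)
        (Dvd.dvd.mul_left ((pow_dvd_pow _ j.le_succ).trans hd) _)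
      obtain ⟨Q, rfl⟩ := hd
      rw [Polynomial.derivative_mul, Polynomial.derivative_X_sub_C_pow]
      refine dvd_add (Dvd.dvd.mul_right (Dvd.intro_left _ (by rw [Nat.add_sub_cancel])) _)
        (Dvd.dvd.mul_right (pow_dvd_pow _ j.le_succ) _)
    have hle := ih (a + p) S hS0 hdS fun i hi => by
      rw [hc] at hi
      obtain ⟨n, rfl⟩ := h i (right_ne_zero_of_mul hi)
      cases n with
      | zero => simp at hi
      | succ n => exact ⟨n, by ring⟩
    have hnd : S.natDegree ≤ T.natDegree :=
        Polynomial.natDegree_le_iff_coeff_eq_zero.2 fun i hi => by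
      rw [hc, Polynomial.coeff_eq_zero_of_natDegree_lt hi, mul_zero]
    rw [Nat.succ_mul]
    omega

/-- The weight of a monomial in two variables, given weights of these variables. -/
noncomputable def wq (β γ : ℝ) (m : Fin 2 →₀ ℕ) : ℝ := m 0 * β + m 1 * γ

open Classical in
/-- The part of weight `r` of a polynomial, evaluated at `l` in the second variable. -/
noncomputable def top (β γ : ℝ) (l : k) (r : ℝ) : MvPolynomial (Fin 2) k →ₗ[k] Polynomial k :=
  (basisMonomials (Fin 2) k).constr k fun m =>
    if wq β γ m = r then Polynomial.monomial (m 0) (l ^ m 1) else 0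

open Classical in
theorem top_monomial (β γ : ℝ) (l : k) (r : ℝ) (m : Fin 2 →₀ ℕ) (a : k) :
    top β γ l r (monomial m a)
      = if wq β γ m = r then Polynomial.monomial (m 0) (a * l ^ m 1) else 0 := by
  have h : monomial m a = a • basisMonomials (Fin 2) k m := by
    simp [smul_monomial]
  rw [h, map_smul, top, Module.Basis.constr_basis]
  split_ifs <;> simp [Polynomial.smul_monomial]

theorem top_pderiv (β γ : ℝ) (l : k) (r : ℝ) (φ : MvPolynomial (Fin 2) k) :
    top β γ l (r - β) (pderiv 0 φ) = Polynomial.derivative (top β γ l r φ) := by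
  classical
  induction φ using MvPolynomial.induction_on' with
  | add p q hp hq => simp only [map_add, hp, hq]
  | monomial m a =>
    rw [pderiv_monomial, top_monomial, top_monomial]
    by_cases h0 : m 0 = 0
    · rw [apply_ite Polynomial.derivative, Polynomial.derivative_monomial]
      simp [h0]
    · have hw : wq β γ (m - Finsupp.single 0 1) = wq β γ m - β := by
        have h1 : ((m 0 - 1 : ℕ) : ℝ) = m 0 - 1 := by
          rw [Nat.cast_sub (Nat.one_le_iff_ne_zero.2 h0)]; simp
        simp [wq, h1]; ring
      rw [hw]
      by_cases h : wq β γ m = r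
      · rw [if_pos (by rw [h]), if_pos h, Polynomial.derivative_monomial]
        simp; congr 1; ring
      · rw [if_neg (fun h' => h (sub_left_injective h')), if_neg h, map_zero]

theorem coeff_top {β γ : ℝ} (hγ : 0 < γ) (l : k) (φ : MvPolynomial (Fin 2) k) (m : Fin 2 →₀ ℕ) :
    (top β γ l (wq β γ m) φ).coeff (m 0) = coeff m φ * l ^ m 1 := by
  classical
  induction φ using MvPolynomial.induction_on' with
  | add p q hp hq => rw [map_add, Polynomial.coeff_add, hp, hq, coeff_add, add_mul]
  | monomial n a =>
    rw [top_monomial, coeff_monomial]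
    by_cases h : n = m
    · simp [h]
    · rw [if_neg h, zero_mul]
      split_ifs with h1
      · rw [Polynomial.coeff_monomial, if_neg]
        intro h0
        refine h ?_
        have h2 : n 1 = m 1 := by
          simp only [wq, h0] at h1
          have := mul_right_cancel₀ hγ.ne' (add_left_cancel h1)
          exact_mod_cast this
        ext i; fin_cases i <;> assumption
      · simp

theorem exists_of_coeff_top {β γ : ℝ} {l : k} {r : ℝ} {φ : MvPolynomial (Fin 2) k} {i : ℕ}
    (h : (top β γ l r φ).coeff i ≠ 0) : ∃ m : Fin 2 →₀ ℕ, m 0 = i ∧ wq β γ m = r := by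
  classical
  by_contra! hm
  refine h ?_
  clear h
  induction φ using MvPolynomial.induction_on' with
  | add p q hp hq => rw [map_add, Polynomial.coeff_add, hp, hq, add_zero]
  | monomial n a =>
    rw [top_monomial]
    split_ifs with h1
    · rw [Polynomial.coeff_monomial, if_neg fun h0 => hm n h0 h1]
    · simp

theorem cf_aeval {b c : Poly3 k} {φ : MvPolynomial (Fin 2) k} {r : ℝ} (hr : 0 ≤ r)
    (h : ∀ m, coeff m φ ≠ 0 → wq (deg b) (deg c) m ≤ r) :
    deg (aeval ![b, c] φ) ≤ r ∧ cf r (aeval ![b, c] φ)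
      = (top (deg b) (deg c) (cf (deg c) c) r φ).eval (cf (deg b) b) := by
  classical
  have key : ∀ s : Finset (Fin 2 →₀ ℕ), (∀ m ∈ s, wq (deg b) (deg c) m ≤ r) →
      deg (aeval ![b, c] (∑ m ∈ s, monomial m (coeff m φ))) ≤ r ∧
      cf r (aeval ![b, c] (∑ m ∈ s, monomial m (coeff m φ)))
      = (top (deg b) (deg c) (cf (deg c) c) r (∑ m ∈ s, monomial m (coeff m φ))).eval
        (cf (deg b) b) := by
    intro s
    induction s using Finset.induction_on with
    | empty => intro _; simp [hr]
    | insert m s hms ih =>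
      intro hs
      obtain ⟨h1, h2⟩ := ih fun n hn => hs n (Finset.mem_insert_of_mem hn)
      have hm := hs m (Finset.mem_insert_self _ _)
      set x := aeval ![b, c] (monomial m (coeff m φ)) with hx
      have hx' : x = coeff m φ • (b ^ m 0 * c ^ m 1) := by
        rw [hx, aeval_monomial, Finsupp.prod_fintype _ _ (fun _ => pow_zero _)]
        simp [algebraMap_eq, smul_eq_C_mul]
      have hb := deg_pow_le b (m 0)
      have hc := deg_pow_le c (m 1)
      have hdeg : deg x ≤ wq (deg b) (deg c) m := by
        rw [hx']
        exact (deg_smul_le _ _).trans ((deg_mul_le _ _).trans (add_le_add hb hc))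
      rw [Finset.sum_insert hms, map_add, map_add, map_add, Polynomial.eval_add, ← h2, ← hx]
      refine ⟨(deg_add_le _ _).trans (max_le (hdeg.trans hm) h1), ?_⟩
      congr 1
      rw [top_monomial]
      split_ifs with hr'
      · rw [hx', ← hr', map_smul, wq, cf_mul hb hc, cf_pow le_rfl, cf_pow le_rfl,
          Polynomial.eval_monomial, smul_eq_mul]
        ring
      · rw [Polynomial.eval_zero]
        exact cf_eq_zero_of_lt (lt_of_le_of_lt hdeg (lt_of_le_of_ne hm hr'))
  have := key φ.support fun m hm => h m (by simpa using hm)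
  rwa [support_sum_monomial_coeff] at this

theorem wq_pderiv_le {β γ r : ℝ} {φ : MvPolynomial (Fin 2) k}
    (h : ∀ m, coeff m φ ≠ 0 → wq β γ m ≤ r) (m : Fin 2 →₀ ℕ) (hm : coeff m (pderiv 0 φ) ≠ 0) :
    wq β γ m ≤ r - β := by
  rw [coeff_pderiv] at hm
  have := h _ (left_ne_zero_of_mul hm)
  simp [wq] at this ⊢
  linarith

/-- The case of no cancellation: all monomials of `φ` have weight at most `deg φ(b, c)`. -/
def NType (b c : Poly3 k) (φ : MvPolynomial (Fin 2) k) : Prop :=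
  ∀ m, coeff m φ ≠ 0 → wq (deg b) (deg c) m ≤ deg (aeval ![b, c] φ)

theorem aeval_pderiv_iterate {b c : Poly3 k} (hD : 0 < D b c) (n : ℕ) :
    ∀ φ : MvPolynomial (Fin 2) k, aeval ![b, c] ((pderiv 0)^[n] φ) ≠ 0 →
      aeval ![b, c] φ ≠ 0 ∧
      deg (aeval ![b, c] ((pderiv 0)^[n] φ)) + n * (D b c - deg c) ≤ deg (aeval ![b, c] φ) := by
  induction n with
  | zero => intro φ h; exact ⟨h, by simp⟩
  | succ n ih =>
    intro φ h
    rw [Function.iterate_succ_apply] at h ⊢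
    obtain ⟨h1, h2⟩ := ih _ h
    have h3 := deg_pderiv_le hD φ h1
    refine ⟨fun h0 => ?_, by push_cast; linarith⟩
    have h4 := cr_aeval_right b c φ
    have h5 := vd_smul h1 (show 0 < vd (cr b c) from hD)
    rw [← h4, h0, ← C_0, cr_C_left, vd_zero] at h5
    have := deg_nonneg (aeval ![b, c] (pderiv 0 φ))
    have : 0 < vd (cr b c) := hD
    linarith

set_option maxHeartbeats 1000000 in
theorem exists_coprime_of_not_nType [CharZero k] {b c : Poly3 k} (hb : 0 < deg b) (hc : 0 < deg c)
    (hD : 0 < D b c) {φ : MvPolynomial (Fin 2) k} (hφ : ¬ NType b c φ) :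
    ∃ p q : ℕ, 0 < p ∧ 0 < q ∧ p.Coprime q ∧ p * deg b = q * deg c ∧
      p * deg b + D b c ≤ deg (aeval ![b, c] φ) + deg b + deg c ∧
      (2 ≤ p → 2 ≤ q → p * deg b ≤ deg (aeval ![b, c] (pderiv 0 φ)) + deg b) := by
  obtain ⟨m₀, hm₀, hlt⟩ : ∃ m, coeff m φ ≠ 0 ∧ deg (aeval ![b, c] φ) < wq (deg b) (deg c) m := by
    simpa [NType] using hφ
  obtain ⟨m, hm, hmax⟩ := Finset.exists_max_image φ.support (wq (deg b) (deg c))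
    ⟨m₀, by simpa using hm₀⟩
  have hmax' : ∀ n, coeff n φ ≠ 0 → wq (deg b) (deg c) n ≤ wq (deg b) (deg c) m :=
    fun n hn => hmax n (by simpa using hn)
  rw [mem_support_iff] at hm
  set N := wq (deg b) (deg c) m with hN
  set lb := cf (deg b) b
  set lc := cf (deg c) c
  have hlb : lb ≠ 0 := cf_deg_ne (ne_zero_of_deg_pos hb)
  have hlc : lc ≠ 0 := cf_deg_ne (ne_zero_of_deg_pos hc)
  have hNpos : 0 ≤ N := by rw [hN, wq]; positivity
  obtain ⟨-, hcf⟩ := cf_aeval hNpos hmax'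
  set T := top (deg b) (deg c) lc N φ with hT
  have hT0 : T ≠ 0 := by
    intro h0
    have := coeff_top hc lc φ m (β := deg b)
    rw [← hN, ← hT, h0, Polynomial.coeff_zero] at this
    exact mul_ne_zero hm (pow_ne_zero _ hlc) this.symm
  have hev : T.eval lb = 0 := by
    by_contra h0
    rw [← hcf] at h0
    exact absurd (le_deg_of_cf_ne h0) (hlt.trans_le (hmax' _ hm₀)).not_ge
  set j := T.rootMultiplicity lb with hj
  have hj1 : 1 ≤ j := (Polynomial.rootMultiplicity_pos hT0).2 hev
  -- the `j`-th derivative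
  have hit : ∀ n : ℕ, top (deg b) (deg c) lc (N - n * deg b) ((pderiv 0)^[n] φ)
      = Polynomial.derivative^[n] T ∧
      ∀ m, coeff m ((pderiv 0)^[n] φ) ≠ 0 → wq (deg b) (deg c) m ≤ N - n * deg b := by
    intro n
    induction n with
    | zero => exact ⟨by simp [hT], by simpa using hmax'⟩
    | succ n ih =>
      have he : N - (n + 1 : ℕ) * deg b = N - n * deg b - deg b := by push_cast; ring
      rw [Function.iterate_succ_apply', Function.iterate_succ_apply', ← ih.1, he, top_pderiv]
      exact ⟨rfl, wq_pderiv_le ih.2⟩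
  obtain ⟨hitj, hwj⟩ := hit j
  have hevj : (Polynomial.derivative^[j] T).eval lb ≠ 0 := by
    rw [hj, Polynomial.eval_iterate_derivative_rootMultiplicity, nsmul_eq_mul]
    exact mul_ne_zero (by exact_mod_cast Nat.factorial_ne_zero _)
      (Polynomial.eval_divByMonic_pow_rootMultiplicity_ne_zero _ hT0)
  -- two distinct exponents in `T`
  have htwo : ∃ i₁ i₂, i₁ < i₂ ∧ T.coeff i₁ ≠ 0 ∧ T.coeff i₂ ≠ 0 := by
    by_contra! hcon
    have hmono : T = Polynomial.monomial T.natDegree (T.coeff T.natDegree) := by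
      ext i
      rw [Polynomial.coeff_monomial]
      split_ifs with h1
      · rw [h1]
      · rcases lt_or_gt_of_ne h1 with h2 | h2
        · exact Polynomial.coeff_eq_zero_of_natDegree_lt h2
        · by_contra h3
          exact Polynomial.leadingCoeff_ne_zero.2 hT0 (hcon i _ h2 h3)
    rw [hmono, Polynomial.eval_monomial] at hev
    exact mul_ne_zero (Polynomial.leadingCoeff_ne_zero.2 hT0) (pow_ne_zero _ hlb) hev
  obtain ⟨i₁, i₂, hi, hi₁, hi₂⟩ := htwo
  have hdiff : ∀ i i', i ≤ i' → T.coeff i ≠ 0 → T.coeff i' ≠ 0 →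
      ∃ n : ℕ, ((i' - i : ℕ) : ℝ) * deg b = n * deg c := by
    intro i i' hii hi hi'
    obtain ⟨n, rfl, hn⟩ := exists_of_coeff_top hi
    obtain ⟨n', rfl, hn'⟩ := exists_of_coeff_top hi'
    have he : wq (deg b) (deg c) n = wq (deg b) (deg c) n' := hn.trans hn'.symm
    simp only [wq] at he
    have h1 : ((n 0 : ℕ) : ℝ) ≤ n' 0 := by exact_mod_cast hii
    have hle : n' 1 ≤ n 1 := by
      by_contra! h2
      have h3 : ((n 1 : ℕ) : ℝ) < n' 1 := by exact_mod_cast h2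
      nlinarith
    refine ⟨n 1 - n' 1, ?_⟩
    rw [Nat.cast_sub hii, Nat.cast_sub hle]
    linarith
  obtain ⟨n₀, hn₀⟩ := hdiff i₁ i₂ hi.le hi₁ hi₂
  obtain ⟨g, p, q, hg, hcop, hp, hq⟩ := Nat.exists_coprime' (m := i₂ - i₁) (n := n₀)
    (Nat.gcd_pos_of_pos_left _ (by omega))
  have hp0 : 0 < p := by
    rcases Nat.eq_zero_or_pos p with h | h
    · subst h; omega
    · exact h
  have hpq : p * deg b = q * deg c := by
    rw [hp, hq] at hn₀
    push_cast at hn₀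
    have : (0 : ℝ) < g := by exact_mod_cast hg
    apply mul_right_cancel₀ this.ne'
    linarith
  have hq0 : 0 < q := by
    rcases Nat.eq_zero_or_pos q with h | h
    · subst h
      simp [hp0.ne', hb.ne'] at hpq
    · exact h
  have hsupp : ∀ i, T.coeff i ≠ 0 → ∃ n, i = T.natTrailingDegree + p * n := by
    intro i hi
    have hle := Polynomial.natTrailingDegree_le_of_ne_zero hi
    obtain ⟨n, hn⟩ := hdiff _ _ hle (Polynomial.trailingCoeff_nonzero_iff_nonzero.2 hT0) hi
    have h1 : ((i - T.natTrailingDegree : ℕ) : ℝ) * q = n * p := by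
      have h2 : (((i - T.natTrailingDegree : ℕ) : ℝ) * q) * (deg c) = (n * p) * deg c := by
        have : p * deg b * (i - T.natTrailingDegree : ℕ)
          = q * deg c * ((i - T.natTrailingDegree : ℕ) : ℝ) := by rw [hpq]
        linear_combination -this + p * hn
      exact mul_right_cancel₀ hc.ne' h2
    have h2 : (i - T.natTrailingDegree) * q = n * p := by exact_mod_cast h1
    obtain ⟨n', hn'⟩ := hcop.dvd_of_dvd_mul_right (Dvd.intro_left _ h2.symm)
    exact ⟨n', by omega⟩
  have hjp : j * p ≤ T.natDegree := by
    have := add_mul_le_natDegree hlb p j _ T hT0 (Polynomial.pow_rootMultiplicity_dvd T lb) hsupp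
    omega
  have hNj : j * (p * deg b) ≤ N := by
    obtain ⟨n, hn, hn'⟩ := exists_of_coeff_top (Polynomial.leadingCoeff_ne_zero.2 hT0)
    rw [← hn']
    simp only [wq, hn]
    have h1 : ((j * p : ℕ) : ℝ) ≤ T.natDegree := by exact_mod_cast hjp
    push_cast at h1
    have : 0 ≤ (n 1 : ℝ) * deg c := by positivity
    nlinarith
  have hj1' : (1 : ℝ) ≤ j := by exact_mod_cast hj1
  have hjb : 0 ≤ N - j * deg b := by
    have : (1 : ℝ) ≤ p := by exact_mod_cast hp0
    have : (j : ℝ) * deg b ≤ j * (p * deg b) := by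
      apply mul_le_mul_of_nonneg_left _ (by positivity)
      nlinarith
    linarith
  have hcfj : cf (N - j * deg b) (aeval ![b, c] ((pderiv 0)^[j] φ)) ≠ 0 := by
    rw [(cf_aeval hjb hwj).2, hitj]
    exact hevj
  have hnej : aeval ![b, c] ((pderiv 0)^[j] φ) ≠ 0 := by
    intro h; rw [h, map_zero] at hcfj; exact hcfj rfl
  have hdegj := le_deg_of_cf_ne hcfj
  refine ⟨p, q, hp0, hq0, hcop, hpq, ?_, fun hp2 hq2 => ?_⟩
  · have h1 := (aeval_pderiv_iterate hD j φ hnej).2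
    by_cases hneg : p * deg b + D b c - deg b - deg c ≤ 0
    · linarith [deg_nonneg (aeval ![b, c] φ)]
    · push Not at hneg
      have : j * (p * deg b + D b c - deg b - deg c) ≤ deg (aeval ![b, c] φ) := by linarith
      nlinarith
  · have hjs : j = (j - 1) + 1 := by omega
    rw [hjs, Function.iterate_succ_apply] at hnej hdegj
    have h1 := (aeval_pderiv_iterate hD (j - 1) (pderiv 0 φ) hnej).2
    rw [Nat.cast_sub hj1] at h1
    have hp2' : (2 : ℝ) ≤ p := by exact_mod_cast hp2
    have hq2' : (2 : ℝ) ≤ q := by exact_mod_cast hq2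
    have e1 : 2 * deg b ≤ p * deg b := by nlinarith
    have e2 : 2 * deg c ≤ p * deg b := by rw [hpq]; nlinarith
    have e3 : 0 ≤ (j - 1 : ℝ) * (p * deg b - deg b - deg c + D b c) :=
      mul_nonneg (by linarith) (by linarith)
    push_cast at h1 hdegj
    rw [Nat.cast_sub hj1] at hdegj
    push_cast at h1 hdegj
    nlinarith

end

section

variable {k : Type} [Field k]

/-- No cancellation occurs in `ψ` as a polynomial in `b` and `c`. -/
def NT (b c ψ : Poly3 k) : Prop :=
  (∀ P : Submodule k (Poly3 k),
    (∀ i j : ℕ, i * deg b + j * deg c ≤ deg ψ → b ^ i * c ^ j ∈ P) → ψ ∈ P) ∧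
  ∃ i j : ℕ, i * deg b + j * deg c = deg ψ

/-- Cancellation in `ψ` as a polynomial in `b` and `c` and its consequences;
`a` completes `b, c` to a Keller triple. -/
def CT (a b c ψ : Poly3 k) : Prop :=
  ∃ p q : ℕ, 0 < p ∧ 0 < q ∧ p.Coprime q ∧ p * deg b = q * deg c ∧
    p * deg b + D b c ≤ deg ψ + deg b + deg c ∧
    (2 ≤ p → 2 ≤ q → p * deg b + Wt ≤ deg ψ + deg b + D a c ∧
      p * deg b + Wt ≤ deg ψ + deg c + D a b)

theorem aeval_monomial_two (b c : Poly3 k) (m : Fin 2 →₀ ℕ) (r : k) :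
    aeval ![b, c] (monomial m r) = r • (b ^ m 0 * c ^ m 1) := by
  rw [aeval_monomial, Finsupp.prod_fintype _ _ (fun _ => pow_zero _)]
  simp [algebraMap_eq, smul_eq_C_mul]

theorem NType.nt {b c : Poly3 k} {φ : MvPolynomial (Fin 2) k} (h : NType b c φ) :
    NT b c (aeval ![b, c] φ) := by
  constructor
  · intro P hP
    rw [← support_sum_monomial_coeff φ, map_sum]
    refine Submodule.sum_mem _ fun m hm => ?_
    rw [aeval_monomial_two]
    exact P.smul_mem _ (hP _ _ (h m (by simpa using hm)))
  · by_cases h0 : φ = 0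
    · exact ⟨0, 0, by simp [h0]⟩
    · obtain ⟨m, hm, hmax⟩ := Finset.exists_max_image φ.support (wq (deg b) (deg c))
        (by simpa using h0)
      refine ⟨m 0, m 1, le_antisymm (h m (by simpa using hm)) ?_⟩
      refine (cf_aeval ?_ fun n hn => hmax n (by simpa using hn)).1
      have := deg_nonneg b
      have := deg_nonneg c
      rw [wq]; positivity

theorem aeval_rename_swap (b c : Poly3 k) (φ : MvPolynomial (Fin 2) k) :
    aeval ![c, b] (rename (Equiv.swap 0 1) φ) = aeval ![b, c] φ := by
  rw [aeval_rename]
  congr 2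
  ext i
  fin_cases i <;> simp

theorem NType.of_rename {b c : Poly3 k} {φ : MvPolynomial (Fin 2) k}
    (h : NType c b (rename (Equiv.swap 0 1) φ)) : NType b c φ := by
  intro m hm
  have := h (m.mapDomain (Equiv.swap 0 1))
    (by rwa [coeff_rename_mapDomain _ (Equiv.injective _)])
  rw [aeval_rename_swap] at this
  refine le_trans (le_of_eq ?_) this
  have h0 := Finsupp.mapDomain_apply (Equiv.injective (Equiv.swap (0 : Fin 2) 1)) m 0
  have h1 := Finsupp.mapDomain_apply (Equiv.injective (Equiv.swap (0 : Fin 2) 1)) m 1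
  rw [Equiv.swap_apply_left] at h0
  rw [Equiv.swap_apply_right] at h1
  rw [wq, wq, h0, h1, add_comm]

theorem exists_aeval_of_mem_adjoin {b c ψ : Poly3 k} (h : ψ ∈ Algebra.adjoin k {b, c}) :
    ∃ φ : MvPolynomial (Fin 2) k, aeval ![b, c] φ = ψ := by
  have : Set.range ![b, c] = {b, c} := by
    simp [Matrix.range_cons, Set.pair_comm]
  rw [← this, Algebra.adjoin_range_eq_range_aeval] at h
  exact h

theorem Keller.nt_or_ct [CharZero k] {a b c ψ : Poly3 k} (h : Keller a b c)
    (hψ : ψ ∈ Algebra.adjoin k {b, c}) : NT b c ψ ∨ CT a b c ψ := by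
  obtain ⟨φ, rfl⟩ := exists_aeval_of_mem_adjoin hψ
  by_cases hN : NType b c φ
  · exact Or.inl hN.nt
  right
  have hb := h.rot.deg_pos
  have hc := h.rot.rot.deg_pos
  have hD := h.D_pos
  obtain ⟨p, q, hp, hq, hcop, hpq, h1, h2⟩ := exists_coprime_of_not_nType hb hc hD hN
  have hN' : ¬ NType c b (rename (Equiv.swap 0 1) φ) := fun h' => hN h'.of_rename
  obtain ⟨q', p', hq', hp', hcop', hpq', -, h2'⟩ :=
    exists_coprime_of_not_nType hc hb (by rwa [D_comm]) hN'
  have e : p * q' = p' * q := by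
    have : (p * q' : ℝ) * deg b = (p' * q) * deg b := by
      linear_combination q' * hpq + q * hpq'
    exact_mod_cast mul_right_cancel₀ hb.ne' this
  have e1 : p ∣ p' := hcop.dvd_of_dvd_mul_right (Dvd.intro _ e)
  have e2 : p' ∣ p := hcop'.symm.dvd_of_dvd_mul_right (Dvd.intro _ e.symm)
  obtain rfl : p = p' := Nat.dvd_antisymm e1 e2
  obtain rfl : q' = q := Nat.eq_of_mul_eq_mul_left hp e
  refine ⟨p, q', hp, hq, hcop, hpq, h1, fun hp2 hq2 => ⟨?_, ?_⟩⟩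
  · have h3 := h2 hp2 hq2
    have hne : aeval ![b, c] (pderiv 0 φ) ≠ 0 := by
      refine ne_zero_of_deg_pos ?_
      have : (2 : ℝ) ≤ p := by exact_mod_cast hp2
      nlinarith
    have := h.deg_pderiv_le φ hne
    rw [D_comm c a] at this
    linarith
  · have h3 := h2' hq2 hp2
    have hne : aeval ![c, b] (pderiv 0 (rename (Equiv.swap 0 1) φ)) ≠ 0 := by
      refine ne_zero_of_deg_pos ?_
      have : (2 : ℝ) ≤ q' := by exact_mod_cast hq2
      nlinarith
    have := h.swap.deg_pderiv_le _ hne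
    rw [D_comm b a, aeval_rename_swap] at this
    linarith

/-- The span of `1, b, c`. -/
noncomputable def Pl (b c : Poly3 k) : Submodule k (Poly3 k) := Submodule.span k {1, b, c}

/-- The span of `1, a, b, c`. -/
noncomputable def Sp (a b c : Poly3 k) : Submodule k (Poly3 k) := Submodule.span k {1, a, b, c}

theorem mem_Pl {b c v : Poly3 k} : v ∈ Pl b c ↔ ∃ r y z : k, v = C r + y • b + z • c := by
  simp only [Pl, Submodule.mem_span_insert, Submodule.mem_span_singleton]
  constructor
  · rintro ⟨r, _, ⟨y, _, ⟨z, rfl⟩, rfl⟩, rfl⟩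
    exact ⟨r, y, z, by rw [smul_eq_C_mul, mul_one, add_assoc]⟩
  · rintro ⟨r, y, z, rfl⟩
    exact ⟨r, _, ⟨y, _, ⟨z, rfl⟩, rfl⟩, by
      rw [← mul_one (C r), ← smul_eq_C_mul, add_assoc]⟩

theorem Sp_eq_sup (a b c : Poly3 k) : Sp a b c = Submodule.span k {a} ⊔ Pl b c := by
  rw [Sp, Pl, ← Submodule.span_union]
  congr 1
  ext x; simp; tauto

theorem mem_Sp_iff {a b c v : Poly3 k} : v ∈ Sp a b c ↔ ∃ x : k, v - x • a ∈ Pl b c := by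
  rw [Sp_eq_sup, Submodule.mem_sup]
  constructor
  · rintro ⟨y, hy, z, hz, rfl⟩
    obtain ⟨x, rfl⟩ := Submodule.mem_span_singleton.1 hy
    exact ⟨x, by simpa using hz⟩
  · rintro ⟨x, hx⟩
    exact ⟨x • a, Submodule.mem_span_singleton.2 ⟨x, rfl⟩, _, hx, by abel⟩

theorem mem_Sp {a b c v : Poly3 k} :
    v ∈ Sp a b c ↔ ∃ r x y z : k, v = C r + x • a + y • b + z • c := by
  rw [mem_Sp_iff]
  constructor
  · rintro ⟨x, hx⟩
    obtain ⟨r, y, z, h⟩ := mem_Pl.1 hx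
    exact ⟨r, x, y, z, by rw [← sub_add_cancel v (x • a), h]; abel⟩
  · rintro ⟨r, x, y, z, rfl⟩
    exact ⟨x, mem_Pl.2 ⟨r, y, z, by abel⟩⟩

theorem Pl_comm (b c : Poly3 k) : Pl b c = Pl c b := by
  rw [Pl, Pl, Set.pair_comm]

theorem Sp_swap (a b c : Poly3 k) : Sp a b c = Sp a c b := by
  rw [Sp, Sp, Set.pair_comm]

theorem Sp_swap' (a b c : Poly3 k) : Sp a b c = Sp b a c := by
  rw [Sp, Sp, Set.insert_comm a b]

theorem Sp_rot (a b c : Poly3 k) : Sp a b c = Sp b c a := by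
  rw [Sp_swap', Sp_swap]

theorem C_mem_Pl (r : k) (b c : Poly3 k) : C r ∈ Pl b c := mem_Pl.2 ⟨r, 0, 0, by simp⟩
theorem left_mem_Pl (b c : Poly3 k) : b ∈ Pl b c := mem_Pl.2 ⟨0, 1, 0, by simp⟩
theorem right_mem_Pl (b c : Poly3 k) : c ∈ Pl b c := mem_Pl.2 ⟨0, 0, 1, by simp⟩

theorem Pl_le_Sp (a b c : Poly3 k) : Pl b c ≤ Sp a b c := by
  rw [Sp_eq_sup]; exact le_sup_right

theorem left_mem_Sp (a b c : Poly3 k) : a ∈ Sp a b c := mem_Sp.2 ⟨0, 1, 0, 0, by simp⟩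
theorem mid_mem_Sp (a b c : Poly3 k) : b ∈ Sp a b c := Pl_le_Sp a b c (left_mem_Pl b c)
theorem right_mem_Sp (a b c : Poly3 k) : c ∈ Sp a b c := Pl_le_Sp a b c (right_mem_Pl b c)

theorem Pl_le {b c : Poly3 k} {P : Submodule k (Poly3 k)} (h1 : 1 ∈ P) (hb : b ∈ P) (hc : c ∈ P) :
    Pl b c ≤ P := by
  rw [Pl, Submodule.span_le]
  rintro x (rfl | rfl | rfl) <;> assumption

theorem one_mem_Pl (b c : Poly3 k) : 1 ∈ Pl b c := by simpa using C_mem_Pl 1 b c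

theorem Sp_eq_Sp {a b c a' b' c' : Poly3 k} (hP : Pl b c = Pl b' c') {x : k} (hx : x ≠ 0)
    (h : a - x • a' ∈ Pl b c) : Sp a b c = Sp a' b' c' := by
  rw [Sp_eq_sup, Sp_eq_sup, ← hP]
  apply le_antisymm
  · refine sup_le ?_ le_sup_right
    rw [Submodule.span_singleton_le_iff_mem, ← sub_add_cancel a (x • a')]
    exact add_mem (Submodule.mem_sup_right h)
      (Submodule.mem_sup_left (Submodule.smul_mem _ _ (Submodule.mem_span_singleton_self _)))
  · refine sup_le ?_ le_sup_right
    rw [Submodule.span_singleton_le_iff_mem]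
    have : a' = x⁻¹ • a - x⁻¹ • (a - x • a') := by
      rw [smul_sub, inv_smul_smul₀ hx]; abel
    rw [this]
    exact sub_mem
      (Submodule.mem_sup_left (Submodule.smul_mem _ _ (Submodule.mem_span_singleton_self _)))
      (Submodule.mem_sup_right (Submodule.smul_mem _ _ h))

theorem Sp_add {a b c l : Poly3 k} (hl : l ∈ Pl b c) : Sp (a + l) b c = Sp a b c :=
  Sp_eq_Sp rfl one_ne_zero (by simpa using hl)

theorem Pl_eq_Pl {b c b' : Poly3 k} {x : k} (hx : x ≠ 0) (z : k) (r : k)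
    (h : b' = x • b + z • c + C r) : Pl b' c = Pl b c := by
  apply le_antisymm
  · refine Pl_le (one_mem_Pl _ _) ?_ (right_mem_Pl _ _)
    exact mem_Pl.2 ⟨r, x, z, by rw [h]; abel⟩
  · refine Pl_le (one_mem_Pl _ _) ?_ (right_mem_Pl _ _)
    refine mem_Pl.2 ⟨-(x⁻¹ * r), x⁻¹, -(x⁻¹ * z), ?_⟩
    simp only [h, smul_eq_C_mul, mul_add, ← mul_assoc, ← C_mul, inv_mul_cancel₀ hx, C_neg, C_1]
    ring

theorem Pl_le_adjoin (b c : Poly3 k) : Pl b c ≤ (Algebra.adjoin k {b, c}).toSubmodule := by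
  refine Pl_le (Subalgebra.one_mem _) ?_ ?_ <;> exact Algebra.subset_adjoin (by simp)

theorem adjoin_le_of_Pl {b c : Poly3 k} {S : Subalgebra k (Poly3 k)}
    (h : Pl b c ≤ S.toSubmodule) : Algebra.adjoin k {b, c} ≤ S := by
  refine Algebra.adjoin_le ?_
  rintro x (rfl | rfl)
  · exact h (left_mem_Pl _ _)
  · exact h (right_mem_Pl _ _)

theorem adjoin_eq_of_Pl {b c b' c' : Poly3 k} (h : Pl b c = Pl b' c') :
    Algebra.adjoin k {b, c} = Algebra.adjoin k {b', c'} :=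
  le_antisymm (adjoin_le_of_Pl (h ▸ Pl_le_adjoin _ _)) (adjoin_le_of_Pl (h ▸ Pl_le_adjoin _ _))

/-- A Keller triple with pairwise distinct degrees. -/
def Good (a b c : Poly3 k) : Prop :=
  Keller a b c ∧ deg a ≠ deg b ∧ deg a ≠ deg c ∧ deg b ≠ deg c

theorem Good.swap {a b c : Poly3 k} (h : Good a b c) : Good a c b :=
  ⟨h.1.swap, h.2.2.1, h.2.1, h.2.2.2.symm⟩

theorem Good.rot {a b c : Poly3 k} (h : Good a b c) : Good b c a :=
  ⟨h.1.rot, h.2.2.2, h.2.1.symm, h.2.2.1.symm⟩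

theorem deg_add_eq_max {f g : Poly3 k} (h : deg f = deg g → f = 0 ∨ g = 0) :
    deg (f + g) = max (deg f) (deg g) := by
  rcases lt_trichotomy (deg f) (deg g) with h1 | h1 | h1
  · rw [deg_add_eq_right h1, max_eq_right h1.le]
  · rcases h h1 with rfl | rfl
    · simp [deg_nonneg]
    · simp [deg_nonneg]
  · rw [deg_add_eq_left h1, max_eq_left h1.le]

theorem deg_add_C (f : Poly3 k) (r : k) : deg (f + C r) = deg f := by
  rcases (deg_nonneg f).eq_or_lt with h | h
  · rw [eq_C_of_deg_eq_zero h.symm, ← C_add, deg_C, deg_C]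
  · exact deg_add_eq_left (by simpa using h)

theorem deg_smul_add_smul {b c : Poly3 k} (h : deg b ≠ deg c) (y z : k) :
    deg (y • b + z • c) = max (deg (y • b)) (deg (z • c)) := by
  refine deg_add_eq_max fun h1 => ?_
  by_cases hy : y = 0
  · simp [hy]
  · by_cases hz : z = 0
    · simp [hz]
    · rw [deg_smul hy, deg_smul hz] at h1
      exact absurd h1 h

theorem Good.deg_combo {a b c : Poly3 k} (h : Good a b c) (r x y z : k) :
    deg (C r + x • a + y • b + z • c)
      = max (deg (x • a)) (max (deg (y • b)) (deg (z • c))) := by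
  have e : C r + x • a + y • b + z • c = x • a + (y • b + z • c) + C r := by abel
  have hb := h.1.rot.deg_pos
  have hc := h.1.rot.rot.deg_pos
  rw [e, deg_add_C, ← deg_smul_add_smul h.2.2.2]
  refine deg_add_eq_max fun h1 => ?_
  by_cases hx : x = 0
  · simp [hx]
  right
  rw [deg_smul hx, deg_smul_add_smul h.2.2.2] at h1
  have ha := h.1.deg_pos
  by_cases hy : y = 0
  · by_cases hz : z = 0
    · simp [hy, hz]
    · rw [hy, deg_smul hz] at h1
      simp [hc.le] at h1
      exact absurd h1 h.2.2.1
  · by_cases hz : z = 0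
    · rw [hz, deg_smul hy] at h1
      simp [hb.le] at h1
      exact absurd h1 h.2.1
    · rw [deg_smul hy, deg_smul hz] at h1
      rcases max_choice (deg b) (deg c) with h2 | h2 <;> rw [h2] at h1
      · exact absurd h1 h.2.1
      · exact absurd h1 h.2.2.1

theorem Good.deg_image {a b c : Poly3 k} (h : Good a b c) :
    deg '' (Sp a b c : Set (Poly3 k)) = {0, deg a, deg b, deg c} := by
  ext s
  constructor
  · rintro ⟨v, hv, rfl⟩
    obtain ⟨r, x, y, z, rfl⟩ := mem_Sp.1 hv
    rw [h.deg_combo]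
    have key : ∀ (x : k) (f : Poly3 k), deg (x • f) = 0 ∨ deg (x • f) = deg f := fun x f => by
      by_cases hx : x = 0
      · simp [hx]
      · exact Or.inr (deg_smul hx)
    rcases max_choice (deg (x • a)) (max (deg (y • b)) (deg (z • c))) with h1 | h1 <;> rw [h1]
    · rcases key x a with h | h <;> simp [h]
    · rcases max_choice (deg (y • b)) (deg (z • c)) with h1 | h1 <;> rw [h1]
      · rcases key y b with h | h <;> simp [h]
      · rcases key z c with h | h <;> simp [h]
  · rintro (rfl | rfl | rfl | rfl)
    · exact ⟨0, zero_mem _, deg_zero⟩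
    · exact ⟨a, left_mem_Sp _ _ _, rfl⟩
    · exact ⟨b, mid_mem_Sp _ _ _, rfl⟩
    · exact ⟨c, right_mem_Sp _ _ _, rfl⟩

/-- The sum of the degrees attained on a subspace. -/
noncomputable def vdeg (V : Submodule k (Poly3 k)) : ℝ := ∑ᶠ s ∈ deg '' (V : Set (Poly3 k)), s

theorem Good.vdeg_eq {a b c : Poly3 k} (h : Good a b c) :
    vdeg (Sp a b c) = deg a + deg b + deg c := by
  classical
  have ha := h.1.deg_pos
  have hb := h.1.rot.deg_pos
  have hc := h.1.rot.rot.deg_pos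
  obtain ⟨h1, h2, h3⟩ := h.2
  have : ({0, deg a, deg b, deg c} : Set ℝ) = (({0, deg a, deg b, deg c} : Finset ℝ) : Set ℝ) := by
    simp
  rw [vdeg, h.deg_image, this, finsum_mem_coe_finset, Finset.sum_insert, Finset.sum_insert,
    Finset.sum_insert, Finset.sum_singleton]
  · ring
  · simpa using h3
  · simp [h1, h2]
  · simp [ha.ne, hb.ne, hc.ne]

theorem Keller.exists_good_left {a b c : Poly3 k} (h : Keller a b c) (hbc : deg b ≠ deg c) :
    ∃ l ∈ Pl b c, deg (a + l) ≤ deg a ∧ Good (a + l) b c := by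
  have hK : ∀ l ∈ Pl b c, Keller (a + l) b c := fun l hl => h.add_left (Pl_le_adjoin b c hl)
  have hb := h.rot.deg_pos
  have hc := h.rot.rot.deg_pos
  -- lower the degree once, then again
  have key : ∀ b c : Poly3 k, 0 < deg b → 0 < deg c → deg c < deg b →
      ∃ l ∈ Pl b c, deg (a + l) ≤ deg a ∧ deg (a + l) ≠ deg b ∧ deg (a + l) ≠ deg c := by
    intro b c hb hc hbc
    have h1 : ∃ y : k, deg (a + y • b) ≤ deg a ∧ deg (a + y • b) ≠ deg b := by
      by_cases hab : deg a = deg b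
      · obtain ⟨y, -, hy⟩ := exists_smul_deg_lt hab hb
        exact ⟨y, by linarith, hy.ne⟩
      · exact ⟨0, by simp, by simpa using hab⟩
    obtain ⟨y, hy1, hy2⟩ := h1
    by_cases hac : deg (a + y • b) = deg c
    · obtain ⟨z, -, hz⟩ := exists_smul_deg_lt hac hc
      rw [add_assoc] at hz
      exact ⟨y • b + z • c, mem_Pl.2 ⟨0, y, z, by simp⟩, by linarith, by linarith, hz.ne⟩
    · exact ⟨y • b, mem_Pl.2 ⟨0, y, 0, by simp⟩, hy1, hy2, hac⟩
  rcases lt_or_gt_of_ne hbc with hlt | hlt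
  · obtain ⟨l, hl, h1, h2, h3⟩ := key c b hc hb hlt
    rw [Pl_comm] at hl
    exact ⟨l, hl, h1, hK l hl, h3, h2, hbc⟩
  · obtain ⟨l, hl, h1, h2, h3⟩ := key b c hb hc hlt
    exact ⟨l, hl, h1, hK l hl, h2, h3, hbc⟩

theorem Keller.of_Pl_eq {a b c b' : Poly3 k} {x : k} (hx : x ≠ 0) (z : k) (r : k)
    (h : Keller a b c) (h' : b' = x • b + z • c + C r) : Keller a b' c := by
  have h1 := (h.rot.smul_left hx).add_left (ψ := z • c + C r)
    (Pl_le_adjoin c a (mem_Pl.2 ⟨r, z, 0, by simp [add_comm]⟩))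
  rw [← add_assoc, ← h'] at h1
  exact h1.rot.rot

theorem Keller.exists_mid {a b c : Poly3 k} (h : Keller a b c) :
    ∃ y : k, deg (b + y • c) ≤ deg b ∧ Keller a (b + y • c) c ∧ deg (b + y • c) ≠ deg c ∧
      Pl (b + y • c) c = Pl b c := by
  have hK : ∀ y : k, Keller a (b + y • c) c ∧ Pl (b + y • c) c = Pl b c := fun y =>
    ⟨h.of_Pl_eq one_ne_zero y 0 (by simp), Pl_eq_Pl one_ne_zero y 0 (by simp)⟩
  by_cases hbc : deg b = deg c
  · obtain ⟨y, -, hy⟩ := exists_smul_deg_lt hbc h.rot.rot.deg_pos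
    exact ⟨y, by linarith, (hK y).1, hy.ne, (hK y).2⟩
  · exact ⟨0, by simp, (hK 0).1, by simpa using hbc, (hK 0).2⟩

theorem Keller.vdeg_le {a b c : Poly3 k} (h : Keller a b c) :
    vdeg (Sp a b c) ≤ deg a + deg b + deg c := by
  obtain ⟨y, h1, h2, h3, h4⟩ := h.exists_mid
  obtain ⟨l, hl, h5, h6⟩ := h2.exists_good_left h3
  have : Sp a b c = Sp (a + l) (b + y • c) c :=
    (Sp_eq_Sp h4 one_ne_zero (by simpa using hl)).symm
  rw [this, h6.vdeg_eq]
  linarith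

theorem Keller.not_mem_Pl {a b c : Poly3 k} (h : Keller a b c) : a ∉ Pl b c := by
  intro hm
  have := (h.add_left (ψ := -a) (Pl_le_adjoin b c (neg_mem hm))).deg_pos
  simp at this

/-- Two subspaces spanned by `1` and three polynomials that differ by an elementary move. -/
def Nb (V V' : Submodule k (Poly3 k)) : Prop :=
  ∃ a b c ψ : Poly3 k, Keller a b c ∧ ψ ∈ Algebra.adjoin k {b, c} ∧ V = Sp a b c ∧
    V' = Sp (a + ψ) b c

theorem Nb.symm {V V' : Submodule k (Poly3 k)} (h : Nb V V') : Nb V' V := by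
  obtain ⟨a, b, c, ψ, hK, hψ, rfl, rfl⟩ := h
  exact ⟨a + ψ, b, c, -ψ, hK.add_left hψ, neg_mem hψ, rfl, by simp⟩

theorem exists_good_adapted {a b c ψ a' b' c' : Poly3 k} (hψ : ψ ∈ Algebra.adjoin k {b, c})
    (hK' : Keller a' b' c') (hbc : deg b' ≠ deg c') (hS : Sp a b c = Sp a' b' c')
    (hP : Pl b c = Pl b' c') :
    ∃ ψ' ∈ Algebra.adjoin k {b', c'}, Sp (a + ψ) b c = Sp (a' + ψ') b' c' ∧
      Good (a' + ψ') b' c' := by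
  obtain ⟨x, hx⟩ := mem_Sp_iff.1 (hS ▸ left_mem_Sp a' b' c' : a' ∈ Sp a b c)
  have hx0 : x ≠ 0 := by
    rintro rfl
    rw [hP, zero_smul, sub_zero] at hx
    exact hK'.not_mem_Pl hx
  have hψ' : x • ψ ∈ Algebra.adjoin k {b', c'} := by
    rw [← adjoin_eq_of_Pl hP]
    exact Subalgebra.smul_mem _ hψ x
  obtain ⟨l, hl, -, hG⟩ := (hK'.add_left hψ').exists_good_left hbc
  refine ⟨x • ψ + l, add_mem hψ' (Pl_le_adjoin _ _ hl), ?_, ?_⟩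
  · symm
    refine Sp_eq_Sp hP.symm hx0 ?_
    have : a' + (x • ψ + l) - x • (a + ψ) = (a' - x • a) + l := by rw [smul_add]; abel
    rw [this, ← hP]
    exact add_mem hx (hP ▸ hl)
  · rwa [← add_assoc]

end

section

variable {k : Type} [Field k]

theorem Pl_eq_of_le {a b c b' c' : Poly3 k} (h : Keller a b' c') (hle : Pl b' c' ≤ Pl b c) :
    Pl b' c' = Pl b c := by
  have key : ∀ (b c : Poly3 k) (r y z : k), y ≠ 0 → b' = C r + y • b + z • c → c' ∈ Pl b c →
      Pl b' c' = Pl b c := by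
    intro b c r y z hy hb' hc'
    have e1 : Pl b' c = Pl b c := Pl_eq_Pl hy z r (by rw [hb']; abel)
    rw [← e1] at hc' ⊢
    obtain ⟨r', y', z', hc'⟩ := mem_Pl.1 hc'
    have hz' : z' ≠ 0 := by
      rintro rfl
      exact h.rot.rot.not_mem_Pl (mem_Pl.2 ⟨r', 0, y', by rw [hc']; simp⟩)
    rw [Pl_comm, Pl_comm b' c]
    exact Pl_eq_Pl hz' y' r' (by rw [hc']; abel)
  obtain ⟨r, y, z, hb'⟩ := mem_Pl.1 (hle (left_mem_Pl b' c'))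
  have hc' := hle (right_mem_Pl b' c')
  by_cases hy : y = 0
  · have hz : z ≠ 0 := by
      rintro rfl
      have := h.rot.deg_pos
      rw [hb', hy] at this
      simp at this
    rw [Pl_comm] at hc'
    rw [key c b r z y hz (by rw [hb']; abel) hc', Pl_comm]
  · exact key b c r y z hy hb' hc'

theorem exists_mem_both {a1 b1 c1 a2 b2 c2 : Poly3 k} (h2 : Keller a2 b2 c2)
    (hS : Sp a1 b1 c1 = Sp a2 b2 c2) (hb2 : b2 ∉ Pl b1 c1) :
    ∃ c ∈ Pl b1 c1, Pl b2 c = Pl b2 c2 ∧ Keller a2 b2 c := by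
  obtain ⟨x, hx⟩ := mem_Sp_iff.1 (hS ▸ mid_mem_Sp a2 b2 c2 : b2 ∈ Sp a1 b1 c1)
  obtain ⟨x', hx'⟩ := mem_Sp_iff.1 (hS ▸ right_mem_Sp a2 b2 c2 : c2 ∈ Sp a1 b1 c1)
  have hx0 : x ≠ 0 := by
    rintro rfl
    exact hb2 (by simpa using hx)
  refine ⟨c2 + (-(x' / x)) • b2, ?_, ?_, ?_⟩
  · have := sub_mem hx' (Submodule.smul_mem _ (x' / x) hx)
    convert this using 1
    rw [smul_sub, smul_smul, div_mul_cancel₀ _ hx0, neg_smul]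
    abel
  · rw [Pl_comm, Pl_comm b2 c2]
    exact Pl_eq_Pl one_ne_zero (-(x' / x)) 0 (by simp)
  · exact (h2.swap.of_Pl_eq one_ne_zero (-(x' / x)) 0 (by simp)).swap

theorem exists_basis_with {a b1 c1 c : Poly3 k} (h : Keller a b1 c1) (hc : c ∈ Pl b1 c1)
    (hc0 : 0 < deg c) : ∃ b, Pl b c = Pl b1 c1 ∧ Keller a b c := by
  obtain ⟨r, y, z, rfl⟩ := mem_Pl.1 hc
  by_cases hy : y = 0
  · have hz : z ≠ 0 := by
      rintro rfl
      rw [hy] at hc0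
      simp at hc0
    refine ⟨b1, ?_, ?_⟩
    · rw [Pl_comm, Pl_comm b1 c1]
      exact Pl_eq_Pl hz y r (by abel)
    · exact (h.swap.of_Pl_eq hz y r (by abel)).swap
  · refine ⟨c1, ?_, ?_⟩
    · rw [Pl_comm]
      exact Pl_eq_Pl hy z r (by abel)
    · exact (h.of_Pl_eq hy z r (by abel)).swap

theorem two_planes_aux {a1 b1 c1 a2 b2 c2 : Poly3 k} (h1 : Keller a1 b1 c1)
    (h2 : Keller a2 b2 c2) (hS : Sp a1 b1 c1 = Sp a2 b2 c2) (hb2 : b2 ∉ Pl b1 c1) :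
    (∃ a b c, Good a b c ∧ Sp a b c = Sp a1 b1 c1 ∧ Pl b c = Pl b1 c1 ∧ Pl a c = Pl b2 c2) ∨
    ∃ h b c, Good h b c ∧ deg h < deg b ∧ Sp h b c = Sp a1 b1 c1 ∧ Pl b c = Pl b1 c1 ∧
      Pl (b + h) c = Pl b2 c2 := by
  obtain ⟨c, hcm, hP2, hK2⟩ := exists_mem_both h2 hS hb2
  have hc0 := hK2.rot.rot.deg_pos
  obtain ⟨b0, hP1, hK1⟩ := exists_basis_with h1 hcm hc0
  obtain ⟨y, -, hKb, hbc, hPb⟩ := hK1.exists_mid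
  obtain ⟨z, -, hKe, hec, hPe⟩ := hK2.exists_mid
  generalize b0 + y • c = b at hKb hbc hPb
  generalize b2 + z • c = e at hKe hec hPe
  rw [hP1] at hPb
  rw [hP2] at hPe
  have heS : e ∈ Sp a1 b1 c1 := by
    rw [hS]
    exact Pl_le_Sp _ _ _ (hPe ▸ left_mem_Pl e c)
  have heP : e ∉ Pl b1 c1 := by
    intro he
    apply hb2
    have : b2 ∈ Pl e c := by rw [hPe]; exact left_mem_Pl _ _
    exact Pl_le (one_mem_Pl _ _) he hcm this
  obtain ⟨x, hx⟩ := mem_Sp_iff.1 heS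
  have hx0 : x ≠ 0 := by
    rintro rfl
    exact heP (by simpa using hx)
  have hKebc : Keller e b c := by
    have := (hKb.smul_left hx0).add_left (Pl_le_adjoin b c (hPb.symm ▸ hx))
    rwa [add_sub_cancel] at this
  have hSe : Sp e b c = Sp a1 b1 c1 := Sp_eq_Sp hPb hx0 (by rwa [hPb])
  by_cases heb : deg e = deg b
  · right
    have hb0 := hKb.rot.deg_pos
    obtain ⟨κ, hκ, hlt⟩ := exists_smul_deg_lt heb hb0
    have hl : ∀ z : k, κ • b + z • c ∈ Pl b c := fun z => mem_Pl.2 ⟨0, κ, z, by simp⟩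
    have h3 : ∃ z : k, deg (e + (κ • b + z • c)) < deg b ∧ deg (e + (κ • b + z • c)) ≠ deg c := by
      by_cases hh : deg (e + κ • b) = deg c
      · obtain ⟨z, -, hz⟩ := exists_smul_deg_lt hh hc0
        rw [add_assoc] at hz
        exact ⟨z, by linarith, hz.ne⟩
      · exact ⟨0, by simpa using hlt, by simpa using hh⟩
    obtain ⟨z, hz1, hz2⟩ := h3
    have hκ' : -κ ≠ 0 := neg_ne_zero.2 hκ
    have hdb : deg ((-κ) • b) = deg b := deg_smul hκ'
    have hPb' : Pl ((-κ) • b) c = Pl b c := Pl_eq_Pl hκ' 0 0 (by simp)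
    have hKh : Keller (e + (κ • b + z • c)) b c := hKebc.add_left (Pl_le_adjoin _ _ (hl z))
    refine ⟨e + (κ • b + z • c), (-κ) • b, c, ⟨hKh.of_Pl_eq hκ' 0 0 (by simp), ?_, hz2, ?_⟩, ?_,
      ?_, ?_, ?_⟩
    · rw [hdb]; exact hz1.ne
    · rwa [hdb]
    · rwa [hdb]
    · rw [← hSe]
      exact Sp_eq_Sp hPb' one_ne_zero (by rw [hPb']; simpa using hl z)
    · rw [hPb', hPb]
    · rw [← hPe]
      refine Pl_eq_Pl one_ne_zero z 0 ?_
      simp only [neg_smul, one_smul, C_0]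
      abel
  · left
    exact ⟨e, b, c, ⟨hKebc, heb, hec, hbc⟩, hSe, hPb, hPe⟩

/-- The relative position of two planes of the same space. -/
theorem two_planes {a1 b1 c1 a2 b2 c2 : Poly3 k} (h1 : Keller a1 b1 c1)
    (h2 : Keller a2 b2 c2) (hS : Sp a1 b1 c1 = Sp a2 b2 c2) :
    Pl b1 c1 = Pl b2 c2 ∨
    (∃ a b c, Good a b c ∧ Sp a b c = Sp a1 b1 c1 ∧ Pl b c = Pl b1 c1 ∧ Pl a c = Pl b2 c2) ∨
    ∃ h b c, Good h b c ∧ deg h < deg b ∧ Sp h b c = Sp a1 b1 c1 ∧ Pl b c = Pl b1 c1 ∧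
      Pl (b + h) c = Pl b2 c2 := by
  by_cases hb : b2 ∈ Pl b1 c1
  · by_cases hc : c2 ∈ Pl b1 c1
    · exact Or.inl (Pl_eq_of_le h2 (Pl_le (one_mem_Pl _ _) hb hc)).symm
    · right
      have := two_planes_aux h1 h2.swap (by rw [hS, Sp_swap]) hc
      rwa [Pl_comm c2 b2] at this
  · exact Or.inr (two_planes_aux h1 h2 hS hb)

theorem cr_combo (r r' x1 y1 z1 x2 y2 z2 : k) (a b c : Poly3 k) :
    cr (C r + x1 • a + y1 • b + z1 • c) (C r' + x2 • a + y2 • b + z2 • c) =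
      (C (x1 * y2 - x2 * y1) : Poly3 k) • cr a b + (C (x1 * z2 - x2 * z1) : Poly3 k) • cr a c
        + (C (y1 * z2 - y2 * z1) : Poly3 k) • cr b c := by
  simp only [cr_add_left, cr_add_right, cr_smul_left, cr_smul_right, cr_C_left, cr_C_right,
    cr_self, smul_zero, zero_add, add_zero]
  rw [cr_anticomm b a, cr_anticomm c a, cr_anticomm c b]
  generalize cr a b = u, cr a c = v, cr b c = w
  funext i
  simp only [Pi.add_apply, Pi.smul_apply, Pi.neg_apply, smul_eq_mul, C_mul, C_sub]
  ring

theorem vd_C_smul {a : k} (ha : a ≠ 0) (v : Fin 3 → Poly3 k) : vd ((C a : Poly3 k) • v) = vd v := by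
  refine le_antisymm (vd_C_smul_le a v) ?_
  have := vd_C_smul_le a⁻¹ ((C a : Poly3 k) • v)
  rwa [smul_smul, ← C_mul, inv_mul_cancel₀ ha, C_1, one_smul] at this

theorem Keller.plane_cases {a b c x u v : Poly3 k} (hK : Keller x u v)
    (hS : Sp x u v = Sp a b c) (h1 : D b c < D a c) (h2 : D a c < D a b) :
    D b c ≤ D u v ∧ (Pl u v = Pl b c ∨ D a c ≤ D u v) ∧ (c ∈ Pl u v ∨ D a b ≤ D u v) := by
  obtain ⟨r, x1, y1, z1, hu⟩ := mem_Sp.1 (hS ▸ mid_mem_Sp x u v)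
  obtain ⟨r', x2, y2, z2, hv⟩ := mem_Sp.1 (hS ▸ right_mem_Sp x u v)
  have hcr := cr_combo r r' x1 y1 z1 x2 y2 z2 a b c
  rw [← hu, ← hv] at hcr
  have hbc := vd_C_smul_le (y1 * z2 - y2 * z1) (cr b c)
  have hac := vd_C_smul_le (x1 * z2 - x2 * z1) (cr a c)
  have hpos := hK.D_pos
  by_cases hab : x1 * y2 - x2 * y1 = 0
  · have hc : c ∈ Pl u v := by
      by_contra hc
      have e1 : x1 * z2 - x2 * z1 = 0 := by
        by_contra hne
        refine hc (mem_Pl.2 ⟨-((x1 * z2 - x2 * z1)⁻¹ * (x1 * r' - x2 * r)),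
          -((x1 * z2 - x2 * z1)⁻¹ * x2), (x1 * z2 - x2 * z1)⁻¹ * x1, ?_⟩)
        have hC : (C (x1 * z2 - x2 * z1)⁻¹ : Poly3 k) * (C x1 * C z2 - C x2 * C z1) = 1 := by
          rw [← C_mul, ← C_mul, ← C_sub, ← C_mul, inv_mul_cancel₀ hne, C_1]
        have hC2 : (C x1 * C y2 - C x2 * C y1 : Poly3 k) = 0 := by
          rw [← C_mul, ← C_mul, ← C_sub, hab, C_0]
        rw [hu, hv]
        simp only [smul_eq_C_mul, C_mul, C_neg, C_sub]
        linear_combination (-c) * hC - C (x1 * z2 - x2 * z1)⁻¹ * b * hC2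
      have e2 : y1 * z2 - y2 * z1 = 0 := by
        by_contra hne
        refine hc (mem_Pl.2 ⟨-((y1 * z2 - y2 * z1)⁻¹ * (y1 * r' - y2 * r)),
          -((y1 * z2 - y2 * z1)⁻¹ * y2), (y1 * z2 - y2 * z1)⁻¹ * y1, ?_⟩)
        have hC : (C (y1 * z2 - y2 * z1)⁻¹ : Poly3 k) * (C y1 * C z2 - C y2 * C z1) = 1 := by
          rw [← C_mul, ← C_mul, ← C_sub, ← C_mul, inv_mul_cancel₀ hne, C_1]
        have hC2 : (C x1 * C y2 - C x2 * C y1 : Poly3 k) = 0 := by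
          rw [← C_mul, ← C_mul, ← C_sub, hab, C_0]
        rw [hu, hv]
        simp only [smul_eq_C_mul, C_mul, C_neg, C_sub]
        linear_combination (-c) * hC + C (y1 * z2 - y2 * z1)⁻¹ * a * hC2
      rw [D, hcr, hab, e1, e2] at hpos
      simp at hpos
    by_cases hacm : x1 * z2 - x2 * z1 = 0
    · rw [hab, hacm, C_0, zero_smul, zero_smul, zero_add, zero_add] at hcr
      have hne : y1 * z2 - y2 * z1 ≠ 0 := by
        intro h0
        rw [D, hcr, h0] at hpos
        simp at hpos
      have hD : D u v = D b c := by rw [D, hcr, vd_C_smul hne, D]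
      have hx1 : x1 = 0 := by
        have : x1 * (y1 * z2 - y2 * z1) = 0 := by linear_combination y1 * hacm - z1 * hab
        exact (mul_eq_zero.1 this).resolve_right hne
      have hx2 : x2 = 0 := by
        have : x2 * (y1 * z2 - y2 * z1) = 0 := by linear_combination y2 * hacm - z2 * hab
        exact (mul_eq_zero.1 this).resolve_right hne
      refine ⟨hD.ge, Or.inl (Pl_eq_of_le hK (Pl_le (one_mem_Pl _ _) ?_ ?_)), Or.inl hc⟩
      · exact mem_Pl.2 ⟨r, y1, z1, by rw [hu, hx1]; simp⟩
      · exact mem_Pl.2 ⟨r', y2, z2, by rw [hv, hx2]; simp⟩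
    · have hD : D u v = D a c := by
        rw [D, hcr, hab, C_0, zero_smul, zero_add, vd_add_eq_left, vd_C_smul hacm, D]
        rw [vd_C_smul hacm]
        exact hbc.trans_lt h1
      exact ⟨by linarith, Or.inr hD.ge, Or.inl hc⟩
  · have hD : D u v = D a b := by
      have e : vd ((C (x1 * y2 - x2 * y1) : Poly3 k) • cr a b
          + (C (x1 * z2 - x2 * z1) : Poly3 k) • cr a c) = D a b := by
        rw [vd_add_eq_left, vd_C_smul hab, D]
        rw [vd_C_smul hab]
        exact hac.trans_lt h2
      rw [D, hcr, vd_add_eq_left, e]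
      rw [e]
      exact hbc.trans_lt (h1.trans h2)
    exact ⟨by linarith, Or.inr (by linarith), Or.inr hD.ge⟩

theorem exists_min_deg {S : Set (Poly3 k)} (hS : S.Nonempty) : ∃ f ∈ S, ∀ g ∈ S, deg f ≤ deg g := by
  obtain ⟨f0, hf0⟩ := hS
  have hfin : (deg '' {f ∈ S | deg f ≤ deg f0}).Finite := by
    refine (finite_wt_le (deg f0)).subset ?_
    rintro _ ⟨f, hf, rfl⟩
    exact ⟨hf.2, deg_mem_values f⟩
  obtain ⟨_, ⟨f, hf, rfl⟩, hmin⟩ := Set.exists_min_image _ id hfin ⟨_, f0, ⟨hf0, le_rfl⟩, rfl⟩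
  refine ⟨f, hf.1, fun g hg => ?_⟩
  by_cases h : deg g ≤ deg f0
  · exact hmin _ ⟨g, ⟨hg, h⟩, rfl⟩
  · exact hf.2.trans (not_le.1 h).le

end

section

variable {k : Type} [Field k]

theorem wt_single_nat (i : Fin 3) (n : ℕ) : wt (Finsupp.single i n) = n * W i := by
  rw [wt, Finset.sum_eq_single i]
  · simp
  · intro j _ hj
    simp [Finsupp.single_eq_of_ne hj]
  · simp

theorem W_indep {i j : Fin 3} {p q : ℕ} (hp : 0 < p) (h : p * (W i : ℝ) = q * W j) : i = j := by
  have : wt (Finsupp.single i p) = wt (Finsupp.single j q) := by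
    rw [wt_single_nat, wt_single_nat]
    exact_mod_cast h
  rcases Finsupp.single_eq_single_iff _ _ _ _ |>.1 (wt_injective this) with h | h
  · exact h.1
  · omega

theorem keller_X : Keller (X 0 : Poly3 k) (X 1) (X 2) := by
  refine ⟨1, one_ne_zero, ?_⟩
  simp [cr, cross_apply, grad, pderiv_X, dotProduct, Pi.single_apply, mul_assoc]

theorem good_X : Good (X 0 : Poly3 k) (X 1) (X 2) := by
  refine ⟨keller_X, ?_⟩
  have key : ∀ i j : Fin 3, i ≠ j → deg (X i : Poly3 k) ≠ deg (X j : Poly3 k) := by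
    intro i j hij h
    rw [deg_X, deg_X] at h
    exact hij (W_indep (p := 1) (q := 1) one_pos (by simpa using h))
  exact ⟨key _ _ (by decide), key _ _ (by decide), key _ _ (by decide)⟩

theorem exists_deg_eq_W {a b c v : Poly3 k} (hS : Sp a b c = Sp (X 0) (X 1) (X 2))
    (hv : v ∈ Sp a b c) (h0 : 0 < deg v) : ∃ i, deg v = W i := by
  have : deg v ∈ deg '' (Sp a b c : Set (Poly3 k)) := ⟨v, hv, rfl⟩
  rw [hS, good_X.deg_image] at this
  simp only [Set.mem_insert_iff, Set.mem_singleton_iff, deg_X] at this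
  rcases this with h | h | h | h
  · exact absurd h h0.ne'
  all_goals exact ⟨_, h⟩

theorem Good.base_ratio {a b c : Poly3 k} (h : Good a b c)
    (hS : Sp a b c = Sp (X 0) (X 1) (X 2)) {p q : ℕ} (hp : 0 < p) :
    p * deg a ≠ q * deg b := by
  intro he
  obtain ⟨i, hi⟩ := exists_deg_eq_W hS (left_mem_Sp _ _ _) h.1.deg_pos
  obtain ⟨j, hj⟩ := exists_deg_eq_W hS (mid_mem_Sp _ _ _) h.1.rot.deg_pos
  rw [hi, hj] at he
  have := W_indep hp he
  rw [this, ← hj] at hi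
  exact h.2.1 hi

theorem deg_eq_of_add_lt {f φ : Poly3 k} (h : deg (f + φ) < deg f) : deg φ = deg f := by
  rcases lt_trichotomy (deg φ) (deg f) with h1 | h1 | h1
  · rw [deg_add_eq_left h1] at h
    exact absurd h (lt_irrefl _)
  · exact h1
  · rw [deg_add_eq_right h1] at h
    linarith

theorem Nb.exists_good {V V' : Submodule k (Poly3 k)} (h : Nb V V') :
    ∃ x u v ψ, Good x u v ∧ ψ ∈ Algebra.adjoin k {u, v} ∧ Good (x + ψ) u v ∧ V = Sp x u v ∧
      V' = Sp (x + ψ) u v := by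
  obtain ⟨a, b, c, ψ, hK, hψ, rfl, rfl⟩ := h
  obtain ⟨y, -, hK1, hbc, hP⟩ := hK.exists_mid
  obtain ⟨l, hl, -, hG⟩ := hK1.exists_good_left hbc
  have hS : Sp a b c = Sp (a + l) (b + y • c) c :=
    (Sp_eq_Sp hP one_ne_zero (by simpa using hl)).symm
  obtain ⟨ψ', hψ', e, hG'⟩ := exists_good_adapted hψ hG.1 hbc hS hP.symm
  exact ⟨a + l, b + y • c, c, ψ', hG, hψ', hG', hS, e⟩

theorem Good.perm {a b c x u v : Poly3 k} (h : Good a b c) (h' : Good x u v)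
    (hS : Sp x u v = Sp a b c) :
    (deg x = deg a ∧ (deg u = deg b ∧ deg v = deg c ∨ deg u = deg c ∧ deg v = deg b)) ∨
    (deg x = deg b ∧ (deg u = deg a ∧ deg v = deg c ∨ deg u = deg c ∧ deg v = deg a)) ∨
    (deg x = deg c ∧ (deg u = deg a ∧ deg v = deg b ∨ deg u = deg b ∧ deg v = deg a)) := by
  have key : ∀ w ∈ Sp a b c, 0 < deg w → deg w = deg a ∨ deg w = deg b ∨ deg w = deg c := by
    intro w hw h0
    have : deg w ∈ deg '' (Sp a b c : Set (Poly3 k)) := ⟨w, hw, rfl⟩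
    rw [h.deg_image] at this
    rcases this with h | h
    · exact absurd h h0.ne'
    · exact h
  have hx := key x (hS ▸ left_mem_Sp x u v) h'.1.deg_pos
  have hu := key u (hS ▸ mid_mem_Sp x u v) h'.1.rot.deg_pos
  have hv := key v (hS ▸ right_mem_Sp x u v) h'.1.rot.rot.deg_pos
  obtain ⟨h1, h2, h3⟩ := h'.2
  rcases hx with hx | hx | hx <;> rcases hu with hu | hu | hu <;> rcases hv with hv | hv | hv <;>
    first
    | exact absurd (hx.trans hu.symm) h1
    | exact absurd (hx.trans hv.symm) h2
    | exact absurd (hu.trans hv.symm) h3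
    | simp [hx, hu, hv]

/-- A numerical trace of an elementary degree reduction. -/
def RedNum (X U V E : ℝ) : Prop :=
  (∃ i j : ℕ, i * U + j * V = X) ∨
    ∃ p q : ℕ, 0 < p ∧ 0 < q ∧ p.Coprime q ∧ p * U = q * V ∧ p * U + E ≤ X + U + V

theorem RedNum.swap {X U V E : ℝ} (h : RedNum X U V E) : RedNum X V U E := by
  rcases h with ⟨i, j, h⟩ | ⟨p, q, hp, hq, hc, h1, h2⟩
  · exact Or.inl ⟨j, i, by linarith⟩
  · exact Or.inr ⟨q, p, hq, hp, hc.symm, h1.symm, by linarith⟩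

theorem Keller.redNum [CharZero k] {x u v ψ : Poly3 k} (h : Keller x u v)
    (hψ : ψ ∈ Algebra.adjoin k {u, v}) (hlt : deg (x + ψ) < deg x) :
    RedNum (deg x) (deg u) (deg v) (D u v) := by
  have hd := deg_eq_of_add_lt hlt
  rcases h.nt_or_ct hψ with ⟨-, h1⟩ | ⟨p, q, hp, hq, hc, h1, h2, -⟩
  · rw [hd] at h1
    exact Or.inl h1
  · rw [hd] at h2
    exact Or.inr ⟨p, q, hp, hq, hc, h1, by linarith⟩

/-- An elementary reduction of a space with a given good basis. -/
theorem Nb.redNum [CharZero k] {a b c : Poly3 k} {V1 : Submodule k (Poly3 k)} (h : Good a b c)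
    (hN : Nb (Sp a b c) V1) (hlt : vdeg V1 < vdeg (Sp a b c)) :
    ∃ x u v ψ, Good x u v ∧ Sp x u v = Sp a b c ∧ V1 = Sp (x + ψ) u v ∧
      ψ ∈ Algebra.adjoin k {u, v} ∧ deg (x + ψ) < deg x ∧
      (deg x = deg a ∧ RedNum (deg a) (deg b) (deg c) (D u v) ∨
        deg x = deg b ∧ RedNum (deg b) (deg a) (deg c) (D u v) ∨
        deg x = deg c ∧ RedNum (deg c) (deg a) (deg b) (D u v)) := by
  obtain ⟨x, u, v, ψ, hG, hψ, hG', hS, rfl⟩ := hN.exists_good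
  rw [hS, hG.vdeg_eq, hG'.vdeg_eq] at hlt
  have hlt' : deg (x + ψ) < deg x := by linarith
  refine ⟨x, u, v, ψ, hG, hS.symm, rfl, hψ, hlt', ?_⟩
  have hR := hG.1.redNum hψ hlt'
  rcases h.perm hG hS.symm with ⟨h1, ⟨h2, h3⟩ | ⟨h2, h3⟩⟩ | ⟨h1, ⟨h2, h3⟩ | ⟨h2, h3⟩⟩ |
    ⟨h1, ⟨h2, h3⟩ | ⟨h2, h3⟩⟩ <;> rw [h1, h2, h3] at hR
  · exact Or.inl ⟨h1, hR⟩
  · exact Or.inl ⟨h1, hR.swap⟩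
  · exact Or.inr (Or.inl ⟨h1, hR⟩)
  · exact Or.inr (Or.inl ⟨h1, hR.swap⟩)
  · exact Or.inr (Or.inr ⟨h1, hR⟩)
  · exact Or.inr (Or.inr ⟨h1, hR.swap⟩)

/-- The data of a non-elementary reduction. -/
structure KData (f1' f1 f2 f3 χ : Poly3 k) (κ : k) (δ : ℝ) : Prop where
  keller : Keller f1' f2 f3
  ne : κ ≠ 0
  eq : f1 = f1' + κ • f3 ^ 2
  deg1 : deg f1 = 3 * δ
  deg2 : deg f2 = 2 * δ
  deg1' : deg f1' ≤ 3 * δ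
  mem : χ ∈ Algebra.adjoin k {f1, f2}
  lt : deg (f3 + χ) < deg f3
  deg3 : deg f3 < 2 * δ
  hD : 3 * δ + D f1 f2 ≤ D f2 f3

/-- Spaces that can be reduced to the space spanned by the variables. -/
inductive Red : Submodule k (Poly3 k) → Prop
  | base : Red (Sp (X 0) (X 1) (X 2))
  | elem {V V1 : Submodule k (Poly3 k)} : Nb V V1 → vdeg V1 < vdeg V → Red V1 → Red V
  | kur {f1' f1 f2 f3 χ : Poly3 k} {κ : k} {δ : ℝ} : KData f1' f1 f2 f3 χ κ δ →
      Red (Sp f1 f2 (f3 + χ)) → Red (Sp f1' f2 f3)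

namespace KData

variable {f1' f1 f2 f3 χ : Poly3 k} {κ : k} {δ : ℝ}

theorem pos (h : KData f1' f1 f2 f3 χ κ δ) : 0 < δ := by
  have := h.keller.rot.deg_pos
  rw [h.deg2] at this
  linarith

theorem sq_mem (f2 f3 : Poly3 k) (κ : k) : κ • f3 ^ 2 ∈ Algebra.adjoin k {f2, f3} :=
  Subalgebra.smul_mem _ (pow_mem (Algebra.subset_adjoin (by simp)) 2) _

theorem keller1 (h : KData f1' f1 f2 f3 χ κ δ) : Keller f1 f2 f3 := by
  rw [h.eq]
  exact h.keller.add_left (sq_mem f2 f3 κ)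

theorem two_t_le (h : KData f1' f1 f2 f3 χ κ δ) : 2 * deg f3 ≤ 3 * δ := by
  have h3 := ne_zero_of_deg_pos h.keller.rot.rot.deg_pos
  have e : κ • f3 ^ 2 = f1 - f1' := by rw [h.eq]; abel
  have := deg_sub_le f1 f1'
  rw [← e, deg_smul h.ne, deg_pow h3] at this
  have := this.trans (max_le h.deg1.le h.deg1')
  exact_mod_cast this

theorem le_t [CharZero k] (h : KData f1' f1 f2 f3 χ κ δ) : δ + D f1 f2 ≤ deg f3 := by
  have hδ := h.pos
  have h3 := h.keller.rot.rot.deg_pos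
  have ht := h.deg3
  rcases h.keller1.rot.rot.redNum h.mem h.lt with ⟨i, j, hij⟩ | ⟨p, q, hp, hq, hc, h1, h2⟩
  · rw [h.deg1, h.deg2] at hij
    rcases Nat.eq_zero_or_pos i with rfl | hi
    · rcases Nat.eq_zero_or_pos j with rfl | hj
      · simp at hij
        linarith
      · have : (1 : ℝ) ≤ j := by exact_mod_cast hj
        simp at hij
        nlinarith
    · have : (1 : ℝ) ≤ i := by exact_mod_cast hi
      have : (0 : ℝ) ≤ j := by positivity
      nlinarith
  · rw [h.deg1, h.deg2] at h1 h2
    have h4 : (p * 3 : ℝ) = q * 2 := by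
      have : (p * 3 : ℝ) * δ = q * 2 * δ := by linarith
      exact mul_right_cancel₀ hδ.ne' this
    have h5 : p * 3 = q * 2 := by exact_mod_cast h4
    have h6 : 2 ∣ p := by omega
    have h7 : 2 ≤ p := Nat.le_of_dvd hp h6
    have h8 : (2 : ℝ) ≤ p := by exact_mod_cast h7
    nlinarith

theorem D12_pos (h : KData f1' f1 f2 f3 χ κ δ) : 0 < D f1 f2 := h.keller1.rot.rot.D_pos

theorem D13 [CharZero k] (h : KData f1' f1 f2 f3 χ κ δ) : D f1 f3 = δ + D f2 f3 := by
  have h1 := h.keller1.two_max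
  have h2 := h.keller1.rot.swap.two_max
  rw [D_comm f2 f1] at h2
  have h3 := h.two_t_le
  have h4 := h.hD
  have h5 := h.pos
  rw [h.deg1, h.deg2] at h1
  rw [h.deg1, h.deg2] at h2
  rcases le_max_iff.1 h1 with h6 | h6 <;> rcases le_max_iff.1 h2 with h7 | h7 <;> linarith

theorem cr_sq_left (f g : Poly3 k) : cr (f ^ 2) g = (C 2 * f) • cr f g := by
  rw [cr, sq, grad_mul, map_add, LinearMap.add_apply, map_smul, LinearMap.smul_apply, ← add_smul,
    ← two_mul, cr]
  rfl

theorem D13' [CharZero k] (h : KData f1' f1 f2 f3 χ κ δ) : D f1' f3 = δ + D f2 f3 := by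
  rw [← h.D13, D, D, h.eq, cr_add_left, cr_smul_left, cr_sq_left]
  simp

theorem D12' [CharZero k] (h : KData f1' f1 f2 f3 χ κ δ) : D f1' f2 = deg f3 + D f2 f3 := by
  have e : f1' = f1 + (-κ) • f3 ^ 2 := by rw [h.eq, neg_smul]; abel
  have h3 := ne_zero_of_deg_pos h.keller.rot.rot.deg_pos
  have h0 : (C (-κ * 2) * f3 : Poly3 k) ≠ 0 :=
    mul_ne_zero (by simpa using h.ne) h3
  have h1 : cr f1' f2 = cr f1 f2 + (C (-κ * 2) * f3) • cr f3 f2 := by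
    rw [e, cr_add_left, cr_smul_left, cr_sq_left, smul_smul, ← mul_assoc, C_mul]
  have hp : 0 < vd (cr f3 f2) := h.keller.swap.D_pos
  have h2 : vd ((C (-κ * 2) * f3) • cr f3 f2) = deg f3 + D f2 f3 := by
    rw [vd_smul h0 hp, ← smul_eq_C_mul, deg_smul (by simpa using h.ne), D_comm f2 f3, D]
  rw [D, h1, vd_add_eq_right, h2]
  rw [h2]
  have := h.hD
  have := h.pos
  have := h.keller.rot.rot.deg_pos
  change D f1 f2 < _
  linarith

theorem lt_t [CharZero k] (h : KData f1' f1 f2 f3 χ κ δ) : δ < deg f3 := by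
  have := h.le_t
  have := h.D12_pos
  linarith

theorem lt_deg1' [CharZero k] (h : KData f1' f1 f2 f3 χ κ δ) : 2 * δ < deg f1' := by
  have h1 := D_le f1' f2
  rw [h.D12', h.deg2] at h1
  have := h.hD
  have := h.lt_t
  have := h.D12_pos
  linarith

theorem good [CharZero k] (h : KData f1' f1 f2 f3 χ κ δ) : Good f1' f2 f3 := by
  have h1 := h.lt_deg1'
  have h2 := h.deg2
  have h3 := h.deg3
  exact ⟨h.keller, by linarith, by linarith, by linarith⟩

theorem plane_cases [CharZero k] (h : KData f1' f1 f2 f3 χ κ δ) {x u v : Poly3 k}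
    (hK : Keller x u v) (hS : Sp x u v = Sp f1' f2 f3) :
    D f2 f3 ≤ D u v ∧ (Pl u v = Pl f2 f3 ∨ δ + D f2 f3 ≤ D u v) := by
  have h1 := h.D13'
  have h2 := h.D12'
  have h3 := h.pos
  have h4 := h.lt_t
  obtain ⟨h5, h6, -⟩ := hK.plane_cases hS (by linarith) (by linarith)
  rw [h1] at h6
  exact ⟨h5, h6⟩

end KData

/-- Reducibility propagates from spaces of degree less than `μ` to their neighbours. -/
def Step (k : Type) [Field k] (μ : ℝ) : Prop :=
  ∀ V V' : Submodule k (Poly3 k), Red V → vdeg V < μ → Nb V V' → vdeg V' ≤ μ → Red V'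

theorem eq_one_of_mul_lt {p : ℕ} (hp : 0 < p) {Y : ℝ} (hY : 0 < Y) (h : p * Y < 2 * Y) : p = 1 := by
  have : (p : ℝ) < 2 := lt_of_mul_lt_mul_right h hY.le
  have : p < 2 := by exact_mod_cast this
  omega

theorem pow_mul_pow_mem (b c : Poly3 k) (i j : ℕ) : b ^ i * c ^ j ∈ Algebra.adjoin k {b, c} :=
  mul_mem (pow_mem (Algebra.subset_adjoin (by simp)) i)
    (pow_mem (Algebra.subset_adjoin (by simp)) j)

theorem deg_pow_mul_pow {b c : Poly3 k} (hb : b ≠ 0) (hc : c ≠ 0) (i j : ℕ) :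
    deg (b ^ i * c ^ j) = i * deg b + j * deg c := by
  rw [deg_mul (pow_ne_zero _ hb) (pow_ne_zero _ hc), deg_pow hb, deg_pow hc]

theorem Keller.exists_min {a b c : Poly3 k} (h : Keller a b c) :
    ∃ ρ ∈ Algebra.adjoin k {b, c},
      (∀ σ ∈ Algebra.adjoin k {b, c}, deg (a + ρ) ≤ deg (a + σ)) ∧
      ∀ i j : ℕ, i * deg b + j * deg c ≠ deg (a + ρ) := by
  obtain ⟨_, ⟨ρ, hρ, rfl⟩, hmin⟩ := exists_min_deg
    (S := (fun σ => a + σ) '' (Algebra.adjoin k {b, c} : Set (Poly3 k)))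
    ⟨_, 0, zero_mem _, rfl⟩
  refine ⟨ρ, hρ, fun σ hσ => hmin _ ⟨σ, hσ, rfl⟩, fun i j hij => ?_⟩
  have hb := ne_zero_of_deg_pos h.rot.deg_pos
  have hc := ne_zero_of_deg_pos h.rot.rot.deg_pos
  have hy := (h.add_left hρ).deg_pos
  rw [← deg_pow_mul_pow hb hc] at hij
  obtain ⟨κ, -, hκ⟩ := exists_smul_deg_lt hij.symm (hij ▸ hy)
  have := hmin _ ⟨_, add_mem hρ (Subalgebra.smul_mem _ (pow_mul_pow_mem b c i j) κ), rfl⟩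
  rw [hij, add_assoc] at hκ
  exact absurd (hκ.trans_le this) (lt_irrefl _)

theorem Good.not_red_of_min {a b c x u v ψ : Poly3 k} (h : Good a b c)
    (hmin : ∀ σ ∈ Algebra.adjoin k {b, c}, deg a ≤ deg (a + σ)) (h' : Good x u v)
    (hS : Sp x u v = Sp a b c) (hψ : ψ ∈ Algebra.adjoin k {u, v}) (hlt : deg (x + ψ) < deg x) :
    Pl u v ≠ Pl b c := by
  intro hP
  obtain ⟨ψ', hψ', e, hG⟩ := exists_good_adapted hψ h.1 h.2.2.2 hS hP
  have h1 := (h'.1.add_left hψ).vdeg_le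
  rw [e, hG.vdeg_eq] at h1
  have h2 := h.vdeg_eq
  rw [← hS, h'.vdeg_eq] at h2
  have := hmin ψ' hψ'
  linarith

theorem vd_smul_C_mul {a : k} (ha : a ≠ 0) {f : Poly3 k} (hf : f ≠ 0) {v : Fin 3 → Poly3 k}
    (hv : 0 < vd v) : vd ((C a * f) • v) = deg f + vd v := by
  rw [vd_smul (mul_ne_zero (by simpa using ha) hf) hv, ← smul_eq_C_mul, deg_smul ha]

end

section

variable {k : Type} [Field k]

/-- A triple of degrees `6η, 4η, 3η` all of whose planes but one have large degree. -/
structure SData (f1 f2 f3 : Poly3 k) (η : ℝ) : Prop where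
  keller : Keller f1 f2 f3
  deg1 : deg f1 = 6 * η
  deg2 : deg f2 = 4 * η
  deg3 : deg f3 = 3 * η
  D12 : D f1 f2 ≤ η
  D23 : 3 * η < D f2 f3
  D13 : D f1 f3 = 2 * η + D f2 f3

theorem NT.mem {b c ψ : Poly3 k} (h : NT b c ψ) {P : Submodule k (Poly3 k)}
    (hP : ∀ i j : ℕ, i * deg b + j * deg c ≤ deg ψ → b ^ i * c ^ j ∈ P) : ψ ∈ P := h.1 P hP

namespace SData

variable {f1 f2 f3 ρ : Poly3 k} {η : ℝ}

theorem pos (h : SData f1 f2 f3 η) : 0 < η := by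
  have := h.keller.deg_pos
  rw [h.deg1] at this
  linarith

theorem exists_eq [CharZero k] (h : SData f1 f2 f3 η) (hρ : ρ ∈ Algebra.adjoin k {f2, f3})
    (hlt : deg (f1 + ρ) < 6 * η) :
    ∃ γ α β κ : k, κ ≠ 0 ∧ ρ = C γ + α • f2 + β • f3 + κ • f3 ^ 2 := by
  have hη := h.pos
  have hD := h.D23
  have hd := deg_eq_of_add_lt (hlt.trans_eq h.deg1.symm)
  rcases h.keller.nt_or_ct hρ with hN | ⟨p, q, hp, hq, hc, h1, h2, -⟩
  · have : ρ ∈ Submodule.span k {1, f2, f3, f3 ^ 2} := by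
      refine hN.mem fun i j hij => ?_
      rw [hd, h.deg1, h.deg2, h.deg3] at hij
      have h' : i * 4 + j * 3 ≤ 6 := by
        have : (i * 4 + j * 3 : ℝ) * η ≤ 6 * η := by linarith
        exact_mod_cast le_of_mul_le_mul_right this hη
      have : (i = 0 ∧ j = 0) ∨ (i = 1 ∧ j = 0) ∨ (i = 0 ∧ j = 1) ∨ (i = 0 ∧ j = 2) := by omega
      rcases this with ⟨rfl, rfl⟩ | ⟨rfl, rfl⟩ | ⟨rfl, rfl⟩ | ⟨rfl, rfl⟩ <;>
        exact Submodule.subset_span (by simp)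
    simp only [Submodule.mem_span_insert, Submodule.mem_span_singleton] at this
    obtain ⟨γ, _, ⟨α, _, ⟨β, _, ⟨κ, rfl⟩, rfl⟩, rfl⟩, rfl⟩ := this
    refine ⟨γ, α, β, κ, ?_, by rw [← mul_one (C γ), ← smul_eq_C_mul]; abel⟩
    rintro rfl
    have e : γ • (1 : Poly3 k) + (α • f2 + (β • f3 + (0 : k) • f3 ^ 2))
        = α • f2 + β • f3 + C γ := by
      rw [← mul_one (C γ), ← smul_eq_C_mul, zero_smul]; abel
    rw [e, deg_add_C, h.deg1] at hd
    have := deg_add_le (α • f2) (β • f3)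
    have h4 := deg_smul_le α f2
    have h5 := deg_smul_le β f3
    rw [h.deg2] at h4
    rw [h.deg3] at h5
    rcases le_max_iff.1 this with h6 | h6 <;> linarith
  · rw [h.deg2, h.deg3] at h1 h2
    rw [hd, h.deg1] at h2
    have h3 : p * 4 = q * 3 := by
      have : (p * 4 : ℝ) * η = (q * 3 : ℝ) * η := by linarith
      exact_mod_cast mul_right_cancel₀ hη.ne' this
    have h4 : 3 ≤ p := by omega
    have : (3 : ℝ) ≤ p := by exact_mod_cast h4
    nlinarith

theorem D_eqs (h : SData f1 f2 f3 η) {γ α β κ : k} (hκ : κ ≠ 0) [CharZero k]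
    (hρ : ρ = C γ + α • f2 + β • f3 + κ • f3 ^ 2) :
    D (f1 + ρ) f3 = 2 * η + D f2 f3 ∧ D (f1 + ρ) f2 = 3 * η + D f2 f3 := by
  have hη := h.pos
  have hE := h.D23
  have h3 := ne_zero_of_deg_pos h.keller.rot.rot.deg_pos
  constructor
  · rw [← h.D13, D, hρ]
    simp only [cr_add_left, cr_smul_left, KData.cr_sq_left, cr_C_left, cr_self, smul_zero,
      add_zero, zero_add]
    rw [vd_add_eq_left, D]
    refine (vd_C_smul_le _ _).trans_lt ?_
    change D f2 f3 < D f1 f3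
    rw [h.D13]
    linarith
  · have hp : 0 < vd (cr f3 f2) := h.keller.swap.D_pos
    have e : cr (f1 + ρ) f2 = (cr f1 f2 + (C β : Poly3 k) • cr f3 f2)
        + (C (κ * 2) * f3) • cr f3 f2 := by
      rw [hρ]
      simp only [cr_add_left, cr_smul_left, KData.cr_sq_left, cr_C_left, cr_self, smul_zero,
        zero_add, C_mul, smul_smul, mul_assoc, add_assoc]
    have h1 : vd ((C (κ * 2) * f3) • cr f3 f2) = 3 * η + D f2 f3 := by
      rw [vd_smul_C_mul (by simpa using hκ) h3 hp, h.deg3, D_comm f2, D]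
    rw [D, e, vd_add_eq_right, h1]
    rw [h1]
    refine (vd_add_le _ _).trans_lt (max_lt ?_ ((vd_C_smul_le _ _).trans_lt ?_))
    · have := h.D12
      change D f1 f2 < _
      linarith
    · change D f3 f2 < _
      rw [D_comm]
      linarith

end SData

theorem KData.of_sData [CharZero k] {f1 f2 f3 y f1' g1 g2 g3 χ : Poly3 k} {η δ : ℝ}
    {γ α β κ κ' : k} (h : SData f1 f2 f3 η)
    (hy : y = f1 + (C γ + α • f2 + β • f3 + κ • f3 ^ 2))
    (hG : Good y f2 f3) (hY : deg y ≤ 6 * η) (hY4 : 4 * η < deg y)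
    (hK : KData f1' g1 g2 g3 χ κ' δ) (hS : Sp f1' g2 g3 = Sp y f2 f3) :
    ∃ χ' ∈ Algebra.adjoin k {f1, f2}, deg (f3 + χ') < 3 * η ∧
      Sp f1 f2 (f3 + χ') = Sp g1 g2 (g3 + χ) := by
  have hη := h.pos
  have h2 := h.deg2
  have h3 := h.deg3
  have k1 := hK.lt_deg1'
  have k2 := hK.deg2
  have k3 := hK.deg3
  have k4 := hK.two_t_le
  have k5 := hK.le_t
  -- match the degrees
  have hdeg : deg f1' = deg y ∧ deg g2 = deg f2 ∧ deg g3 = deg f3 := by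
    rcases hG.perm hK.good hS with ⟨h5, ⟨h6, h7⟩ | ⟨h6, h7⟩⟩ | ⟨h5, ⟨h6, h7⟩ | ⟨h6, h7⟩⟩ |
      ⟨h5, ⟨h6, h7⟩ | ⟨h6, h7⟩⟩
    · exact ⟨h5, h6, h7⟩
    all_goals linarith
  obtain ⟨d1, d2, d3⟩ := hdeg
  have hδ : δ = 2 * η := by linarith
  obtain ⟨r1, x1, y1, z1, e1⟩ := mem_Sp.1 (hS ▸ left_mem_Sp f1' g2 g3)
  obtain ⟨r2, x2, y2, z2, e2⟩ := mem_Sp.1 (hS ▸ mid_mem_Sp f1' g2 g3)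
  obtain ⟨r3, x3, y3, z3, e3⟩ := mem_Sp.1 (hS ▸ right_mem_Sp f1' g2 g3)
  have c2 : x2 = 0 := by
    by_contra hx
    have := hG.deg_combo r2 x2 y2 z2
    rw [← e2, deg_smul hx] at this
    have := le_max_left (deg y) (max (deg (y2 • f2)) (deg (z2 • f3)))
    linarith
  have c3 : x3 = 0 := by
    by_contra hx
    have := hG.deg_combo r3 x3 y3 z3
    rw [← e3, deg_smul hx] at this
    have := le_max_left (deg y) (max (deg (y3 • f2)) (deg (z3 • f3)))
    linarith
  have c3' : y3 = 0 := by
    by_contra hx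
    have := hG.deg_combo r3 x3 y3 z3
    rw [← e3, deg_smul hx] at this
    have := (le_max_left (deg f2) (deg (z3 • f3))).trans (le_max_right (deg (x3 • y)) _)
    linarith
  subst c2 c3 c3'
  simp only [zero_smul, add_zero] at e2 e3
  have hz3 : z3 ≠ 0 := by
    rintro rfl
    rw [e3] at d3
    simp at d3
    linarith
  have hy2 : y2 ≠ 0 := by
    rintro rfl
    have := deg_smul_le z2 f3
    rw [e2, zero_smul, add_zero, add_comm, deg_add_C] at d2
    linarith
  have hx1 : x1 ≠ 0 := by
    rintro rfl
    have h4 := deg_add_le (y1 • f2) (z1 • f3)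
    have h5 := deg_smul_le y1 f2
    have h6 := deg_smul_le z1 f3
    have e : f1' = y1 • f2 + z1 • f3 + C r1 := by rw [e1, zero_smul]; abel
    rw [e, deg_add_C] at d1
    rcases le_max_iff.1 h4 with h7 | h7 <;> linarith
  -- express `g1` through the `f`s
  obtain ⟨R, μ2, μ3, μ4, hg1⟩ : ∃ R μ2 μ3 μ4 : k,
      g1 = C R + x1 • f1 + μ2 • f2 + μ3 • f3 + μ4 • f3 ^ 2 := by
    refine ⟨r1 + x1 * γ + κ' * r3 ^ 2, x1 * α + y1, x1 * β + z1 + 2 * κ' * r3 * z3,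
      x1 * κ + κ' * z3 ^ 2, ?_⟩
    rw [hK.eq, e1, e3, hy]
    have h2C : (C 2 : Poly3 k) = 2 := map_ofNat C 2
    simp only [smul_eq_C_mul, C_mul, C_add, C_pow, h2C]
    ring
  have hcr : cr g1 g2 = (C (μ4 * 2 * y2) * f3) • cr f3 f2 + ((C (x1 * z2) : Poly3 k) • cr f1 f3
      + ((C (x1 * y2) : Poly3 k) • cr f1 f2 + (C (μ2 * z2 - μ3 * y2) : Poly3 k) • cr f2 f3)) := by
    rw [hg1, e2]
    simp only [cr_add_left, cr_add_right, cr_smul_left, cr_smul_right, cr_C_left, cr_C_right,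
      cr_self, smul_zero, zero_add, add_zero, KData.cr_sq_left]
    rw [cr_anticomm f3 f2]
    generalize cr f1 f2 = u, cr f1 f3 = v, cr f2 f3 = w
    funext i
    simp only [Pi.add_apply, Pi.smul_apply, Pi.neg_apply, smul_eq_mul, C_mul, C_sub]
    ring
  have hD : vd (cr g1 g2) ≤ η := by
    change D g1 g2 ≤ η
    linarith
  have hE := h.D23
  have hp : 0 < vd (cr f3 f2) := h.keller.swap.D_pos
  have h3' := ne_zero_of_deg_pos h.keller.rot.rot.deg_pos
  have b12 : vd ((C (x1 * y2) : Poly3 k) • cr f1 f2) ≤ η := (vd_C_smul_le _ _).trans h.D12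
  have b23 : vd ((C (μ2 * z2 - μ3 * y2) : Poly3 k) • cr f2 f3) ≤ D f2 f3 := vd_C_smul_le _ _
  have b13 : vd ((C (x1 * z2) : Poly3 k) • cr f1 f3) ≤ 2 * η + D f2 f3 :=
    (vd_C_smul_le _ _).trans h.D13.le
  have b123 := (vd_add_le ((C (x1 * y2) : Poly3 k) • cr f1 f2)
    ((C (μ2 * z2 - μ3 * y2) : Poly3 k) • cr f2 f3)).trans
      (max_le (b12.trans (by linarith)) b23)
  have hμ4 : μ4 = 0 := by
    by_contra hne
    have h6 : vd ((C (μ4 * 2 * y2) * f3) • cr f3 f2) = 3 * η + D f2 f3 := by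
      rw [vd_smul_C_mul (by simp [hne, hy2]) h3' hp, h.deg3, D_comm f2, D]
    have h7 := (vd_add_le ((C (x1 * z2) : Poly3 k) • cr f1 f3) _).trans
      (max_le b13 (b123.trans (by linarith)))
    rw [hcr, vd_add_eq_left (by linarith), h6] at hD
    linarith
  subst hμ4
  simp only [zero_mul, C_0, zero_smul, zero_add, add_zero] at hcr hg1
  have hz2 : z2 = 0 := by
    by_contra hne
    have h6 : vd ((C (x1 * z2) : Poly3 k) • cr f1 f3) = 2 * η + D f2 f3 := by
      rw [vd_C_smul (mul_ne_zero hx1 hne), ← h.D13, D]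
    rw [hcr, vd_add_eq_left (by linarith), h6] at hD
    linarith
  subst hz2
  simp only [mul_zero, C_0, zero_smul, zero_add, add_zero, zero_sub] at hcr e2
  have hμ3 : μ3 = 0 := by
    by_contra hne
    have h6 : vd ((C (-(μ3 * y2)) : Poly3 k) • cr f2 f3) = D f2 f3 := by
      rw [vd_C_smul (by simp [hne, hy2]), D]
    rw [hcr, vd_add_eq_right (by linarith), h6] at hD
    linarith
  subst hμ3
  simp only [zero_smul, add_zero] at hg1
  have hPg : Pl g1 g2 = Pl f1 f2 := by
    have t1 : Pl g1 g2 = Pl f1 g2 := by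
      refine Pl_eq_Pl hx1 (μ2 * y2⁻¹) (R - μ2 * y2⁻¹ * r2) ?_
      rw [hg1, e2]
      have : (C μ2 * C y2⁻¹ * C y2 : Poly3 k) = C μ2 := by
        rw [← C_mul, ← C_mul, inv_mul_cancel_right₀ hy2]
      simp only [smul_eq_C_mul, C_mul, C_sub]
      linear_combination (-f2) * this
    rw [t1, Pl_comm, Pl_comm f1 f2]
    exact Pl_eq_Pl hy2 0 r2 (by rw [e2]; simp [add_comm])
  have hχ : z3⁻¹ • (χ + C r3) ∈ Algebra.adjoin k {f1, f2} := by
    rw [← adjoin_eq_of_Pl hPg]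
    exact Subalgebra.smul_mem _ (add_mem hK.mem (Subalgebra.algebraMap_mem _ r3)) _
  have hg3 : g3 + χ = z3 • (f3 + z3⁻¹ • (χ + C r3)) := by
    rw [smul_add, smul_inv_smul₀ hz3, e3]
    abel
  refine ⟨_, hχ, ?_, ?_⟩
  · have := hK.lt
    rw [hg3, deg_smul hz3] at this
    linarith
  · rw [Sp_rot g1, Sp_rot g2, Sp_rot f1, Sp_rot f2]
    symm
    exact Sp_eq_Sp hPg hz3 (by rw [hg3, sub_self]; exact zero_mem _)

theorem SData.exists_red [CharZero k] {f1 f2 f3 ρ : Poly3 k} {η μ : ℝ} (h : SData f1 f2 f3 η)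
    (hμ : 13 * η ≤ μ) (hstep : Step k μ) (hρ : ρ ∈ Algebra.adjoin k {f2, f3})
    (hlt : deg (f1 + ρ) < 6 * η) (hR : Red (Sp (f1 + ρ) f2 f3)) :
    ∃ χ ∈ Algebra.adjoin k {f1, f2}, deg (f3 + χ) < 3 * η ∧ Red (Sp f1 f2 (f3 + χ)) := by
  have hη := h.pos
  have h1 := h.deg1
  have h2 := h.deg2
  have h3 := h.deg3
  have hE := h.D23
  obtain ⟨ρ0, hρ0, hmin, hns⟩ := h.keller.exists_min
  have hlt0 := (hmin ρ hρ).trans_lt hlt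
  have hR0 : Red (Sp (f1 + ρ0) f2 f3) := by
    refine hstep _ _ hR ?_ ⟨f1 + ρ, f2, f3, ρ0 - ρ, h.keller.add_left hρ, sub_mem hρ0 hρ, rfl,
      by congr 1; abel⟩ ?_
    · have := (h.keller.add_left hρ).vdeg_le
      linarith
    · have := (h.keller.add_left hρ0).vdeg_le
      linarith
  obtain ⟨γ, α, β, κ, hκ, e⟩ := h.exists_eq hρ0 hlt0
  obtain ⟨D13, D12⟩ := h.D_eqs hκ e
  have hY := D_le (f1 + ρ0) f2
  have hY4 : deg (f1 + ρ0) ≠ 4 * η := fun h' => hns 1 0 (by simp; linarith)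
  have hY3 : deg (f1 + ρ0) ≠ 3 * η := fun h' => hns 0 1 (by simp; linarith)
  have hG : Good (f1 + ρ0) f2 f3 :=
    ⟨h.keller.add_left hρ0, by rwa [h2], by rwa [h3], by rw [h2, h3]; linarith⟩
  have hmin' : ∀ σ ∈ Algebra.adjoin k {f2, f3}, deg (f1 + ρ0) ≤ deg (f1 + ρ0 + σ) := by
    intro σ hσ
    rw [add_assoc]
    exact hmin _ (add_mem hρ0 hσ)
  have e' : f1 + ρ0 = f1 + (C γ + α • f2 + β • f3 + κ • f3 ^ 2) := by rw [← e]
  generalize f1 + ρ0 = y at *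
  rw [h2, h3] at hns
  rw [D12, h2] at hY
  generalize hV : Sp y f2 f3 = V at hR0
  cases hR0 with
  | base =>
    exact absurd (by rw [h2, h3]; push_cast; ring)
      (hG.rot.base_ratio (by rw [← Sp_rot]; exact hV) (p := 3) (q := 4) (by norm_num))
  | elem hN hlt1 hR1 =>
    exfalso
    rw [← hV] at hN hlt1
    obtain ⟨x, u, v, ψ, hG1, hS1, -, hψ, hlt2, hnum⟩ := hN.redNum hG hlt1
    have hnp := hG.not_red_of_min hmin' hG1 hS1 hψ hlt2
    have hD := ((hG1.1.plane_cases hS1 (by linarith) (by linarith)).2.1.resolve_left hnp)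
    rw [D13] at hD
    rw [h2, h3] at hnum
    have hY2 : 2 * η < deg y := by linarith
    rcases hnum with ⟨-, ⟨i, j, hij⟩ | ⟨p, q, hp, hq, hc, h5, h6⟩⟩ |
      ⟨-, ⟨i, j, hij⟩ | ⟨p, q, hp, hq, hc, h5, h6⟩⟩ | ⟨-, ⟨i, j, hij⟩ | ⟨p, q, hp, hq, hc, h5, h6⟩⟩
    · exact hns i j hij
    · have h7 : p * 4 = q * 3 := by
        have : (p * 4 : ℝ) * η = (q * 3 : ℝ) * η := by linarith
        exact_mod_cast mul_right_cancel₀ hη.ne' this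
      have h4 : 3 ≤ p := by omega
      have : (3 : ℝ) ≤ p := by exact_mod_cast h4
      nlinarith
    · rcases Nat.eq_zero_or_pos i with rfl | hi
      · have : (4 : ℝ) * η = (j * 3 : ℝ) * η := by push_cast at hij; linarith
        have : 4 = j * 3 := by exact_mod_cast mul_right_cancel₀ hη.ne' this
        omega
      rcases Nat.eq_zero_or_pos j with rfl | hj
      · obtain rfl | hi' : i = 1 ∨ 2 ≤ i := by omega
        · exact hY4 (by push_cast at hij; linarith)
        · have : (2 : ℝ) ≤ i := by exact_mod_cast hi'
          push_cast at hij
          nlinarith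
      · have h8 : (1 : ℝ) ≤ i := by exact_mod_cast hi
        have h9 : (1 : ℝ) ≤ j := by exact_mod_cast hj
        nlinarith [mul_le_mul_of_nonneg_right h8 (deg_nonneg y),
          mul_le_mul_of_nonneg_right h9 hη.le]
    · have := eq_one_of_mul_lt hp (Y := deg y) (by linarith) (by linarith)
      subst this
      exact hns 0 q (by push_cast at *; linarith)
    · rcases Nat.eq_zero_or_pos i with rfl | hi
      · have : (3 : ℝ) * η = (j * 4 : ℝ) * η := by push_cast at hij; linarith
        have : 3 = j * 4 := by exact_mod_cast mul_right_cancel₀ hη.ne' this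
        omega
      rcases Nat.eq_zero_or_pos j with rfl | hj
      · obtain rfl | hi' : i = 1 ∨ 2 ≤ i := by omega
        · exact hY3 (by push_cast at hij; linarith)
        · have : (2 : ℝ) ≤ i := by exact_mod_cast hi'
          push_cast at hij
          nlinarith
      · have h8 : (1 : ℝ) ≤ i := by exact_mod_cast hi
        have h9 : (1 : ℝ) ≤ j := by exact_mod_cast hj
        nlinarith [mul_le_mul_of_nonneg_right h8 (deg_nonneg y),
          mul_le_mul_of_nonneg_right h9 hη.le]
    · have := eq_one_of_mul_lt hp (Y := deg y) (by linarith) (by linarith)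
      subst this
      exact hns q 0 (by push_cast at *; linarith)
  | kur hK hR1 =>
    rename_i f1' g1 g2 g3 χ κ' δ
    have k1 := hK.lt_deg1'
    have k2 := hK.deg2
    have k3 := hK.deg3
    have k4 := hK.two_t_le
    have k5 := hK.le_t
    have k6 := hK.hD
    have k7 := hK.D12_pos
    have k8 := (hK.plane_cases hG.1 hV).1
    have k9 := hK.deg1'
    have hY4' : 4 * η < deg y := by
      rcases hG.perm hK.good hV.symm with ⟨h5, ⟨h6, h7⟩ | ⟨h6, h7⟩⟩ |
        ⟨h5, ⟨h6, h7⟩ | ⟨h6, h7⟩⟩ | ⟨h5, ⟨h6, h7⟩ | ⟨h6, h7⟩⟩ <;> linarith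
    obtain ⟨χ', h5, h6, h7⟩ := KData.of_sData h e' hG hlt0.le hY4' hK hV.symm
    exact ⟨χ', h5, h6, h7 ▸ hR1⟩

end

section

variable {k : Type} [Field k]

theorem Good.mem_Pl_of_deg_lt {a b c u : Poly3 k} (h : Good a b c) (hu : u ∈ Sp a b c)
    (hlt : deg u < deg a) : u ∈ Pl b c := by
  obtain ⟨r, x, y, z, rfl⟩ := mem_Sp.1 hu
  rw [h.deg_combo] at hlt
  obtain rfl : x = 0 := by
    by_contra hx
    rw [deg_smul hx] at hlt
    exact absurd (le_max_left _ _) hlt.not_ge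
  exact mem_Pl.2 ⟨r, y, z, by simp⟩

/-- The plane of elements of small degree is determined by the space. -/
theorem Good.Pl_eq_of_deg {a b c x u v : Poly3 k} (h : Good a b c) (h' : Good x u v)
    (hS : Sp x u v = Sp a b c) (hb : deg b < deg a) (hc : deg c < deg a) (hx : deg x = deg a) :
    Pl u v = Pl b c := by
  have huv : deg u < deg a ∧ deg v < deg a := by
    rcases h.perm h' hS with ⟨-, ⟨h2, h3⟩ | ⟨h2, h3⟩⟩ | ⟨h1, -⟩ | ⟨h1, -⟩
    · exact ⟨h2 ▸ hb, h3 ▸ hc⟩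
    · exact ⟨h2 ▸ hc, h3 ▸ hb⟩
    · linarith
    · linarith
  refine Pl_eq_of_le h'.1 (Pl_le (one_mem_Pl _ _) ?_ ?_)
  · exact h.mem_Pl_of_deg_lt (hS ▸ mid_mem_Sp x u v) huv.1
  · exact h.mem_Pl_of_deg_lt (hS ▸ right_mem_Sp x u v) huv.2

theorem Good.not_mem_Pl_of_deg {x u v c : Poly3 k} (h : Good x u v) (hc : deg c = deg x) :
    c ∉ Pl u v := by
  intro hm
  obtain ⟨r, y, z, rfl⟩ := mem_Pl.1 hm
  have hy := h.rot.1.deg_pos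
  have hz := h.rot.rot.1.deg_pos
  have e : C r + y • u + z • v = C r + (0 : k) • x + y • u + z • v := by simp
  have hx := h.1.deg_pos
  have h1 := h.2.1
  have h2 := h.2.2.1
  rw [e, h.deg_combo, zero_smul, deg_zero, max_eq_right (le_max_of_le_left (deg_nonneg _))] at hc
  rcases max_choice (deg (y • u)) (deg (z • v)) with h3 | h3 <;> rw [h3] at hc
  · by_cases hy0 : y = 0
    · rw [hy0, zero_smul, deg_zero] at hc
      linarith
    · rw [deg_smul hy0] at hc
      exact h1 hc.symm
  · by_cases hz0 : z = 0
    · rw [hz0, zero_smul, deg_zero] at hc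
      linarith
    · rw [deg_smul hz0] at hc
      exact h2 hc.symm

theorem Keller.exists_coprime_max_D [CharZero k] {f b c ρ : Poly3 k} (h : Keller f b c)
    (hρ : ρ ∈ Algebra.adjoin k {b, c}) (hn : ∀ i j : ℕ, i * deg b + j * deg c ≠ deg ρ) :
    ∃ p q : ℕ, 0 < p ∧ 0 < q ∧ p.Coprime q ∧ p * deg b = q * deg c ∧
      (2 ≤ p → 2 ≤ q → p * deg b + D b c ≤ deg b + max (D f c) (D (f + ρ) c)) := by
  obtain ⟨φ, rfl⟩ := exists_aeval_of_mem_adjoin hρ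
  have hb := h.rot.deg_pos
  have hD := h.D_pos
  have hN : ¬ NType b c φ := fun hN => by
    obtain ⟨i, j, hij⟩ := hN.nt.2
    exact hn i j hij
  obtain ⟨p, q, hp, hq, hcop, hpq, -, h2⟩ :=
    exists_coprime_of_not_nType hb h.rot.rot.deg_pos hD hN
  refine ⟨p, q, hp, hq, hcop, hpq, fun hp2 hq2 => ?_⟩
  have h3 := h2 hp2 hq2
  have hne : aeval ![b, c] (pderiv 0 φ) ≠ 0 := by
    refine ne_zero_of_deg_pos ?_
    have : (2 : ℝ) ≤ p := by exact_mod_cast hp2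
    nlinarith
  have h4 : vd (cr (aeval ![b, c] φ) c) = deg (aeval ![b, c] (pderiv 0 φ)) + D b c := by
    rw [cr_aeval_right, vd_smul hne hD, D]
  have h5 : cr (aeval ![b, c] φ) c = cr (f + aeval ![b, c] φ) c + (C (-1) : Poly3 k) • cr f c := by
    rw [cr_add_left]
    simp
  have h6 := vd_add_le (cr (f + aeval ![b, c] φ) c) ((C (-1) : Poly3 k) • cr f c)
  rw [← h5, h4, vd_C_smul (by simp), max_comm] at h6
  change _ ≤ max (D f c) (D (f + _) c) at h6
  linarith

theorem eq_of_coprime_ratio {p q s : ℕ} {B G : ℝ} (hs : Odd s) (hG : 0 < G)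
    (hc : p.Coprime q) (h1 : p * B = q * G) (h2 : 2 * B = s * G) : p = 2 ∧ q = s := by
  have e : p * s = 2 * q := by
    have : (p * s : ℝ) * G = (2 * q : ℝ) * G := by linear_combination 2 * h1 - p * h2
    exact_mod_cast mul_right_cancel₀ hG.ne' this
  have hc2 : Nat.Coprime 2 s := (Nat.coprime_two_left).2 hs
  have e1 : p ∣ 2 := hc.dvd_of_dvd_mul_right (Dvd.intro _ e)
  have e2 : 2 ∣ p := hc2.dvd_of_dvd_mul_right (Dvd.intro _ e.symm)
  obtain rfl : p = 2 := Nat.dvd_antisymm e1 e2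
  exact ⟨rfl, by omega⟩

/-- A minimal `y` over the plane of `b, c` of degree ratio `s / 2` with large `D y c` cannot be
reduced. -/
theorem not_red_of_ratio [CharZero k] {y b c : Poly3 k} {s : ℕ} {μ : ℝ} (hstep : Step k μ)
    (hG : Good y b c) (hμ : deg y + deg b + deg c ≤ μ) (hs : Odd s) (hs3 : 3 ≤ s)
    (h2b : 2 * deg b = s * deg c)
    (hns : ∀ i j : ℕ, i * deg b + j * deg c ≠ deg y)
    (hmin : ∀ σ ∈ Algebra.adjoin k {b, c}, deg y ≤ deg (y + σ)) (hy2 : deg y < 2 * deg b)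
    (h1 : deg b + D b c ≤ D y c) (h2 : D y b + deg c = deg b + D y c) :
    ¬ Red (Sp y b c) := by
  intro hR
  have hb := hG.rot.1.deg_pos
  have hc := hG.rot.rot.1.deg_pos
  have hD := hG.1.D_pos
  have hle := D_le y c
  have hs3' : (3 : ℝ) ≤ s := by exact_mod_cast hs3
  have hcb : 3 * deg c ≤ 2 * deg b := by nlinarith
  have hyb : deg y ≠ deg b := hG.2.1
  have hyc : deg y ≠ deg c := hG.2.2.1
  generalize hV : Sp y b c = V at hR
  cases hR with
  | base =>
    refine hG.rot.base_ratio (by rw [← Sp_rot]; exact hV) (p := 2) (q := s) (by norm_num) ?_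
    push_cast
    exact h2b
  | elem hN hlt1 hR1 =>
    rw [← hV] at hN hlt1
    obtain ⟨x, u, v, ψ, hG1, hS1, hV1, hψ, hlt2, hnum⟩ := hN.redNum hG hlt1
    have hnp := hG.not_red_of_min hmin hG1 hS1 hψ hlt2
    have hpc := hG1.1.plane_cases hS1 (by linarith) (by linarith)
    have hD1 := hpc.2.1.resolve_left hnp
    rcases hnum with ⟨hx, ⟨i, j, hij⟩ | ⟨p, q, hp, hq, hcop, h5, h6⟩⟩ |
      ⟨hx, ⟨i, j, hij⟩ | ⟨p, q, hp, hq, hcop, h5, h6⟩⟩ |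
      ⟨hx, ⟨i, j, hij⟩ | ⟨p, q, hp, hq, hcop, h5, h6⟩⟩
    · exact hns i j hij
    · obtain ⟨rfl, rfl⟩ := eq_of_coprime_ratio hs hc hcop h5 h2b
      push_cast at h6
      exact hnp (hG.Pl_eq_of_deg hG1 hS1 (by linarith) (by linarith) hx)
    · have hi : i = 2 ∧ j = 0 ∧ s = 3 := by
        rcases Nat.eq_zero_or_pos i with rfl | hi
        · exfalso
          have : (2 * j : ℝ) * deg c = (s : ℝ) * deg c := by push_cast at hij; linarith
          have : 2 * j = s := by exact_mod_cast mul_right_cancel₀ hc.ne' this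
          exact (Nat.not_even_iff_odd.2 hs) ⟨j, by omega⟩
        obtain rfl | hi' : i = 1 ∨ 2 ≤ i := by omega
        · exfalso
          rcases Nat.eq_zero_or_pos j with rfl | hj
          · push_cast at hij
            exact hyb (by linarith)
          · have : (1 : ℝ) ≤ j := by exact_mod_cast hj
            push_cast at hij
            nlinarith
        · have h7 : (2 : ℝ) ≤ i := by exact_mod_cast hi'
          have h8 : (s : ℝ) * deg c < 4 * deg c := by
            have := mul_le_mul_of_nonneg_right h7 (deg_nonneg y)
            have := mul_nonneg (Nat.cast_nonneg (α := ℝ) j) hc.le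
            linarith
          have h9 : s < 4 := by exact_mod_cast lt_of_mul_lt_mul_right h8 hc.le
          obtain rfl : s = 3 := by omega
          push_cast at h2b
          have h10 : i < 3 := by
            by_contra! hi3
            have : (3 : ℝ) ≤ i := by exact_mod_cast hi3
            have := mul_le_mul_of_nonneg_right this (deg_nonneg y)
            have := mul_nonneg (Nat.cast_nonneg (α := ℝ) j) hc.le
            linarith
          obtain rfl : i = 2 := by omega
          have h11 : j = 0 := by
            by_contra hj
            have : (1 : ℝ) ≤ j := by exact_mod_cast Nat.one_le_iff_ne_zero.2 hj
            have := mul_le_mul_of_nonneg_right this hc.le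
            push_cast at hij
            linarith
          exact ⟨rfl, h11, rfl⟩
      obtain ⟨rfl, rfl, rfl⟩ := hi
      push_cast at hij h2b
      have hP : Pl u v = Pl c y :=
        hG.rot.Pl_eq_of_deg hG1 (hS1.trans (Sp_rot _ _ _)) (by linarith) (by linarith) hx
      obtain ⟨ρ, hρ, hSρ, hGρ⟩ := exists_good_adapted hψ hG.rot.1 hG.rot.2.2.2
        (hS1.trans (Sp_rot _ _ _)) hP
      rw [hV1, hSρ] at hlt1 hR1
      rw [hGρ.vdeg_eq, hG.vdeg_eq] at hlt1
      have hSD : SData b c y (deg c / 4) := by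
        refine ⟨hG.rot.1, by linarith, by linarith, by linarith, by linarith, ?_, ?_⟩
        · rw [D_comm]; linarith
        · rw [D_comm, D_comm c]; linarith
      obtain ⟨χ, hχ, hχ1, -⟩ := hSD.exists_red (μ := μ) (by linarith) hstep hρ (by linarith) hR1
      have := hmin χ hχ
      linarith
    · exfalso
      obtain rfl | hp2 : p = 1 ∨ 2 ≤ p := by omega
      · exact hns 0 q (by push_cast at *; linarith)
      have hp2' : (2 : ℝ) ≤ p := by exact_mod_cast hp2
      have h7 := mul_le_mul_of_nonneg_right hp2' (deg_nonneg y)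
      obtain rfl | hp3 : p = 2 ∨ 3 ≤ p := by omega
      · rcases (show q = 1 ∨ q = 2 ∨ 3 ≤ q by omega) with rfl | rfl | h
        · push_cast at h5
          linarith
        · push_cast at h5
          exact hyc (by linarith)
        · have := mul_le_mul_of_nonneg_right (show (3 : ℝ) ≤ q by exact_mod_cast h) hc.le
          push_cast at h5 h6
          linarith
      · have := mul_le_mul_of_nonneg_right (show (3 : ℝ) ≤ p by exact_mod_cast hp3) (deg_nonneg y)
        linarith
    · exfalso
      have hj : j = 0 := by
        by_contra hj
        have : (1 : ℝ) ≤ j := by exact_mod_cast Nat.one_le_iff_ne_zero.2 hj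
        have := mul_le_mul_of_nonneg_right this hb.le
        have := mul_nonneg (Nat.cast_nonneg (α := ℝ) i) (deg_nonneg y)
        linarith
      subst hj
      rcases (show i = 0 ∨ i = 1 ∨ i = 2 ∨ 3 ≤ i by omega) with rfl | rfl | rfl | h
      · push_cast at hij; linarith
      · push_cast at hij; exact hyc (by linarith)
      · push_cast at hij; linarith
      · have := mul_le_mul_of_nonneg_right (show (3 : ℝ) ≤ i by exact_mod_cast h) (deg_nonneg y)
        push_cast at hij
        linarith
    · exfalso
      have hD2 := hpc.2.2.resolve_left (hG1.not_mem_Pl_of_deg hx.symm)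
      obtain rfl | hp2 : p = 1 ∨ 2 ≤ p := by omega
      · exact hns q 0 (by push_cast at *; linarith)
      have := mul_le_mul_of_nonneg_right (show (2 : ℝ) ≤ p by exact_mod_cast hp2) (deg_nonneg y)
      linarith
  | kur hK hR1 =>
    have k1 := hK.deg1'
    have k2 := hK.deg2
    have k3 := hK.deg3
    have k6 := hK.hD
    have k7 := hK.D12_pos
    have k8 := (hK.plane_cases hG.1 hV).1
    rcases hG.perm hK.good hV.symm with ⟨h5, ⟨h6, h7⟩ | ⟨h6, h7⟩⟩ |
        ⟨h5, ⟨h6, h7⟩ | ⟨h6, h7⟩⟩ | ⟨h5, ⟨h6, h7⟩ | ⟨h6, h7⟩⟩ <;> linarith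

theorem Step.D_ge [CharZero k] {f b c φ : Poly3 k} {s : ℕ} {μ : ℝ} (hstep : Step k μ)
    (hG : Good f b c) (hμ : deg f + deg b + deg c ≤ μ) (hs : Odd s) (hs3 : 3 ≤ s)
    (h2b : 2 * deg b = s * deg c) (hns : ∀ i j : ℕ, i * deg b + j * deg c ≠ deg f)
    (hf2 : deg f < 2 * deg b) (hφ : φ ∈ Algebra.adjoin k {b, c}) (hlt : deg (f + φ) < deg f)
    (hR : Red (Sp (f + φ) b c)) :
    deg b + D b c ≤ D f c ∧ D f b + deg c = deg b + D f c := by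
  have key : ∀ {g : Poly3 k}, Good g b c → deg g < 2 * deg b → deg b + D b c ≤ D g c →
      D g b + deg c = deg b + D g c := by
    intro g hg hg2 h
    have h1 := hg.rot.1.two_max
    have h2 := hg.rot.rot.1.two_max
    rw [D_comm c g, D_comm b g] at h1
    rw [D_comm c b, D_comm c g] at h2
    rcases le_max_iff.1 h1 with h1 | h1 <;> rcases le_max_iff.1 h2 with h2 | h2 <;> linarith
  suffices h : deg b + D b c ≤ D f c from ⟨h, key hG hf2 h⟩
  by_contra! hlt'
  obtain ⟨ρ, hρ, hmin, hns0⟩ := hG.1.exists_min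
  have hc := hG.rot.rot.1.deg_pos
  have hle0 := (hmin φ hφ).trans_lt hlt
  have hK0 := hG.1.add_left hρ
  have hG0 : Good (f + ρ) b c :=
    ⟨hK0, fun h => hns0 1 0 (by simp [h]), fun h => hns0 0 1 (by simp [h]), hG.2.2.2⟩
  have hR0 : Red (Sp (f + ρ) b c) := by
    refine hstep _ _ hR ?_ ⟨f + φ, b, c, ρ - φ, hG.1.add_left hφ, sub_mem hρ hφ, rfl,
      by congr 1; abel⟩ ?_
    · have := (hG.1.add_left hφ).vdeg_le
      linarith
    · have := hK0.vdeg_le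
      linarith
  obtain ⟨p, q, hp, hq, hcop, hpq, h2⟩ :=
    hG.1.exists_coprime_max_D hρ (by rw [deg_eq_of_add_lt hle0]; exact hns)
  obtain ⟨rfl, rfl⟩ := eq_of_coprime_ratio hs hc hcop hpq h2b
  have h3 := h2 le_rfl (by omega)
  push_cast at h3
  have h4 : deg b + D b c ≤ D (f + ρ) c := by
    rcases le_max_iff.1 (show deg b + D b c ≤ max (D f c) (D (f + ρ) c) by linarith) with h | h
    · linarith
    · exact h
  have hle := D_le (f + ρ) c
  have hD := hG.1.D_pos
  have hs3' : (3 : ℝ) ≤ q := by exact_mod_cast hs3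
  have hcb : 3 * deg c ≤ 2 * deg b := by nlinarith
  refine not_red_of_ratio hstep hG0 (by linarith) hs hs3 h2b hns0 (fun σ hσ => ?_)
    (by linarith) h4 (key hG0 (by linarith) h4) hR0
  rw [add_assoc]
  exact hmin _ (add_mem hρ hσ)

end

section

variable {k : Type} [Field k]

theorem adjoin_singleton_le_right (b c : Poly3 k) :
    Algebra.adjoin k {c} ≤ Algebra.adjoin k {b, c} := Algebra.adjoin_mono (by simp)

theorem left_mem_adjoin (b c : Poly3 k) : b ∈ Algebra.adjoin k {b, c} :=
  Algebra.subset_adjoin (by simp)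

theorem right_mem_adjoin (b c : Poly3 k) : c ∈ Algebra.adjoin k {b, c} :=
  Algebra.subset_adjoin (by simp)

theorem smul_pow_mem_adjoin (c : Poly3 k) (r : k) (m : ℕ) :
    r • c ^ m ∈ Algebra.adjoin k {c} :=
  Subalgebra.smul_mem _ (pow_mem (Algebra.self_mem_adjoin_singleton k c) m) r

theorem adjoin_pair_comm (b c : Poly3 k) : Algebra.adjoin k {b, c} = Algebra.adjoin k {c, b} := by
  rw [Set.pair_comm]

theorem mem_adjoin_add_left {b c ψ φ : Poly3 k} (hψ : ψ ∈ Algebra.adjoin k {c})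
    (hφ : φ ∈ Algebra.adjoin k {b, c}) : φ ∈ Algebra.adjoin k {b + ψ, c} := by
  refine (Algebra.adjoin_le (S := Algebra.adjoin k {b + ψ, c}) ?_) hφ
  rintro x (rfl | rfl)
  · have := sub_mem (left_mem_adjoin (x + ψ) c) (adjoin_singleton_le_right (x + ψ) c hψ)
    simpa using this
  · exact right_mem_adjoin _ _

theorem Sp_reverse (a b c : Poly3 k) : Sp a b c = Sp c b a := by
  rw [Sp_swap', Sp_swap, Sp_swap']

theorem exists_pow_reduction {a c : Poly3 k} {m : ℕ} (h : deg a = m * deg c) (ha : 0 < deg a) :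
    ∃ r : k, deg (a + r • c ^ m) < deg a := by
  have hc : c ≠ 0 := by
    rintro rfl
    rw [deg_zero, mul_zero] at h
    linarith
  have h1 : deg (c ^ m) = deg a := by rw [deg_pow hc, h]
  obtain ⟨r, -, hr⟩ := exists_smul_deg_lt h1.symm (h1 ▸ ha)
  exact ⟨r, h1 ▸ hr⟩

theorem deg_le_of_add_le {b ψ : Poly3 k} (h : deg (b + ψ) ≤ deg b) : deg ψ ≤ deg b := by
  have := deg_sub_le (b + ψ) b
  rw [add_sub_cancel_left] at this
  exact this.trans (max_le h le_rfl)

namespace Step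

variable {μ : ℝ}

theorem red (h : Step k μ) {a b c ψ ψ' : Poly3 k} (hK : Keller (a + ψ) b c)
    (hψ : ψ' - ψ ∈ Algebra.adjoin k {b, c}) (hR : Red (Sp (a + ψ) b c))
    (h1 : deg (a + ψ) + deg b + deg c < μ) (h2 : deg (a + ψ') + deg b + deg c ≤ μ) :
    Red (Sp (a + ψ') b c) := by
  have e : a + ψ' = a + ψ + (ψ' - ψ) := by abel
  refine h _ _ hR (hK.vdeg_le.trans_lt h1) ⟨a + ψ, b, c, ψ' - ψ, hK, hψ, rfl, by rw [e]⟩ ?_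
  rw [e] at h2 ⊢
  exact (hK.add_left hψ).vdeg_le.trans h2

theorem path (hs : Step k μ) {a b c φ ψ : Poly3 k} (h : Keller a b c)
    (hμ : deg a + deg b + deg c ≤ μ) (hφ : φ ∈ Algebra.adjoin k {b, c})
    (h1 : deg (a + φ) < deg a) (hR : Red (Sp (a + φ) b c)) (hψ : ψ ∈ Algebra.adjoin k {a, c})
    (h2 : deg (b + ψ) ≤ deg b)
    (hor : φ ∈ Algebra.adjoin k {c} ∨ ψ ∈ Algebra.adjoin k {c}) : Red (Sp a (b + ψ) c) := by
  have hψ' : ψ ∈ Algebra.adjoin k {a + φ, c} := by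
    rcases hor with hor | hor
    · exact mem_adjoin_add_left hor hψ
    · exact adjoin_singleton_le_right _ _ hor
  have hφ' : φ ∈ Algebra.adjoin k {b + ψ, c} := by
    rcases hor with hor | hor
    · exact adjoin_singleton_le_right _ _ hor
    · exact mem_adjoin_add_left hor hφ
  have hK1 : Keller b (a + φ) c := (h.add_left hφ).rot.swap
  have hw : Red (Sp (b + ψ) (a + φ) c) := by
    refine hs.red (ψ := 0) (by simpa using hK1) (by simpa using hψ') ?_ ?_ ?_
    · rw [add_zero, Sp_swap']
      exact hR
    · rw [add_zero]
      linarith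
    · linarith
  have hK2 : Keller (a + φ) (b + ψ) c := (hK1.add_left hψ').rot.swap
  have := hs.red (a := a) (ψ := φ) (ψ' := 0) (b := b + ψ) hK2 (by simpa using hφ')
    (by rw [Sp_swap']; exact hw) (by linarith) (by rw [add_zero]; linarith)
  simpa using this

end Step

theorem Good.red_of_lt {a b c φ : Poly3 k} (h : Good a b c) (hφ : φ ∈ Algebra.adjoin k {b, c})
    (h1 : deg (a + φ) < deg a) (hR : Red (Sp (a + φ) b c)) : Red (Sp a b c) := by
  refine Red.elem ⟨a, b, c, φ, h.1, hφ, rfl, rfl⟩ ?_ hR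
  rw [h.vdeg_eq]
  have := (h.1.add_left hφ).vdeg_le
  linarith

namespace Step

variable {μ : ℝ}

/-- The case where the degrees of `a` or `b` are multiples of that of `c`. -/
theorem adapted_of_mul (hs : Step k μ) {a b c φ ψ : Poly3 k} (h : Keller a b c)
    (hμ : deg a + deg b + deg c ≤ μ) (hφ : φ ∈ Algebra.adjoin k {b, c})
    (h1 : deg (a + φ) < deg a) (hR : Red (Sp (a + φ) b c)) (hψ : ψ ∈ Algebra.adjoin k {a, c})
    (h2 : deg (b + ψ) ≤ deg b)
    (hor : (∃ m : ℕ, deg a = m * deg c) ∨ ∃ m : ℕ, deg b = m * deg c) :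
    Red (Sp a (b + ψ) c) := by
  rcases hor with ⟨m, hm⟩ | ⟨m, hm⟩
  · obtain ⟨r, hr⟩ := exists_pow_reduction hm h.deg_pos
    have hr' := smul_pow_mem_adjoin c r m
    have hr'' := adjoin_singleton_le_right b c hr'
    refine hs.path h hμ hr'' hr ?_ hψ h2 (Or.inl hr')
    exact hs.red (h.add_left hφ) (sub_mem hr'' hφ) hR (by linarith) (by linarith)
  · obtain ⟨r, hr⟩ := exists_pow_reduction hm h.rot.deg_pos
    have hr' := smul_pow_mem_adjoin c r m
    have hr'' := adjoin_singleton_le_right a c hr'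
    have := hs.path h hμ hφ h1 hR hr'' hr.le (Or.inr hr')
    rw [Sp_swap'] at this ⊢
    exact hs.red (h.rot.swap.add_left hr'') (sub_mem hψ hr'') this (by linarith) (by linarith)

/-- Reducing the third element by a power of the first one. -/
theorem adapted_of_pow_left (hs : Step k μ) {a b c ψ : Poly3 k} {r : k} {m : ℕ} (h : Keller a b c)
    (hμ : deg a + deg b + deg c ≤ μ) (hr : deg (c + r • a ^ m) < deg c)
    (hR : Red (Sp a b (c + r • a ^ m))) (hψ : ψ ∈ Algebra.adjoin k {a, c})
    (h2 : deg (b + ψ) ≤ deg b) : Red (Sp a (b + ψ) c) := by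
  have hr' := smul_pow_mem_adjoin a r m
  rw [Sp_reverse] at hR ⊢
  exact hs.path h.rot.rot.swap (by linarith) (adjoin_singleton_le_right b a hr') hr hR
    (by rwa [adjoin_pair_comm]) h2 (Or.inl hr')

end Step

end

section

variable {k : Type} [Field k]

theorem cast_mul_le {n m : ℕ} (h : n ≤ m) {x : ℝ} (hx : 0 ≤ x) : (n : ℝ) * x ≤ m * x :=
  mul_le_mul_of_nonneg_right (by exact_mod_cast h) hx

theorem ratio_cases {p q : ℕ} {B G : ℝ} (hB : 0 < B) (hG : 0 < G) (hp : 2 ≤ p) (hq : 2 ≤ q)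
    (hc : p.Coprime q) (h : p * B = q * G) (hlt : p * B < 2 * B + G) :
    (p = 2 ∧ Odd q ∧ 3 ≤ q) ∨ (p = 3 ∧ q = 2) := by
  have hq' := cast_mul_le hq hG.le
  push_cast at hq'
  have hp4 : p < 4 := by
    by_contra! h4
    have := cast_mul_le h4 hB.le
    push_cast at this
    linarith
  interval_cases p
  · left
    have hodd : Odd q := Nat.coprime_two_left.1 hc
    refine ⟨rfl, hodd, ?_⟩
    obtain ⟨m, rfl⟩ := hodd
    omega
  · right
    refine ⟨rfl, ?_⟩
    by_contra hne
    have := cast_mul_le (show 3 ≤ q by omega) hG.le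
    push_cast at this h hlt
    linarith

theorem NT.mem_adjoin_right {b c ψ : Poly3 k} (h : NT b c ψ)
    (hi : ∀ i j : ℕ, i * deg b + j * deg c ≤ deg ψ → i = 0) : ψ ∈ Algebra.adjoin k {c} := by
  refine h.mem (P := (Algebra.adjoin k {c}).toSubmodule) fun i j hij => ?_
  rw [hi i j hij, pow_zero, one_mul]
  exact pow_mem (Algebra.self_mem_adjoin_singleton k c) j

theorem NT.mem_adjoin_left {b c ψ : Poly3 k} (h : NT b c ψ)
    (hi : ∀ i j : ℕ, i * deg b + j * deg c ≤ deg ψ → j = 0) : ψ ∈ Algebra.adjoin k {b} := by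
  refine h.mem (P := (Algebra.adjoin k {b}).toSubmodule) fun i j hij => ?_
  rw [hi i j hij, pow_zero, mul_one]
  exact pow_mem (Algebra.self_mem_adjoin_singleton k b) i

theorem pow_mul_pow_mem_Pl (b c : Poly3 k) {i j : ℕ} (h : i + j ≤ 1) : b ^ i * c ^ j ∈ Pl b c := by
  rcases i with _ | i
  · rcases j with _ | j
    · simpa using one_mem_Pl b c
    · obtain rfl : j = 0 := by omega
      simpa using right_mem_Pl b c
  · obtain rfl : i = 0 := by omega
    obtain rfl : j = 0 := by omega
    simpa using left_mem_Pl b c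

theorem NT.mem_Pl {b c ψ : Poly3 k} (h : NT b c ψ)
    (hi : ∀ i j : ℕ, i * deg b + j * deg c ≤ deg ψ → i + j ≤ 1) : ψ ∈ Pl b c :=
  h.mem fun i j hij => pow_mul_pow_mem_Pl b c (hi i j hij)

theorem Sp_add_mid {a b c ψ : Poly3 k} (h : ψ ∈ Pl a c) : Sp a (b + ψ) c = Sp a b c := by
  rw [Sp_swap', Sp_add h, Sp_swap']

theorem mem_sup_span_pair {P : Submodule k (Poly3 k)} {x y v : Poly3 k}
    (h : v ∈ P ⊔ Submodule.span k {x, y}) : ∃ w ∈ P, ∃ r s : k, v = w + (r • x + s • y) := by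
  obtain ⟨w, hw, z, hz, rfl⟩ := Submodule.mem_sup.1 h
  obtain ⟨r, s, rfl⟩ := Submodule.mem_span_pair.1 hz
  exact ⟨w, hw, r, s, rfl⟩

namespace Step

variable {μ : ℝ}

/-- Replacing a reduction of the first element of degree `6` by one of the third of degree `3`. -/
theorem conflict [CharZero k] (hs : Step k μ) {f1 f2 f3 χ ρ : Poly3 k} {η : ℝ}
    (h : Keller f1 f2 f3) (h1 : deg f1 = 6 * η) (h2 : deg f2 = 4 * η) (h3 : deg f3 = 3 * η)
    (hμ : 13 * η ≤ μ) (hχ : χ ∈ Algebra.adjoin k {f1, f2}) (hχ3 : deg (f3 + χ) ≤ deg f3)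
    (h12 : 12 * η + D f1 f2 ≤ deg χ + 10 * η) (h23 : 12 * η + Wt ≤ deg χ + 6 * η + D f2 f3)
    (hρ : ρ ∈ Algebra.adjoin k {f2, f3}) (hlt : deg (f1 + ρ) < deg f1)
    (hR : Red (Sp (f1 + ρ) f2 f3)) : Red (Sp f1 f2 (f3 + χ)) := by
  have hχd := deg_le_of_add_le hχ3
  have hW := three_le_Wt
  have m1 := h.two_max
  have m2 := h.rot.swap.two_max
  have hp := h.deg_pos
  rw [D_comm f2 f1] at m2
  rw [h1, h2, h3] at m1 m2
  have hD13 : D f1 f3 = 2 * η + D f2 f3 := by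
    apply le_antisymm
    · rcases le_max_iff.1 m2 with m | m <;> linarith
    · rcases le_max_iff.1 m1 with m | m <;> linarith
  have hS : SData f1 f2 f3 η := ⟨h, h1, h2, h3, by linarith, by linarith, hD13⟩
  obtain ⟨χ', hχ', hlt', hR'⟩ := hS.exists_red hμ hs hρ (h1 ▸ hlt) hR
  rw [← Sp_rot] at hR' ⊢
  exact hs.red (h.rot.rot.add_left hχ') (sub_mem hχ hχ') hR' (by linarith) (by linarith)

section lt

variable [CharZero k] {a b c φ ψ : Poly3 k}

theorem adapted_lt_pow (hs : Step k μ) (h : Good a b c) (hμ : deg a + deg b + deg c ≤ μ)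
    (hφ : φ ∈ Algebra.adjoin k {b, c}) (h1 : deg (a + φ) < deg a) (hR : Red (Sp (a + φ) b c))
    (hψ : ψ ∈ Algebra.adjoin k {a, c}) (h2 : deg (b + ψ) ≤ deg b) (hlt : deg a < deg b)
    {p : ℕ} (hp : 2 ≤ p) (hpc : deg c = p * deg b) : Red (Sp a (b + ψ) c) := by
  have hb := h.1.rot.deg_pos
  have ha := h.1.deg_pos
  have hc := h.1.rot.rot.deg_pos
  have hψd := deg_le_of_add_le h2
  have h2b := cast_mul_le hp hb.le
  push_cast at h2b
  obtain ⟨r, hr⟩ := exists_pow_reduction hpc hc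
  have hr' := smul_pow_mem_adjoin b r p
  have hRc : Red (Sp a b (c + r • b ^ p)) := by
    rw [Sp_swap]
    exact hs.path h.1.swap (by linarith) (by rwa [adjoin_pair_comm]) h1 (by rwa [Sp_swap])
      (adjoin_singleton_le_right a b hr') hr.le (Or.inr hr')
  rcases h.1.rot.swap.nt_or_ct hψ with hN | ⟨p', q', hp', hq', hc', he, hD, -⟩
  · have hψa := hN.mem_adjoin_left fun i j hij => by
      by_contra hj
      have h3 := cast_mul_le (Nat.one_le_iff_ne_zero.2 hj) hc.le
      have h4 : 0 ≤ (i : ℝ) * deg a := by positivity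
      push_cast at h3
      linarith
    rw [Sp_reverse]
    refine hs.path h.1.rot.rot.swap (by linarith) (adjoin_singleton_le_right a b hr' |> fun h => ?_)
      hr ?_ (adjoin_singleton_le_right c a hψa) h2 (Or.inr hψa)
    · rwa [adjoin_pair_comm]
    · rwa [Sp_reverse]
  · have hq1 : q' = 1 := by
      by_contra hne
      have h3 := cast_mul_le (show 2 ≤ q' by omega) hc.le
      have h4 := D_nonneg a c
      push_cast at h3
      linarith
    subst hq1
    obtain ⟨r', hr'⟩ := exists_pow_reduction (m := p') (a := c) (c := a) (by rw [he]; simp) hc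
    refine hs.adapted_of_pow_left h.1 hμ hr' ?_ hψ h2
    rw [← Sp_rot] at hRc ⊢
    refine hs.red (h.1.rot.rot.add_left ?_) (sub_mem ?_ ?_) hRc (by linarith) (by linarith)
    · exact adjoin_singleton_le_right _ _ (smul_pow_mem_adjoin b r p)
    · rw [adjoin_pair_comm]
      exact adjoin_singleton_le_right _ _ (smul_pow_mem_adjoin a r' p')
    · exact adjoin_singleton_le_right _ _ (smul_pow_mem_adjoin b r p)

theorem adapted_lt_three_two (hs : Step k μ) (h : Good a b c) (hμ : deg a + deg b + deg c ≤ μ)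
    (hφ : φ ∈ Algebra.adjoin k {b, c}) (h1 : deg (a + φ) < deg a) (hR : Red (Sp (a + φ) b c))
    (hψ : ψ ∈ Algebra.adjoin k {a, c}) (h2 : deg (b + ψ) ≤ deg b) (hlt : deg a < deg b)
    (hr : 3 * deg b = 2 * deg c) (hD : 3 * deg b + D b c ≤ deg a + deg b + deg c) :
    Red (Sp a (b + ψ) c) := by
  have hb := h.1.rot.deg_pos
  have ha := h.1.deg_pos
  have hc := h.1.rot.rot.deg_pos
  have hD0 := h.1.D_pos
  have hψd := deg_le_of_add_le h2
  obtain ⟨hU1, hU2⟩ := hs.D_ge (s := 3) h.swap (by linarith) (by decide) le_rfl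
    (by push_cast; linarith) (fun i j hij => by
      rcases i with _ | i
      · rcases j with _ | j
        · simp at hij
          linarith
        · have h3 := cast_mul_le (show 1 ≤ j + 1 by omega) hb.le
          simp only [CharP.cast_eq_zero, zero_mul, zero_add] at hij
          push_cast at h3 hij
          linarith
      · have h3 := cast_mul_le (show 1 ≤ i + 1 by omega) hc.le
        have h4 : 0 ≤ (j : ℝ) * deg b := by positivity
        push_cast at h3 hij
        linarith) (by linarith) (by rwa [adjoin_pair_comm]) h1 (by rwa [Sp_swap])
  rw [D_comm c b] at hU1
  rcases h.1.rot.swap.nt_or_ct hψ with hN | ⟨p', q', hp', hq', hc', he, hD', -⟩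
  · have hψ' := hN.mem_Pl fun i j hij => by
      have hj : j = 0 := by
        by_contra hj
        have h3 := cast_mul_le (Nat.one_le_iff_ne_zero.2 hj) hc.le
        have h4 : 0 ≤ (i : ℝ) * deg a := by positivity
        push_cast at h3
        linarith
      subst hj
      by_contra hi
      have h3 := cast_mul_le (show 2 ≤ i by omega) ha.le
      push_cast at h3 hij
      linarith
    rw [Sp_add_mid hψ']
    exact h.red_of_lt hφ h1 hR
  · have h3 := cast_mul_le hq' hc.le
    push_cast at h3
    linarith

theorem adapted_lt_two (hs : Step k μ) (h : Good a b c) (hμ : deg a + deg b + deg c ≤ μ)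
    (hφ : φ ∈ Algebra.adjoin k {b, c}) (h1 : deg (a + φ) < deg a) (hR : Red (Sp (a + φ) b c))
    (hψ : ψ ∈ Algebra.adjoin k {a, c}) (h2 : deg (b + ψ) ≤ deg b) (hlt : deg a < deg b)
    (ham : ∀ m : ℕ, deg a ≠ m * deg c) {s : ℕ} (hs3 : 3 ≤ s) (hso : Odd s)
    (hr : 2 * deg b = s * deg c) (hD : 2 * deg b + D b c ≤ deg a + deg b + deg c) :
    Red (Sp a (b + ψ) c) := by
  have hb := h.1.rot.deg_pos
  have ha := h.1.deg_pos
  have hc := h.1.rot.rot.deg_pos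
  have hD0 := h.1.D_pos
  have hψd := deg_le_of_add_le h2
  have hsc := cast_mul_le hs3 hc.le
  push_cast at hsc
  obtain ⟨hU1, hU2⟩ := hs.D_ge h hμ hso hs3 hr (fun i j hij => by
      rcases i with _ | i
      · exact ham j (by rw [← hij]; simp)
      · have h3 := cast_mul_le (show 1 ≤ i + 1 by omega) hb.le
        have h4 : 0 ≤ (j : ℝ) * deg c := by positivity
        push_cast at h3 hij
        linarith) (by linarith) hφ h1 hR
  rcases h.1.rot.swap.nt_or_ct hψ with hN | ⟨p', q', hp', hq', hc', he, hD', -⟩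
  · have hij0 : ∀ i j : ℕ, i * deg a + j * deg c ≤ deg ψ →
        i = 0 ∨ (i = 1 ∧ j = 0) ∨ (i = 2 ∧ j = 0 ∧ 2 * deg a ≤ deg b) := by
      intro i j hij
      rcases Nat.eq_zero_or_pos i with hi | hi
      · exact Or.inl hi
      right
      have hj : j = 0 := by
        by_contra hj
        have h3 := cast_mul_le (Nat.one_le_iff_ne_zero.2 hj) hc.le
        have h4 := cast_mul_le hi ha.le
        push_cast at h3 h4
        linarith
      subst hj
      have hi3 : i < 3 := by
        by_contra! hi
        have h3 := cast_mul_le hi ha.le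
        push_cast at h3 hij
        linarith
      interval_cases i
      · simp
      · right
        push_cast at hij
        exact ⟨rfl, rfl, by linarith⟩
    by_cases h2a : 2 * deg a ≤ deg b
    · obtain rfl : s = 3 := by
        by_contra hne
        have h3 := cast_mul_le (show 5 ≤ s by obtain ⟨m, rfl⟩ := hso; omega) hc.le
        push_cast at h3
        linarith
      push_cast at hr
      have hmem : ψ ∈ Pl a c ⊔ Submodule.span k {a ^ 2, a ^ 2} := by
        refine hN.mem fun i j hij => ?_
        rcases hij0 i j hij with rfl | ⟨rfl, rfl⟩ | ⟨rfl, rfl, -⟩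
        · refine Submodule.mem_sup_left (pow_mul_pow_mem_Pl a c ?_)
          by_contra hj
          have h3 := cast_mul_le (show 2 ≤ j by omega) hc.le
          push_cast at h3 hij
          linarith
        · exact Submodule.mem_sup_left (pow_mul_pow_mem_Pl a c (by simp))
        · refine Submodule.mem_sup_right (Submodule.subset_span ?_)
          simp
      obtain ⟨l, hl, κ1, κ2, rfl⟩ := mem_sup_span_pair hmem
      rw [← add_smul] at *
      set κ := κ1 + κ2
      by_cases hκ : κ = 0
      · rw [hκ, zero_smul, add_zero, Sp_add_mid hl]
        exact h.red_of_lt hφ h1 hR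
      · have hld : deg (κ • a ^ 2) ≤ deg b :=
          (deg_smul_le _ _).trans ((deg_pow_le _ _).trans (by push_cast; linarith))
        have e : Sp a (b + (l + κ • a ^ 2)) c = Sp (b + κ • a ^ 2) c a := by
          rw [add_comm l, ← add_assoc, Sp_add_mid hl, Sp_rot]
        rw [e]
        refine Red.kur (f1 := b) (χ := φ) (κ := -κ) (δ := deg c / 2) ⟨?_, neg_ne_zero.2 hκ, ?_, ?_,
          ?_, ?_, hφ, h1, ?_, ?_⟩ (by rwa [← Sp_rot])
        · refine h.1.rot.add_left ?_
          exact adjoin_singleton_le_right _ _ (smul_pow_mem_adjoin a κ 2)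
        · rw [neg_smul]
          abel
        · linarith
        · linarith
        · refine (deg_add_le _ _).trans (max_le ?_ ?_) <;> linarith
        · linarith
        · rw [D_comm c a]
          linarith
    · have hmem : ψ ∈ (Algebra.adjoin k {c}).toSubmodule ⊔ Submodule.span k {a, a} := by
        refine hN.mem fun i j hij => ?_
        rcases hij0 i j hij with rfl | ⟨rfl, rfl⟩ | ⟨-, -, hh⟩
        · rw [pow_zero, one_mul]
          exact Submodule.mem_sup_left (pow_mem (Algebra.self_mem_adjoin_singleton k c) j)
        · refine Submodule.mem_sup_right (Submodule.subset_span ?_)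
          simp
        · exact absurd hh h2a
      obtain ⟨ψ0, h0, r, r', rfl⟩ := mem_sup_span_pair hmem
      rw [← add_smul] at *
      have h0' := adjoin_singleton_le_right a c h0
      rw [← add_assoc, Sp_add_mid (Submodule.smul_mem _ _ (left_mem_Pl a c))]
      refine hs.path h.1 hμ hφ h1 hR h0' ?_ (Or.inr h0)
      have e : b + ψ0 = b + (ψ0 + (r + r') • a) - (r + r') • a := by abel
      rw [e]
      exact (deg_sub_le _ _).trans (max_le h2 ((deg_smul_le _ _).trans hlt.le))
  · exfalso
    have hq1 := cast_mul_le hq' hc.le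
    push_cast at hq1
    have hp2 : 2 ≤ p' := by
      by_contra hne
      obtain rfl : p' = 1 := by omega
      exact ham q' (by rw [← he]; simp)
    have h3 := cast_mul_le hp2 ha.le
    push_cast at h3
    have hq1 : q' = 1 := by
      by_contra hne
      have h3 := cast_mul_le (show 2 ≤ q' by omega) hc.le
      push_cast at h3
      linarith
    subst hq1
    push_cast at he
    linarith

theorem adapted_lt (hs : Step k μ) (h : Good a b c) (hμ : deg a + deg b + deg c ≤ μ)
    (hφ : φ ∈ Algebra.adjoin k {b, c}) (h1 : deg (a + φ) < deg a) (hR : Red (Sp (a + φ) b c))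
    (hψ : ψ ∈ Algebra.adjoin k {a, c}) (h2 : deg (b + ψ) ≤ deg b) (hlt : deg a < deg b)
    (ham : ∀ m : ℕ, deg a ≠ m * deg c) (hbm : ∀ m : ℕ, deg b ≠ m * deg c) :
    Red (Sp a (b + ψ) c) := by
  have hb := h.1.rot.deg_pos
  have hc := h.1.rot.rot.deg_pos
  have hD0 := h.1.D_pos
  have hφd := deg_le_of_add_le h1.le
  rcases h.1.nt_or_ct hφ with hN | ⟨p, q, hp, hq, hpq, he, hD, -⟩
  · refine hs.path h.1 hμ hφ h1 hR hψ h2 (Or.inl (hN.mem_adjoin_right fun i j hij => ?_))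
    by_contra hi
    have h3 := cast_mul_le (Nat.one_le_iff_ne_zero.2 hi) hb.le
    have h4 : 0 ≤ (j : ℝ) * deg c := by positivity
    push_cast at h3
    linarith
  · have hp2 : 2 ≤ p := by
      by_contra hne
      obtain rfl : p = 1 := by omega
      exact hbm q (by rw [← he]; simp)
    by_cases hq1 : q = 1
    · subst hq1
      exact hs.adapted_lt_pow h hμ hφ h1 hR hψ h2 hlt hp2 (by rw [he]; simp)
    · rcases ratio_cases hb hc hp2 (by omega) hpq he (by linarith) with ⟨rfl, ho, h3⟩ | ⟨rfl, rfl⟩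
      · push_cast at he hD
        exact hs.adapted_lt_two h hμ hφ h1 hR hψ h2 hlt ham h3 ho he (by linarith)
      · push_cast at he hD
        exact hs.adapted_lt_three_two h hμ hφ h1 hR hψ h2 hlt he (by linarith)

end lt
end Step

end

section

variable {k : Type} [Field k]

namespace Step

variable {μ : ℝ}

section gt

variable [CharZero k] {a b c φ ψ : Poly3 k}

theorem adapted_gt_pow (hs : Step k μ) (h : Good a b c) (hμ : deg a + deg b + deg c ≤ μ)
    (hφ : φ ∈ Algebra.adjoin k {b, c}) (h1 : deg (a + φ) < deg a) (hR : Red (Sp (a + φ) b c))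
    (hψ : ψ ∈ Algebra.adjoin k {a, c}) (h2 : deg (b + ψ) ≤ deg b) (hlt : deg b < deg a)
    {p : ℕ} (hp : 2 ≤ p) (hpc : deg c = p * deg a) : Red (Sp a (b + ψ) c) := by
  have hb := h.1.rot.deg_pos
  have ha := h.1.deg_pos
  have hc := h.1.rot.rot.deg_pos
  have hφd := deg_le_of_add_le h1.le
  have h2b := cast_mul_le hp ha.le
  push_cast at h2b
  obtain ⟨r, hr⟩ := exists_pow_reduction hpc hc
  have hr' : r • a ^ p ∈ Algebra.adjoin k {a, b} := by
    rw [adjoin_pair_comm]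
    exact adjoin_singleton_le_right _ _ (smul_pow_mem_adjoin a r p)
  have hφ' : φ ∈ Algebra.adjoin k {c, b} := by rwa [adjoin_pair_comm]
  have hR' : Red (Sp (a + φ) c b) := by rwa [Sp_swap]
  refine hs.adapted_of_pow_left h.1 hμ hr ?_ hψ h2
  rcases h.1.nt_or_ct hφ with hN | ⟨p', q', hp', hq', hc', he, hD, -⟩
  · rw [Sp_swap]
    refine hs.path h.1.swap (by linarith) hφ' h1 hR' hr' hr.le
      (Or.inl (hN.mem_adjoin_left fun i j hij => ?_))
    by_contra hj
    have h3 := cast_mul_le (Nat.one_le_iff_ne_zero.2 hj) hc.le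
    have h4 : 0 ≤ (i : ℝ) * deg b := by positivity
    push_cast at h3
    linarith
  · have hq1 : q' = 1 := by
      by_contra hne
      have h3 := cast_mul_le (show 2 ≤ q' by omega) hc.le
      have h4 := D_nonneg b c
      push_cast at h3
      linarith
    subst hq1
    obtain ⟨r', hr2⟩ := exists_pow_reduction (m := p') (a := c) (c := b) (by rw [he]; simp) hc
    have hr2' := smul_pow_mem_adjoin b r' p'
    have hr2'' := adjoin_singleton_le_right a b hr2'
    have := hs.path h.1.swap (by linarith) hφ' h1 hR' hr2'' hr2.le (Or.inr hr2')
    rw [Sp_swap, ← Sp_rot] at this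
    rw [← Sp_rot]
    exact hs.red (h.1.rot.rot.add_left hr2'') (sub_mem hr' hr2'') this (by linarith) (by linarith)

theorem adapted_gt_three_two (hs : Step k μ) (h : Good a b c) (hμ : deg a + deg b + deg c ≤ μ)
    (hφ : φ ∈ Algebra.adjoin k {b, c}) (h1 : deg (a + φ) < deg a) (hR : Red (Sp (a + φ) b c))
    (hψ : ψ ∈ Algebra.adjoin k {a, c}) (h2 : deg (b + ψ) ≤ deg b) (hlt : deg b < deg a)
    (hr : 3 * deg a = 2 * deg c) (hD : 3 * deg a + D a c ≤ deg ψ + deg a + deg c)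
    (hD1 : 3 * deg a + Wt ≤ deg ψ + deg a + D b c)
    (hD2 : 3 * deg a + Wt ≤ deg ψ + deg c + D b a) :
    Red (Sp a (b + ψ) c) := by
  have hb := h.1.rot.deg_pos
  have ha := h.1.deg_pos
  have hc := h.1.rot.rot.deg_pos
  have hD0 := D_nonneg a c
  have hψd := deg_le_of_add_le h2
  have hφd := deg_eq_of_add_lt h1
  have hD0' := h.1.rot.swap.D_pos
  have hW := three_le_Wt
  rcases h.1.nt_or_ct hφ with hN | ⟨p', q', hp', hq', hc', he, hD', -⟩
  · exfalso
    obtain ⟨i, j, hij⟩ := hN.2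
    rw [hφd] at hij
    have hj : j = 0 := by
      by_contra hj
      have h3 := cast_mul_le (Nat.one_le_iff_ne_zero.2 hj) hc.le
      have h4 : 0 ≤ (i : ℝ) * deg b := by positivity
      push_cast at h3
      linarith
    subst hj
    have hi : i < 2 := by
      by_contra! hi
      have h3 := cast_mul_le hi hb.le
      push_cast at h3 hij
      linarith
    interval_cases i <;> push_cast at hij <;> linarith
  · have hp3 : p' < 3 := by
      by_contra! hp
      have h3 := cast_mul_le hp hb.le
      push_cast at h3
      linarith
    have hq1 := cast_mul_le hq' hc.le
    push_cast at hq1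
    obtain rfl : p' = 2 := by
      by_contra hne
      obtain rfl : p' = 1 := by omega
      push_cast at he
      linarith
    obtain rfl : q' = 1 := by
      by_contra hne
      have h3 := cast_mul_le (show 2 ≤ q' by omega) hc.le
      push_cast at h3 he
      linarith
    obtain ⟨r, hr2⟩ := exists_pow_reduction (m := 2) (a := c) (c := b) (by rw [he]; simp) hc
    have hr2' := smul_pow_mem_adjoin b r 2
    have hr2'' := adjoin_singleton_le_right a b hr2'
    have := hs.path h.1.swap (by linarith) (by rwa [adjoin_pair_comm]) h1 (by rwa [Sp_swap]) hr2''
      hr2.le (Or.inr hr2')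
    rw [Sp_swap'] at this
    push_cast at he
    rw [← Sp_rot]
    refine hs.conflict (η := deg c / 6) h.1.rot.rot (by linarith) (by linarith) (by linarith)
      (by linarith) (by rwa [adjoin_pair_comm]) h2 ?_ ?_ hr2'' hr2 this
    · rw [D_comm]
      linarith
    · rw [D_comm]
      linarith

theorem adapted_gt_two (hs : Step k μ) (h : Good a b c) (hμ : deg a + deg b + deg c ≤ μ)
    (hφ : φ ∈ Algebra.adjoin k {b, c}) (h1 : deg (a + φ) < deg a) (hR : Red (Sp (a + φ) b c))
    (hψ : ψ ∈ Algebra.adjoin k {a, c}) (h2 : deg (b + ψ) ≤ deg b) (hlt : deg b < deg a)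
    (ham : ∀ m : ℕ, deg a ≠ m * deg c) (hbm : ∀ m : ℕ, deg b ≠ m * deg c)
    {s : ℕ} (hs3 : 3 ≤ s) (hso : Odd s)
    (hr : 2 * deg a = s * deg c) (hD : 2 * deg a + D a c ≤ deg ψ + deg a + deg c)
    (hD1 : 2 * deg a + Wt ≤ deg ψ + deg a + D b c) :
    Red (Sp a (b + ψ) c) := by
  have hb := h.1.rot.deg_pos
  have ha := h.1.deg_pos
  have hc := h.1.rot.rot.deg_pos
  have hD0 := h.1.rot.swap.D_pos
  have hψd := deg_le_of_add_le h2
  have hφd := deg_eq_of_add_lt h1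
  have hW := three_le_Wt
  have hsc := cast_mul_le hs3 hc.le
  push_cast at hsc
  rcases h.1.nt_or_ct hφ with hN | ⟨p', q', hp', hq', hc', he, hD', -⟩
  · obtain ⟨i, j, hij⟩ := hN.2
    rw [hφd] at hij
    have hi0 : i ≠ 0 := by
      rintro rfl
      exact ham j (by rw [← hij]; simp)
    have hj : j = 0 := by
      by_contra hj
      have h3 := cast_mul_le (Nat.one_le_iff_ne_zero.2 hj) hc.le
      have h4 := cast_mul_le (Nat.one_le_iff_ne_zero.2 hi0) hb.le
      push_cast at h3 h4
      linarith
    subst hj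
    have hi3 : i < 3 := by
      by_contra! hi
      have h3 := cast_mul_le hi hb.le
      push_cast at h3 hij
      linarith
    obtain rfl : i = 2 := by
      by_contra hne
      obtain rfl : i = 1 := by omega
      push_cast at hij
      linarith
    push_cast at hij
    obtain rfl : s = 3 := by
      by_contra hne
      have h3 := cast_mul_le (show 4 ≤ s by omega) hc.le
      push_cast at h3
      linarith
    push_cast at hr
    rw [Sp_swap]
    refine hs.conflict (η := deg c / 4) h.1.swap (by linarith) (by linarith) (by linarith)
      (by linarith) hψ h2 (by linarith) ?_ (by rwa [adjoin_pair_comm]) h1 (by rwa [Sp_swap])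
    rw [D_comm]
    linarith
  · exfalso
    have hp2 : p' ≠ 1 := by
      rintro rfl
      exact hbm q' (by rw [← he]; simp)
    have hp4 : p' < 4 := by
      by_contra! hp
      have h3 := cast_mul_le hp hb.le
      push_cast at h3
      linarith
    have hcase : p' = 2 ∨ p' = 3 := by omega
    rcases hcase with rfl | rfl
    · push_cast at he
      have hlt1 : q' < s := by
        by_contra! hle
        have := cast_mul_le hle hc.le
        linarith
      have hlt2 : s < q' + 2 := by
        by_contra! hle
        have := cast_mul_le hle hc.le
        push_cast at this
        linarith
      have hq'' : Odd q' := Nat.coprime_two_left.1 hc'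
      obtain ⟨m, rfl⟩ := hso
      obtain ⟨n, rfl⟩ := hq''
      omega
    · push_cast at he hD'
      have hq2 : q' = 2 := by
        have hlt1 : q' < 3 := by
          by_contra! hle
          have := cast_mul_le hle hc.le
          push_cast at this
          linarith
        have hlt2 : 1 < q' := by
          by_contra! hle
          have := cast_mul_le hle hc.le
          push_cast at this
          linarith
        omega
      subst hq2
      push_cast at he
      obtain rfl : s = 3 := by
        by_contra hne
        have h3 := cast_mul_le (show 4 ≤ s by omega) hc.le
        push_cast at h3
        linarith
      push_cast at hr
      obtain ⟨hU1, hU2⟩ := hs.D_ge (s := 3) h.swap (by linarith) (by decide) le_rfl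
        (by push_cast; linarith) (fun i j hij => by
          have e : ((12 * i + 8 * j : ℕ) : ℝ) * deg c = (18 : ℕ) * deg c := by
            rw [show deg b = 2 / 3 * deg c by linarith,
              show deg a = 3 / 2 * deg c by linarith] at hij
            push_cast
            linarith
          have e' := mul_right_cancel₀ hc.ne' e
          norm_cast at e'
          omega) (by linarith) (by rwa [adjoin_pair_comm]) h1 (by rwa [Sp_swap])
      rw [D_comm c b] at hU1
      have := D_nonneg b c
      linarith

theorem adapted_gt (hs : Step k μ) (h : Good a b c) (hμ : deg a + deg b + deg c ≤ μ)
    (hφ : φ ∈ Algebra.adjoin k {b, c}) (h1 : deg (a + φ) < deg a) (hR : Red (Sp (a + φ) b c))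
    (hψ : ψ ∈ Algebra.adjoin k {a, c}) (h2 : deg (b + ψ) ≤ deg b) (hlt : deg b < deg a)
    (ham : ∀ m : ℕ, deg a ≠ m * deg c) (hbm : ∀ m : ℕ, deg b ≠ m * deg c) :
    Red (Sp a (b + ψ) c) := by
  have ha := h.1.deg_pos
  have hc := h.1.rot.rot.deg_pos
  have hD0 := D_nonneg a c
  have hψd := deg_le_of_add_le h2
  rcases h.1.rot.swap.nt_or_ct hψ with hN | ⟨p, q, hp, hq, hpq, he, hD, hT⟩
  · refine hs.path h.1 hμ hφ h1 hR hψ h2 (Or.inr (hN.mem_adjoin_right fun i j hij => ?_))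
    by_contra hi
    have h3 := cast_mul_le (Nat.one_le_iff_ne_zero.2 hi) ha.le
    have h4 : 0 ≤ (j : ℝ) * deg c := by positivity
    push_cast at h3
    linarith
  · have hp2 : 2 ≤ p := by
      by_contra hne
      obtain rfl : p = 1 := by omega
      exact ham q (by rw [← he]; simp)
    by_cases hq1 : q = 1
    · subst hq1
      exact hs.adapted_gt_pow h hμ hφ h1 hR hψ h2 hlt hp2 (by rw [he]; simp)
    · obtain ⟨hT1, hT2⟩ := hT hp2 (by omega)
      rcases ratio_cases ha hc hp2 (by omega) hpq he (by linarith) with ⟨rfl, ho, h3⟩ | ⟨rfl, rfl⟩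
      · push_cast at he hD hT1
        exact hs.adapted_gt_two h hμ hφ h1 hR hψ h2 hlt ham hbm h3 ho he hD hT1
      · push_cast at he hD hT1 hT2
        exact hs.adapted_gt_three_two h hμ hφ h1 hR hψ h2 hlt he hD hT1 hT2

/-- Two reductions along adapted planes. -/
theorem adapted (hs : Step k μ) (h : Good a b c) (hμ : deg a + deg b + deg c ≤ μ)
    (hφ : φ ∈ Algebra.adjoin k {b, c}) (h1 : deg (a + φ) < deg a) (hR : Red (Sp (a + φ) b c))
    (hψ : ψ ∈ Algebra.adjoin k {a, c}) (h2 : deg (b + ψ) ≤ deg b) : Red (Sp a (b + ψ) c) := by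
  by_cases ham : ∃ m : ℕ, deg a = m * deg c
  · exact hs.adapted_of_mul h.1 hμ hφ h1 hR hψ h2 (Or.inl ham)
  by_cases hbm : ∃ m : ℕ, deg b = m * deg c
  · exact hs.adapted_of_mul h.1 hμ hφ h1 hR hψ h2 (Or.inr hbm)
  push Not at ham hbm
  rcases lt_or_gt_of_ne h.2.1 with hlt | hlt
  · exact hs.adapted_lt h hμ hφ h1 hR hψ h2 hlt ham hbm
  · exact hs.adapted_gt h hμ hφ h1 hR hψ h2 hlt ham hbm

end gt
end Step

end

section

variable {k : Type} [Field k]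

theorem D_add_left_of_lt {f g c : Poly3 k} (h : D f c < D g c) : D (f + g) c = D g c := by
  unfold D at *
  rw [cr_add_left]
  exact vd_add_eq_right h

theorem deg_add_le_left {b x : Poly3 k} (h : deg x ≤ deg b) : deg (b + x) ≤ deg b :=
  (deg_add_le _ _).trans (max_le le_rfl h)

theorem Keller.add_mid {x b c : Poly3 k} (h : Keller x b c) : Keller x (b + x) c :=
  (h.rot.swap.add_left (left_mem_adjoin x c)).rot.swap

theorem Sp_mid_add_left (x b c : Poly3 k) : Sp x (b + x) c = Sp x b c :=
  Sp_add_mid (left_mem_Pl x c)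

namespace Step

variable {μ : ℝ}

section nonadapted

variable {x b c φ ψ : Poly3 k}

theorem nonadapted_of_left (hs : Step k μ) (h : Keller x b c) (hμ : deg x + deg b + deg c ≤ μ)
    (hxb : deg x < deg b) (hφ : φ ∈ Algebra.adjoin k {c}) (h1 : deg (x + φ) < deg x)
    (hR : Red (Sp (x + φ) b c)) (hψ : ψ ∈ Algebra.adjoin k {b + x, c})
    (h2 : deg (x + ψ) ≤ deg x) : Red (Sp (x + ψ) (b + x) c) := by
  have hφ' := adjoin_singleton_le_right b c hφ
  have hφ2 := adjoin_singleton_le_right (b + x) c hφ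
  have hφ3 := adjoin_singleton_le_right (x + φ) c hφ
  have hd := deg_add_le_left hxb.le
  have hd' := deg_add_le_left (h1.trans hxb).le
  have hK := h.add_left hφ'
  have hw : Red (Sp (b + x) (x + φ) c) := by
    refine hs.red (ψ := x + φ) hK.add_mid.rot.swap ?_ ?_ (by linarith) (by linarith)
    · rw [show x - (x + φ) = -φ by abel]
      exact neg_mem hφ3
    · rwa [Sp_swap', Sp_mid_add_left]
  refine hs.red (h.add_mid.add_left hφ2) (sub_mem hψ hφ2) ?_ (by linarith) (by linarith)
  rwa [Sp_swap']

theorem nonadapted_of_right (hs : Step k μ) (h : Keller x b c) (hμ : deg x + deg b + deg c ≤ μ)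
    (hxb : deg x < deg b) (hφ : φ ∈ Algebra.adjoin k {b, c}) (h1 : deg (x + φ) < deg x)
    (hR : Red (Sp (x + φ) b c)) (hψ : ψ ∈ Algebra.adjoin k {c})
    (h2 : deg (x + ψ) ≤ deg x) : Red (Sp (x + ψ) (b + x) c) := by
  have e : Sp (x + ψ) (b + x) c = Sp (x + ψ) (b + -ψ) c := by
    rw [← Sp_mid_add_left (x + ψ) (b + -ψ)]
    congr 1
    abel
  have hψ' := neg_mem (adjoin_singleton_le_right (x + φ) c hψ)
  have hd : deg (b + -ψ) ≤ deg b := by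
    refine deg_add_le_left ?_
    rw [deg_neg]
    exact (deg_le_of_add_le h2).trans hxb.le
  have hK := (h.add_left hφ).rot.swap
  have hw : Red (Sp (b + -ψ) (x + φ) c) := by
    refine hs.red (ψ := 0) (by simpa using hK) (by simpa using hψ') ?_ ?_ (by linarith)
    · rwa [add_zero, Sp_swap']
    · rw [add_zero]
      linarith
  rw [e]
  refine hs.red (ψ := φ) (hK.add_left hψ').rot.swap (sub_mem ?_ ?_) ?_ (by linarith)
    (by linarith)
  · exact adjoin_singleton_le_right _ _ hψ
  · exact mem_adjoin_add_left (neg_mem hψ) hφ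
  · rwa [Sp_swap']

theorem nonadapted_of_mul (hs : Step k μ) (h : Keller x b c) (hμ : deg x + deg b + deg c ≤ μ)
    (hxb : deg x < deg b) (hφ : φ ∈ Algebra.adjoin k {b, c}) (h1 : deg (x + φ) < deg x)
    (hR : Red (Sp (x + φ) b c)) (hψ : ψ ∈ Algebra.adjoin k {b + x, c})
    (h2 : deg (x + ψ) ≤ deg x) {m : ℕ} (hm : deg b = m * deg c) :
    Red (Sp (x + ψ) (b + x) c) := by
  obtain ⟨r, hr⟩ := exists_pow_reduction hm h.rot.deg_pos
  have hr' := smul_pow_mem_adjoin c r m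
  have hr2 := adjoin_singleton_le_right x c hr'
  have hb := deg_add_eq_left (f := b) hxb
  have := hs.path h hμ hφ h1 hR hr2 hr.le (Or.inr hr')
  rw [Sp_swap']
  refine hs.path h.add_mid.rot.swap (by linarith) hr2 ?_ ?_ hψ h2 (Or.inl hr')
  · rw [hb, add_right_comm]
    exact (deg_add_le _ _).trans_lt (max_lt hr hxb)
  · rwa [Sp_swap', add_right_comm, Sp_mid_add_left]

theorem nonadapted_of_mul' (hs : Step k μ) (h : Keller x b c) (hμ : deg x + deg b + deg c ≤ μ)
    (hxb : deg x < deg b) (hφ : φ ∈ Algebra.adjoin k {b, c}) (h1 : deg (x + φ) < deg x)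
    (hR : Red (Sp (x + φ) b c)) (hψ : ψ ∈ Algebra.adjoin k {b + x, c})
    (h2 : deg (x + ψ) ≤ deg x) {m : ℕ} (hm : deg c = m * deg b) :
    Red (Sp (x + ψ) (b + x) c) := by
  have hc := h.rot.rot.deg_pos
  have hb := deg_add_eq_left (f := b) hxb
  obtain ⟨r, hr⟩ := exists_pow_reduction hm hc
  obtain ⟨r', hr'⟩ := exists_pow_reduction (c := b + x) (hb ▸ hm) hc
  have hm1 := smul_pow_mem_adjoin b r m
  have hm2 := adjoin_singleton_le_right x b hm1
  have hm3 := smul_pow_mem_adjoin (b + x) r' m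
  have hm4 := adjoin_singleton_le_right x (b + x) hm3
  have hRs := hs.path h.swap (by linarith) (by rwa [adjoin_pair_comm]) h1 (by rwa [Sp_swap]) hm2
    hr.le (Or.inr hm1)
  have hm5 := mem_adjoin_add_left (Algebra.self_mem_adjoin_singleton k x)
    (by rwa [adjoin_pair_comm] : r • b ^ m ∈ Algebra.adjoin k {b, x})
  rw [adjoin_pair_comm] at hm5
  have hRs' : Red (Sp (c + r' • (b + x) ^ m) x (b + x)) := by
    refine hs.red (h.add_mid.rot.rot.add_left hm5) (sub_mem hm4 hm5) ?_
      (by linarith) (by linarith)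
    rwa [Sp_rot, Sp_mid_add_left, Sp_swap]
  rw [← Sp_rot]
  exact hs.path h.add_mid.rot.rot (by linarith) hm4 hr' hRs' (by rwa [adjoin_pair_comm]) h2
    (Or.inl hm3)

/-- Two reductions along planes with no common adapted basis. -/
theorem nonadapted [CharZero k] (hs : Step k μ) (h : Good x b c) (hμ : deg x + deg b + deg c ≤ μ)
    (hxb : deg x < deg b) (hφ : φ ∈ Algebra.adjoin k {b, c}) (h1 : deg (x + φ) < deg x)
    (hR : Red (Sp (x + φ) b c)) (hψ : ψ ∈ Algebra.adjoin k {b + x, c})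
    (h2 : deg (x + ψ) ≤ deg x) : Red (Sp (x + ψ) (b + x) c) := by
  have hx := h.1.deg_pos
  have hb := h.1.rot.deg_pos
  have hc := h.1.rot.rot.deg_pos
  have hbx := deg_add_eq_left (f := b) hxb
  have hD0 := h.1.D_pos
  have hφd := deg_le_of_add_le h1.le
  have hψd := deg_le_of_add_le h2
  have aux : ∀ {B d : ℝ}, 0 < B → d < B → ∀ i j : ℕ, i * B + j * deg c ≤ d → i = 0 := by
    intro B d hB hd i j hij
    by_contra hi
    have h3 := cast_mul_le (Nat.one_le_iff_ne_zero.2 hi) hB.le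
    have h4 : 0 ≤ (j : ℝ) * deg c := by positivity
    push_cast at h3
    linarith
  by_cases hxm : ∃ m : ℕ, deg x = m * deg c
  · obtain ⟨m, hm⟩ := hxm
    obtain ⟨r, hr⟩ := exists_pow_reduction hm hx
    have hr' := smul_pow_mem_adjoin c r m
    refine hs.nonadapted_of_left h.1 hμ hxb hr' hr ?_ hψ h2
    exact hs.red (h.1.add_left hφ) (sub_mem (adjoin_singleton_le_right b c hr') hφ) hR
      (by linarith) (by linarith)
  push Not at hxm
  rcases h.1.nt_or_ct hφ with hN | ⟨p, q, hp, hq, hpq, he, hD, -⟩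
  · exact hs.nonadapted_of_left h.1 hμ hxb
      (hN.mem_adjoin_right (aux hb (by linarith))) h1 hR hψ h2
  rcases h.1.add_mid.nt_or_ct hψ with hN | ⟨p', q', hp', hq', hpq', he', hD', -⟩
  · exact hs.nonadapted_of_right h.1 hμ hxb hφ h1 hR
      (hN.mem_adjoin_right (aux (hbx ▸ hb) (by linarith))) h2
  by_cases hp1 : p = 1
  · subst hp1
    exact hs.nonadapted_of_mul h.1 hμ hxb hφ h1 hR hψ h2 (m := q) (by rw [← he]; simp)
  by_cases hq1 : q = 1
  · subst hq1
    exact hs.nonadapted_of_mul' h.1 hμ hxb hφ h1 hR hψ h2 (m := p) (by rw [he]; simp)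
  exfalso
  rw [hbx] at he' hD'
  rcases ratio_cases hb hc (by omega) (by omega) hpq he (by linarith) with
    ⟨rfl, ho, h3⟩ | ⟨rfl, rfl⟩
  · push_cast at he hD
    obtain ⟨rfl, rfl⟩ := eq_of_coprime_ratio ho hc hpq' he' he
    have hsc := cast_mul_le h3 hc.le
    push_cast at hsc hD'
    obtain ⟨hU1, -⟩ := hs.D_ge h hμ ho h3 he (fun i j hij => by
      obtain rfl := aux hb hxb i j hij.le
      exact hxm j (by rw [← hij]; simp)) (by linarith) hφ h1 hR
    rw [D_add_left_of_lt (by linarith)] at hD'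
    linarith
  · push_cast at he hD
    obtain ⟨rfl, rfl⟩ := eq_of_coprime_ratio (s := 3) (by decide) hb hpq'.symm he'.symm
      (by push_cast; linarith)
    obtain ⟨hU1, hU2⟩ := hs.D_ge (s := 3) h.swap (by linarith) (by decide) le_rfl
      (by push_cast; linarith) (fun i j hij => by
        rcases i with _ | i
        · rcases j with _ | j
          · simp at hij
            linarith
          · have h3 := cast_mul_le (show 1 ≤ j + 1 by omega) hb.le
            simp only [CharP.cast_eq_zero, zero_mul, zero_add] at hij
            push_cast at h3 hij
            linarith
        · have h3 := cast_mul_le (show 1 ≤ i + 1 by omega) hc.le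
          have h4 : 0 ≤ (j : ℝ) * deg b := by positivity
          push_cast at h3 hij
          linarith) (by linarith) (by rwa [adjoin_pair_comm]) h1 (by rwa [Sp_swap])
    rw [D_comm c b] at hU1
    push_cast at hD'
    rw [D_add_left_of_lt (by linarith)] at hD'
    linarith

end nonadapted
end Step

end

section

variable {k : Type} [Field k]

theorem Nb.exists_wt_eq {V V' : Submodule k (Poly3 k)} (h : Nb V V') :
    ∃ m, (wt m : ℝ) = vdeg V := by
  obtain ⟨x, u, v, ψ, hG, -, -, rfl, -⟩ := h.exists_good
  obtain ⟨m1, h1⟩ := deg_mem_values x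
  obtain ⟨m2, h2⟩ := deg_mem_values u
  obtain ⟨m3, h3⟩ := deg_mem_values v
  refine ⟨m1 + m2 + m3, ?_⟩
  rw [hG.vdeg_eq, wt_add, wt_add, ← h1, ← h2, ← h3]
  push_cast
  rfl

namespace KData

variable [CharZero k] {f1' f1 f2 f3 χ : Poly3 k} {κ : k} {δ : ℝ}

theorem mem_Pl (h : KData f1' f1 f2 f3 χ κ δ) {x u v ψ : Poly3 k} (hG : Good x u v)
    (hS : Sp x u v = Sp f1' f2 f3) (hu : deg u = deg f1')
    (hxv : deg x = deg f2 ∧ deg v = deg f3 ∨ deg x = deg f3 ∧ deg v = deg f2)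
    (hψ : ψ ∈ Algebra.adjoin k {u, v}) (hle : deg ψ ≤ deg x) : ψ ∈ Pl u v := by
  have h1 := h.lt_deg1'
  have h2 := h.deg2
  have h3 := h.deg3
  have h4 := h.lt_t
  have h5 := h.hD
  have h6 := h.D12_pos
  have h7 := h.pos
  have hD : 4 * δ < D u v := by
    rcases (h.plane_cases hG.1 hS).2 with hP | hP
    · exfalso
      rcases hxv with hx | hx
      · exact hG.not_mem_Pl_of_deg hx.1.symm (hP ▸ left_mem_Pl _ _)
      · exact hG.not_mem_Pl_of_deg hx.1.symm (hP ▸ right_mem_Pl _ _)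
    · linarith
  have hv0 := hG.1.rot.rot.deg_pos
  have hu0 := hG.1.rot.deg_pos
  rcases hG.1.nt_or_ct hψ with hN | ⟨p, q, hp, hq, hpq, he, hDp, -⟩
  · refine hN.mem_Pl fun i j hij => ?_
    have hi : i = 0 := by
      by_contra hi
      have h3 := cast_mul_le (Nat.one_le_iff_ne_zero.2 hi) hu0.le
      have h4 : 0 ≤ (j : ℝ) * deg v := by positivity
      push_cast at h3
      rcases hxv with hx | hx <;> linarith
    subst hi
    by_contra hj
    have h3 := cast_mul_le (show 2 ≤ j by omega) hv0.le
    push_cast at h3 hij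
    rcases hxv with hx | hx <;> linarith
  · exfalso
    have h3 := cast_mul_le hp hu0.le
    push_cast at h3
    rcases hxv with hx | hx <;> linarith

theorem red_add (h : KData f1' f1 f2 f3 χ κ δ) (hR : Red (Sp f1 f2 (f3 + χ))) {ψ : Poly3 k}
    (hψ : ψ ∈ Algebra.adjoin k {f2, f3}) (hle : deg ψ ≤ deg f1') : Red (Sp (f1' + ψ) f2 f3) := by
  have h1 := h.deg1'
  have h2 := h.deg2
  have h3 := h.deg3
  have h4 := h.lt_t
  have h5 := h.hD
  have h6 := h.D12_pos
  have h7 := h.pos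
  have h8 := h.two_t_le
  rcases h.keller.nt_or_ct hψ with hN | ⟨p, q, hp, hq, hpq, he, hD, -⟩
  · have hmem : ψ ∈ Pl f2 f3 ⊔ Submodule.span k {f3 ^ 2, f3 ^ 2} := by
      refine hN.mem fun i j hij => ?_
      have hj : j < 3 := by
        by_contra! hj
        have h9 := cast_mul_le hj (by linarith : 0 ≤ deg f3)
        have h10 := cast_mul_le (Nat.zero_le i) (by linarith : 0 ≤ deg f2)
        push_cast at h9 h10
        linarith
      have hi : i < 2 := by
        by_contra! hi
        have h9 := cast_mul_le hi (by linarith : 0 ≤ deg f2)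
        have h10 := cast_mul_le (Nat.zero_le j) (by linarith : 0 ≤ deg f3)
        push_cast at h9 h10
        linarith
      by_cases hs : i + j ≤ 1
      · exact Submodule.mem_sup_left (pow_mul_pow_mem_Pl _ _ hs)
      · have hi0 : i = 0 := by
          by_contra hi0
          have h9 := cast_mul_le (show 1 ≤ i by omega) (by linarith : 0 ≤ deg f2)
          have h10 := cast_mul_le (show 1 ≤ j by omega) (by linarith : 0 ≤ deg f3)
          push_cast at h9 h10
          linarith
        obtain rfl : j = 2 := by omega
        subst hi0
        refine Submodule.mem_sup_right (Submodule.subset_span ?_)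
        simp
    obtain ⟨l, hl, r, r', rfl⟩ := mem_sup_span_pair hmem
    rw [← add_smul, add_comm l, ← add_assoc, Sp_add hl]
    by_cases hr : r + r' = κ
    · rw [hr, ← h.eq, ← Sp_rot]
      refine Good.red_of_lt ⟨h.keller1.rot.rot, ?_, ?_, ?_⟩ h.mem h.lt (by rwa [Sp_rot])
      · have := h.deg1
        linarith
      · linarith
      · have := h.deg1
        linarith
    · refine Red.kur (χ := χ) (κ := κ - (r + r')) (δ := δ) ⟨h.keller.add_left (sq_mem _ _ _),
        sub_ne_zero.2 (Ne.symm hr), ?_, h.deg1, h2, ?_, h.mem, h.lt, h3, h5⟩ hR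
      · rw [h.eq, sub_smul]
        abel
      · refine (deg_add_le _ _).trans (max_le h1 ((deg_smul_le _ _).trans ?_))
        refine (deg_pow_le _ _).trans ?_
        push_cast
        linarith
  · exfalso
    have hp1 : p = 1 := eq_one_of_mul_lt hp (Y := deg f2) (by linarith) (by linarith)
    subst hp1
    have hq1 : q = 1 := eq_one_of_mul_lt hq (Y := deg f3) (by linarith)
      (by push_cast at he; linarith)
    subst hq1
    push_cast at he
    linarith

theorem red_of_nb (h : KData f1' f1 f2 f3 χ κ δ) (hR : Red (Sp f1 f2 (f3 + χ)))
    {V : Submodule k (Poly3 k)} (hV : Nb (Sp f1' f2 f3) V) (hle : vdeg V ≤ vdeg (Sp f1' f2 f3)) :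
    Red V := by
  have hRV := Red.kur h hR
  obtain ⟨x, u, v, ψ, hG, hψ, hG', hS, rfl⟩ := hV.exists_good
  have hlex : deg (x + ψ) ≤ deg x := by
    rw [hS, hG.vdeg_eq, hG'.vdeg_eq] at hle
    linarith
  have hψd := deg_le_of_add_le hlex
  have stay : ∀ {u v : Poly3 k}, ψ ∈ Pl u v → Sp x u v = Sp f1' f2 f3 → Red (Sp (x + ψ) u v) := by
    intro u v h1 h2
    rwa [Sp_add h1, h2]
  rcases h.good.perm hG hS.symm with ⟨hx, huv⟩ | ⟨hx, ⟨hu, hv⟩ | ⟨hu, hv⟩⟩ |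
    ⟨hx, ⟨hu, hv⟩ | ⟨hu, hv⟩⟩
  · have h1 := h.lt_deg1'
    have h2 := h.deg2
    have h3 := h.deg3
    have hP := h.good.Pl_eq_of_deg hG hS.symm (by linarith) (by linarith) hx
    obtain ⟨ψ', hψ', e, hG2⟩ := exists_good_adapted hψ h.keller h.good.2.2.2 hS.symm hP
    rw [e] at hle ⊢
    refine h.red_add hR hψ' (deg_le_of_add_le ?_)
    rw [hG2.vdeg_eq, h.good.vdeg_eq] at hle
    linarith
  · exact stay (h.mem_Pl hG hS.symm hu (Or.inl ⟨hx, hv⟩) hψ hψd) hS.symm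
  · rw [Sp_swap]
    rw [Sp_swap x] at hS
    rw [adjoin_pair_comm] at hψ
    exact stay (h.mem_Pl hG.swap hS.symm hv (Or.inl ⟨hx, hu⟩) hψ hψd) hS.symm
  · exact stay (h.mem_Pl hG hS.symm hu (Or.inr ⟨hx, hv⟩) hψ hψd) hS.symm
  · rw [Sp_swap]
    rw [Sp_swap x] at hS
    rw [adjoin_pair_comm] at hψ
    exact stay (h.mem_Pl hG.swap hS.symm hv (Or.inr ⟨hx, hu⟩) hψ hψd) hS.symm

end KData

theorem red_of_nb_base [CharZero k] {V : Submodule k (Poly3 k)} (hV : Nb (Sp (X 0) (X 1) (X 2)) V)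
    (hle : vdeg V ≤ vdeg (Sp (X 0) (X 1) (X 2) : Submodule k (Poly3 k))) : Red V := by
  obtain ⟨x, u, v, ψ, hG, hψ, hG', hS, rfl⟩ := hV.exists_good
  have hlex : deg (x + ψ) ≤ deg x := by
    rw [hS, hG.vdeg_eq, hG'.vdeg_eq] at hle
    linarith
  have hψd := deg_le_of_add_le hlex
  rcases hG.1.nt_or_ct hψ with hN | ⟨p, q, hp, hq, hpq, he, hD, -⟩
  · have key : ∀ w ∈ Sp x u v, 0 < deg w → 1 ≤ deg w ∧ deg w < 2 := by
      intro w hw h0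
      rw [← hS] at hw
      obtain ⟨i, hi⟩ := exists_deg_eq_W rfl hw h0
      rw [hi]
      exact ⟨by exact_mod_cast one_le_W i, by exact_mod_cast W_lt_two i⟩
    rw [Sp_add, ← hS]
    · exact Red.base
    refine hN.mem_Pl fun i j hij => ?_
    have h1 := (key x (left_mem_Sp _ _ _) hG.1.deg_pos).2
    have h2 := (key u (mid_mem_Sp _ _ _) hG.1.rot.deg_pos).1
    have h3 := (key v (right_mem_Sp _ _ _) hG.1.rot.rot.deg_pos).1
    have h4 := mul_le_mul_of_nonneg_left h2 (Nat.cast_nonneg (α := ℝ) i)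
    have h5 := mul_le_mul_of_nonneg_left h3 (Nat.cast_nonneg (α := ℝ) j)
    have h6 : ((i + j : ℕ) : ℝ) < (2 : ℕ) := by
      push_cast
      linarith
    have := Nat.cast_lt.1 h6
    omega
  · exact absurd he (hG.rot.base_ratio (by rw [← Sp_rot, hS]) hp)

theorem Step.red_of_nb_elem [CharZero k] {μ : ℝ} (hs : Step k μ) {V V1 V' : Submodule k (Poly3 k)}
    (hμ : vdeg V ≤ μ) (h1 : Nb V V1) (hlt : vdeg V1 < vdeg V) (hR : Red V1) (h2 : Nb V V')
    (hle : vdeg V' ≤ vdeg V) : Red V' := by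
  obtain ⟨a, b, c, φ, hG, hφ, hG', rfl, rfl⟩ := h1.exists_good
  obtain ⟨x, u, v, ψ, hX, hψ, hX', hS, rfl⟩ := h2.exists_good
  rcases two_planes hG.1 hX.1 hS with hP | ⟨a', b', c', hA, hSA, hP1, hP2⟩ |
    ⟨a', b', c', hA, hlt', hSA, hP1, hP2⟩
  · obtain ⟨ψ', hψ', e, hX2⟩ := exists_good_adapted hψ hG.1 hG.2.2.2 hS.symm hP.symm
    rw [e, hX2.vdeg_eq, hG.vdeg_eq] at hle
    rw [hG'.vdeg_eq, hG.vdeg_eq] at hlt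
    rw [hG.vdeg_eq] at hμ
    rw [e]
    exact hs.red hG'.1 (sub_mem hψ' hφ) hR (by linarith) (by linarith)
  · obtain ⟨φ', hφ', e1, hG2⟩ := exists_good_adapted hφ hA.1 hA.2.2.2 hSA.symm hP1.symm
    obtain ⟨ψ', hψ', e2, hX2⟩ := exists_good_adapted hψ hA.1.rot.swap hA.2.2.1
      (by rw [← hS, ← hSA, Sp_swap']) hP2.symm
    rw [e1, ← hSA, hG2.vdeg_eq, hA.vdeg_eq] at hlt
    rw [e2, ← hSA, hX2.vdeg_eq, hA.vdeg_eq] at hle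
    rw [← hSA, hA.vdeg_eq] at hμ
    rw [e2, Sp_swap']
    exact hs.adapted hA hμ hφ' (by linarith) (e1 ▸ hR) hψ' (by linarith)
  · obtain ⟨φ', hφ', e1, hG2⟩ := exists_good_adapted hφ hA.1 hA.2.2.2 hSA.symm hP1.symm
    have hba := deg_add_eq_left hlt'
    obtain ⟨ψ', hψ', e2, hX2⟩ := exists_good_adapted hψ hA.1.add_mid (by rw [hba]; exact hA.2.2.2)
      (by rw [← hS, ← hSA, Sp_mid_add_left]) hP2.symm
    rw [e1, ← hSA, hG2.vdeg_eq, hA.vdeg_eq] at hlt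
    rw [e2, ← hSA, hX2.vdeg_eq, hA.vdeg_eq, hba] at hle
    rw [← hSA, hA.vdeg_eq] at hμ
    rw [e2]
    exact hs.nonadapted hA hμ hlt' hφ' (by linarith) (e1 ▸ hR) hψ' (by linarith)

/-- Reducibility is preserved by elementary transformations. -/
theorem Red.nb [CharZero k] {V V' : Submodule k (Poly3 k)} (hR : Red V) (h : Nb V V') : Red V' := by
  by_contra hV'
  set T : Set ℝ := {s | ∃ V V' : Submodule k (Poly3 k), Red V ∧ Nb V V' ∧ ¬ Red V' ∧
    max (vdeg V) (vdeg V') = s} with hT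
  have hmem : max (vdeg V) (vdeg V') ∈ T := ⟨V, V', hR, h, hV', rfl⟩
  have hfin : (T ∩ Set.Iic (max (vdeg V) (vdeg V'))).Finite := by
    refine (finite_wt_le (max (vdeg V) (vdeg V'))).subset ?_
    rintro s ⟨⟨U, U', -, hU, -, rfl⟩, hs⟩
    refine ⟨hs, ?_⟩
    rcases max_choice (vdeg U) (vdeg U') with e | e
    · rw [e]
      exact hU.exists_wt_eq
    · rw [e]
      exact hU.symm.exists_wt_eq
  obtain ⟨μ, ⟨⟨U, U', hU, hUU, hU', rfl⟩, hle⟩, hmin⟩ :=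
    Set.exists_min_image _ id hfin ⟨_, hmem, Set.mem_Iic.2 le_rfl⟩
  have hlt : ∀ W W' : Submodule k (Poly3 k), Red W → Nb W W' →
      max (vdeg W) (vdeg W') < max (vdeg U) (vdeg U') → Red W' := by
    intro W W' hW hWW hlt
    by_contra hW'
    exact (hmin _ ⟨⟨W, W', hW, hWW, hW', rfl⟩, hlt.le.trans hle⟩).not_gt hlt
  have hs : Step k (max (vdeg U) (vdeg U')) := by
    intro W W' hW hlt1 hWW hle1
    rcases hle1.lt_or_eq with h1 | h1
    · exact hlt W W' hW hWW (max_lt hlt1 h1)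
    · exact Red.elem hWW.symm (h1 ▸ hlt1) hW
  apply hU'
  rcases lt_or_ge (vdeg U) (vdeg U') with h1 | h1
  · exact hs U U' hU (lt_max_of_lt_right h1) hUU (le_max_right _ _)
  · rw [max_eq_left h1] at hs
    cases hU with
    | base => exact red_of_nb_base hUU h1
    | elem hV hlt hR1 => exact hs.red_of_nb_elem le_rfl hV hlt hR1 hUU h1
    | kur hK hR1 => exact hK.red_of_nb hR1 hUU h1

end

section

open Matrix
variable {k : Type} [Field k]

theorem affine_inv {σ : Aut3 k} (h : IsAffine k σ) : IsAffine k σ⁻¹ := by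
  obtain ⟨A, b, hA, h⟩ := h
  refine ⟨A⁻¹, fun i => -∑ j, A⁻¹ i j * b j, (Matrix.isUnit_nonsing_inv_iff).2 hA, fun i => ?_⟩
  have h1 : ∀ j, (X j : Poly3 k) = (∑ l, C (A j l) * σ⁻¹ (X l)) + C (b j) := by
    intro j
    have := congrArg (σ⁻¹ : Aut3 k) (h j)
    rw [map_add, map_sum] at this
    simp only [map_mul] at this
    have hC : ∀ r : k, (σ⁻¹ : Aut3 k) (C r) = C r := fun r => (σ⁻¹ : Aut3 k).commutes r
    simp only [hC] at this
    rw [← this]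
    exact (AlgEquiv.symm_apply_apply σ (X j)).symm
  have h2 : ∑ j, C (A⁻¹ i j) * ((X j : Poly3 k) - C (b j)) = σ⁻¹ (X i) := by
    calc ∑ j, C (A⁻¹ i j) * ((X j : Poly3 k) - C (b j))
        = ∑ j, ∑ l, C (A⁻¹ i j * A j l) * σ⁻¹ (X l) := by
          refine Finset.sum_congr rfl fun j _ => ?_
          rw [sub_eq_of_eq_add (h1 j), Finset.mul_sum]
          exact Finset.sum_congr rfl fun l _ => by rw [C_mul, mul_assoc]
      _ = ∑ l, C ((A⁻¹ * A) i l) * σ⁻¹ (X l) := by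
          rw [Finset.sum_comm]
          refine Finset.sum_congr rfl fun l _ => ?_
          rw [← Finset.sum_mul, Matrix.mul_apply, map_sum]
      _ = σ⁻¹ (X i) := by
          rw [Matrix.nonsing_inv_mul _ ((Matrix.isUnit_iff_isUnit_det _).1 hA)]
          simp [Matrix.one_apply]
  rw [← h2]
  simp only [mul_sub, Finset.sum_sub_distrib, map_neg, map_sum, map_mul]
  rw [sub_eq_add_neg]

theorem apply_mem_adjoin_of_mem_supported (F : Aut3 k) {i j : Fin 3} {P : Poly3 k}
    (hP : P ∈ supported k ({i, j} : Set (Fin 3))) :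
    F P ∈ Algebra.adjoin k {F (X i), F (X j)} := by
  have : F P ∈ (supported k ({i, j} : Set (Fin 3))).map (F : Poly3 k →ₐ[k] Poly3 k) :=
    ⟨P, hP, rfl⟩
  rw [supported_eq_adjoin_X, AlgHom.map_adjoin, Set.image_image, Set.image_pair] at this
  exact this

theorem apply_eq_self_of_mem_supported (F : Aut3 k) {s : Set (Fin 3)} {P : Poly3 k}
    (hP : P ∈ supported k s) (h : ∀ i ∈ s, F (X i) = X i) : F P = P := by
  rw [supported_eq_adjoin_X] at hP
  refine AlgHom.adjoin_le_equalizer (F : Poly3 k →ₐ[k] Poly3 k) (AlgHom.id k _) ?_ hP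
  rintro _ ⟨i, hi, rfl⟩
  exact h i hi

theorem elementary_inv {σ : Aut3 k} (h : IsElementary k σ) : IsElementary k σ⁻¹ := by
  obtain ⟨P, hP, h0, h1, h2⟩ := h
  have hi : ∀ f g : Poly3 k, σ f = g → σ⁻¹ g = f := by
    rintro f g rfl
    exact AlgEquiv.symm_apply_apply σ f
  refine ⟨-P, neg_mem hP, hi _ _ ?_, hi _ _ h1, hi _ _ h2⟩
  rw [map_add, map_neg, h0, apply_eq_self_of_mem_supported σ hP
    (by rintro i (rfl | rfl) <;> assumption)]
  ring

/-- The images of the variables under `F`. -/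
noncomputable abbrev AutSp (F : Aut3 k) : Submodule k (Poly3 k) := Sp (F (X 0)) (F (X 1)) (F (X 2))

theorem apply_affine (F : Aut3 k) {σ : Aut3 k} {A : Matrix (Fin 3) (Fin 3) k} {b : Fin 3 → k}
    (h : ∀ i, σ (X i) = (∑ j, C (A i j) * X j) + C (b i)) (i : Fin 3) :
    (F * σ) (X i) = C (b i) + A i 0 • F (X 0) + A i 1 • F (X 1) + A i 2 • F (X 2) := by
  have hC : ∀ r : k, F (C r) = C r := fun r => F.commutes r
  rw [AlgEquiv.mul_apply, h, map_add, hC, Fin.sum_univ_three]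
  simp only [map_add, map_mul, hC, smul_eq_C_mul]
  ring

theorem autSp_mul_affine_le (F : Aut3 k) {σ : Aut3 k} (h : IsAffine k σ) :
    AutSp (F * σ) ≤ AutSp F := by
  obtain ⟨A, b, -, h⟩ := h
  have key := fun i => mem_Sp.2 ⟨_, _, _, _, apply_affine F h i⟩
  refine Submodule.span_le.2 ?_
  rintro _ (rfl | rfl | rfl | rfl)
  · exact Pl_le_Sp _ _ _ (one_mem_Pl _ _)
  all_goals exact key _

theorem autSp_mul_affine (F : Aut3 k) {σ : Aut3 k} (h : IsAffine k σ) :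
    AutSp (F * σ) = AutSp F := by
  refine le_antisymm (autSp_mul_affine_le F h) ?_
  have := autSp_mul_affine_le (F * σ) (affine_inv h)
  rwa [mul_inv_cancel_right] at this

theorem keller_mul_affine {F σ : Aut3 k} (h : IsAffine k σ)
    (hF : Keller (F (X 0)) (F (X 1)) (F (X 2))) :
    Keller ((F * σ) (X 0)) ((F * σ) (X 1)) ((F * σ) (X 2)) := by
  obtain ⟨A, b, hA, h⟩ := h
  obtain ⟨u, hu, e⟩ := hF
  refine ⟨A.det * u, mul_ne_zero ((Matrix.isUnit_iff_isUnit_det _).1 hA).ne_zero hu, ?_⟩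
  rw [C_mul, mul_assoc, ← e]
  simp only [apply_affine F h, cr, grad_add, grad_smul, grad_C, zero_add]
  generalize grad (F (X 0)) = u, grad (F (X 1)) = v, grad (F (X 2)) = w
  simp only [cross_apply, vec3_dotProduct, Matrix.det_fin_three, Pi.add_apply, Pi.smul_apply,
    smul_eq_mul, Matrix.cons_val]
  simp only [map_add, map_sub, map_mul]
  ring

theorem Red.of_mem_tame [CharZero k] {F : Aut3 k} (hF : F ∈ Tame k) :
    Keller (F (X 0)) (F (X 1)) (F (X 2)) ∧ Red (AutSp F) := by
  have haff : ∀ F σ : Aut3 k, IsAffine k σ → Keller (F (X 0)) (F (X 1)) (F (X 2)) ∧ Red (AutSp F) →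
      Keller ((F * σ) (X 0)) ((F * σ) (X 1)) ((F * σ) (X 2)) ∧ Red (AutSp (F * σ)) := by
    intro F σ h ⟨h1, h2⟩
    exact ⟨keller_mul_affine h h1, (autSp_mul_affine F h).symm ▸ h2⟩
  have helem : ∀ F σ : Aut3 k, IsElementary k σ →
      Keller (F (X 0)) (F (X 1)) (F (X 2)) ∧ Red (AutSp F) →
      Keller ((F * σ) (X 0)) ((F * σ) (X 1)) ((F * σ) (X 2)) ∧ Red (AutSp (F * σ)) := by
    intro F σ ⟨P, hP, e0, e1, e2⟩ ⟨h1, h2⟩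
    have hm := apply_mem_adjoin_of_mem_supported F hP
    rw [AutSp, AlgEquiv.mul_apply, AlgEquiv.mul_apply, AlgEquiv.mul_apply, e0, e1, e2, map_add]
    exact ⟨h1.add_left hm, h2.nb ⟨_, _, _, _, h1, hm, rfl, rfl⟩⟩
  have hone : Keller ((1 : Aut3 k) (X 0)) ((1 : Aut3 k) (X 1)) ((1 : Aut3 k) (X 2)) ∧
      Red (AutSp (1 : Aut3 k)) := by
    simp only [AutSp, AlgEquiv.one_apply]
    exact ⟨keller_X, Red.base⟩
  unfold Tame at hF
  induction hF using Subgroup.closure_induction_right with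
  | one => exact hone
  | mul_right F hF σ hσ ih =>
    rcases hσ with h | h
    · exact haff F σ h ih
    · exact helem F σ h ih
  | mul_inv_cancel F hF σ hσ ih =>
    rcases hσ with h | h
    · exact haff F _ (affine_inv h) ih
    · exact helem F _ (elementary_inv h) ih

theorem exists_affine (A : Matrix (Fin 3) (Fin 3) k) (hA : IsUnit A) (b : Fin 3 → k) :
    ∃ σ : Aut3 k, ∀ i, σ (X i) = (∑ j, C (A i j) * X j) + C (b i) := by
  have hd := (Matrix.isUnit_iff_isUnit_det _).1 hA
  have key : ∀ (B B' : Matrix (Fin 3) (Fin 3) k) (u v : Fin 3 → k), B * B' = 1 →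
      (∀ i, ∑ j, B i j * v j = - u i) →
      ((aeval fun i => (∑ j, C (B' i j) * X j : Poly3 k) + C (v i)).comp
        (aeval fun i => (∑ j, C (B i j) * X j : Poly3 k) + C (u i)) : Poly3 k →ₐ[k] Poly3 k)
        = AlgHom.id k _ := by
    intro B B' u v hB hv
    refine MvPolynomial.algHom_ext fun i => ?_
    rw [AlgHom.comp_apply, aeval_X, map_add, map_sum]
    simp only [map_mul, aeval_C, aeval_X, algebraMap_eq, mul_add, Finset.sum_add_distrib,
      Finset.mul_sum, AlgHom.id_apply]
    rw [Finset.sum_comm]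
    have h1 : ∀ l, ∑ j, C (B i j) * (C (B' j l) * X l : Poly3 k) = C ((B * B') i l) * X l := by
      intro l
      rw [Matrix.mul_apply, map_sum, Finset.sum_mul]
      exact Finset.sum_congr rfl fun j _ => by rw [C_mul, mul_assoc]
    have h2 : ∑ j, C (B i j) * (C (v j) : Poly3 k) = C (- u i) := by
      rw [← hv i, map_sum]
      exact Finset.sum_congr rfl fun j _ => by rw [C_mul]
    simp only [h1, h2, hB]
    simp [Matrix.one_apply]
  have hm : ∀ i, ∑ j, A i j * (-∑ l, A⁻¹ j l * b l) = - b i := by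
    intro i
    have := congrFun (Matrix.mulVec_mulVec b A A⁻¹) i
    rw [Matrix.mul_nonsing_inv _ hd, Matrix.one_mulVec] at this
    rw [← this]
    simp [Matrix.mulVec, dotProduct]
  refine ⟨AlgEquiv.ofAlgHom (aeval fun i => (∑ j, C (A i j) * X j) + C (b i))
    (aeval fun i => (∑ j, C (A⁻¹ i j) * X j) + C (-∑ l, A⁻¹ i l * b l)) ?_ ?_, fun i => ?_⟩
  · exact key _ _ _ _ (Matrix.nonsing_inv_mul _ hd) fun i => by rw [neg_neg]
  · exact key _ _ _ _ (Matrix.mul_nonsing_inv _ hd) hm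
  · simp

theorem exists_shear (i : Fin 3) {P : Poly3 k} (hP : P ∈ supported k ({i}ᶜ : Set (Fin 3))) :
    ∃ σ : Aut3 k, σ (X i) = X i + P ∧ ∀ j ≠ i, σ (X j) = X j := by
  set f : Poly3 k → Poly3 k →ₐ[k] Poly3 k := fun Q => aeval (Function.update X i (X i + Q)) with hf
  have hX : ∀ Q, f Q (X i) = X i + Q := fun Q => by simp [hf]
  have hXj : ∀ Q, ∀ j ≠ i, f Q (X j) = X j := fun Q j hj => by simp [hf, hj]
  have hfix : ∀ Q, f Q P = P := by
    intro Q
    rw [supported_eq_adjoin_X] at hP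
    refine AlgHom.adjoin_le_equalizer (f Q) (AlgHom.id k _) ?_ hP
    rintro _ ⟨j, hj, rfl⟩
    exact hXj Q j hj
  refine ⟨AlgEquiv.ofAlgHom (f P) (f (-P)) ?_ ?_, hX P, hXj P⟩ <;>
  · refine MvPolynomial.algHom_ext fun j => ?_
    rcases eq_or_ne j i with rfl | hj
    · simp only [AlgHom.comp_apply, hX, map_add, map_neg, hfix, AlgHom.id_apply]
      ring
    · simp only [AlgHom.comp_apply, hXj _ j hj, AlgHom.id_apply]

end

section

open Matrix
variable {k : Type} [Field k]

theorem C_mem_supported (s : Set (Fin 3)) (r : k) : (C r : Poly3 k) ∈ supported k s :=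
  (supported k s).algebraMap_mem r

theorem X_mem_supported_of {s : Set (Fin 3)} {i : Fin 3} (h : i ∈ s) :
    (X i : Poly3 k) ∈ supported k s := by
  rw [supported_eq_adjoin_X]
  exact Algebra.subset_adjoin ⟨i, h, rfl⟩

theorem exists_memH2_adapt {F : Aut3 k} {p a : Poly3 k} (hS : AutSp F = Sp p a (F (X 2)))
    (hK : Keller p a (F (X 2))) :
    ∃ A : Aut3 k, MemH2 k A ∧ (F * A) (X 0) = p ∧ (F * A) (X 1) = a ∧ (F * A) (X 2) = F (X 2) := by
  obtain ⟨r, x, y, z, ep⟩ := mem_Sp.1 (hS ▸ left_mem_Sp p a (F (X 2)))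
  obtain ⟨r', x', y', z', ea⟩ := mem_Sp.1 (hS ▸ mid_mem_Sp p a (F (X 2)))
  have hdet : x * y' - y * x' ≠ 0 := by
    intro h0
    have h1 : y' • p - y • a ∈ Pl (0 : Poly3 k) (F (X 2)) := by
      refine mem_Pl.2 ⟨y' * r - y * r', 0, y' * z - y * z', ?_⟩
      rw [ep, ea]
      have : C (x * y' - y * x') * F (X 0) = 0 := by rw [h0]; simp
      simp only [smul_eq_C_mul, C_mul, C_sub] at this ⊢
      linear_combination this
    have h2 : x' • p - x • a ∈ Pl (0 : Poly3 k) (F (X 2)) := by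
      refine mem_Pl.2 ⟨x' * r - x * r', 0, x' * z - x * z', ?_⟩
      rw [ep, ea]
      have : C (x * y' - y * x') * F (X 1) = 0 := by rw [h0]; simp
      simp only [smul_eq_C_mul, C_mul, C_sub] at this ⊢
      linear_combination -this
    have hz : ∀ s t : k, s • p - t • a ∈ Pl (0 : Poly3 k) (F (X 2)) → t = 0 := by
      intro s t h
      by_contra ht
      refine hK.rot.swap.not_mem_Pl ?_
      have h3 : Pl (0 : Poly3 k) (F (X 2)) ≤ Pl p (F (X 2)) :=
        Pl_le (one_mem_Pl _ _) (zero_mem _) (right_mem_Pl _ _)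
      have h4 := Submodule.smul_mem _ (t⁻¹) (sub_mem
        (Submodule.smul_mem _ s (left_mem_Pl p (F (X 2)))) (h3 h))
      rw [sub_sub_cancel, smul_smul, inv_mul_cancel₀ ht, one_smul] at h4
      exact h4
    have hy := hz _ _ h1
    have hx := hz _ _ h2
    refine hK.not_mem_Pl ?_
    rw [ep, hx, hy, zero_smul, zero_smul, add_zero, add_zero]
    exact add_mem (C_mem_Pl _ _ _) (Submodule.smul_mem _ _ (right_mem_Pl _ _))
  obtain ⟨A, hA⟩ := exists_affine (k := k) !![x, y, z; x', y', z'; 0, 0, 1]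
    (by
      rw [Matrix.isUnit_iff_isUnit_det, isUnit_iff_ne_zero, Matrix.det_fin_three]
      simpa using hdet) ![r, r', 0]
  have e := apply_affine F hA
  refine ⟨A, ⟨C x, C y, C x', C y', C z * X 2 + C r, C z' * X 2 + C r', 1, 0,
    C_mem_supported _ _, C_mem_supported _ _, C_mem_supported _ _, C_mem_supported _ _, ?_, ?_,
    ⟨_, hdet, by simp⟩, one_ne_zero, ?_, ?_, ?_⟩, ?_, ?_, ?_⟩
  · exact add_mem (mul_mem (C_mem_supported _ _) (X_mem_supported_of rfl)) (C_mem_supported _ _)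
  · exact add_mem (mul_mem (C_mem_supported _ _) (X_mem_supported_of rfl)) (C_mem_supported _ _)
  · rw [hA, Fin.sum_univ_three]
    simp [add_assoc]
  · rw [hA, Fin.sum_univ_three]
    simp [add_assoc]
  · rw [hA, Fin.sum_univ_three]
    simp
  · rw [e, ep]
    simp
  · rw [e, ea]
    simp
  · rw [e]
    simp

theorem exists_shear_memH1 {F : Aut3 k} {φ : Poly3 k}
    (hφ : φ ∈ Algebra.adjoin k {F (X 0), F (X 2)}) :
    ∃ E : Aut3 k, MemH1 k E ∧ (F * E) (X 0) = F (X 0) ∧ (F * E) (X 1) = F (X 1) + φ ∧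
      (F * E) (X 2) = F (X 2) := by
  have : φ ∈ (supported k ({0, 2} : Set (Fin 3))).map (F : Poly3 k →ₐ[k] Poly3 k) := by
    rw [supported_eq_adjoin_X, AlgHom.map_adjoin, Set.image_image, Set.image_pair]
    exact hφ
  obtain ⟨P, hP, e⟩ := this
  have hP : P ∈ supported k ({0, 2} : Set (Fin 3)) := hP
  obtain ⟨E, hE, hE'⟩ := exists_shear (k := k) 1 (supported_mono (by
    rintro i (rfl | rfl) <;> simp) hP)
  have h0 := hE' 0 (by simp)
  have h2 := hE' 2 (by simp)
  refine ⟨E, ⟨1, 1, 1, 0, 0, P, one_ne_zero, one_ne_zero, one_ne_zero, zero_mem _, hP, ?_, ?_, ?_⟩,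
    ?_, ?_, ?_⟩
  · simp [h0]
  · simp [hE]
  · simp [h2]
  · rw [AlgEquiv.mul_apply, h0]
  · rw [AlgEquiv.mul_apply, hE, map_add]
    exact congrArg _ e
  · rw [AlgEquiv.mul_apply, h2]

theorem Pl_le_of_combo {b c v : Poly3 k} {r y z : k} (hz : z ≠ 0)
    (h : v = C r + y • b + z • c) : Pl b c = Pl b v := by
  rw [Pl_comm b c, Pl_comm b v]
  exact (Pl_eq_Pl hz y r (by rw [h]; abel)).symm

theorem Good.eq_combo_of_deg_eq_W {a b c φ v : Poly3 k} (h : Good a b c) (hv : v ∈ Sp a b c)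
    (hd : deg v = W 2) (hK : Keller (a + φ) b c) (hlt : deg (a + φ) < deg a) :
    ∃ r y z : k, v = C r + y • b + z • c := by
  obtain ⟨r, x, y, z, e⟩ := mem_Sp.1 hv
  have hx : x = 0 := by
    by_contra hx
    have h1 := h.deg_combo r x y z
    rw [← e, hd, deg_smul hx] at h1
    have h2 := W_two_le_deg hK.deg_pos
    have h3 := le_max_left (deg a) (max (deg (y • b)) (deg (z • c)))
    rw [← h1] at h3
    linarith
  exact ⟨r, y, z, by rw [e, hx, zero_smul, add_zero]⟩

theorem Red.mem_sup [CharZero k] {H1 H2 : Subgroup (Aut3 k)} (hH1 : ∀ σ, σ ∈ H1 ↔ MemH1 k σ)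
    (hH2 : ∀ σ, σ ∈ H2 ↔ MemH2 k σ) {V : Submodule k (Poly3 k)} (hV : Red V) :
    ∀ F : Aut3 k, AutSp F = V → (∃ α β : k, α ≠ 0 ∧ F (X 2) = C α * X 2 + C β) →
      F ∈ H1 ⊔ H2 := by
  have hdeg : ∀ {F : Aut3 k}, (∃ α β : k, α ≠ 0 ∧ F (X 2) = C α * X 2 + C β) →
      deg (F (X 2)) = W 2 := by
    rintro F ⟨α, β, hα, e⟩
    rw [e, deg_add_C, ← smul_eq_C_mul, deg_smul hα, deg_X]
  have h1 : H1 ≤ H1 ⊔ H2 := le_sup_left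
  have h2 : H2 ≤ H1 ⊔ H2 := le_sup_right
  induction hV with
  | base =>
    intro F hS hF
    obtain ⟨α, β, hα, e⟩ := hF
    have hK : Keller (X 0) (X 1) (F (X 2)) := by
      have := (keller_X (k := k)).rot.rot.smul_left hα
      have := this.add_left (Pl_le_adjoin _ _ (C_mem_Pl β (X 0) (X 1)))
      rw [smul_eq_C_mul, ← e] at this
      exact this.rot
    have hS' : AutSp F = Sp (X 0) (X 1) (F (X 2)) := by
      rw [hS, Sp_rot, Sp_rot, Sp_rot (X 0) (X 1) (F (X 2)), Sp_rot (X 1) (F (X 2))]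
      refine Sp_eq_Sp rfl (inv_ne_zero hα) (mem_Pl.2 ⟨-(α⁻¹ * β), 0, 0, ?_⟩)
      rw [e, smul_eq_C_mul, mul_add, ← mul_assoc, ← C_mul, ← C_mul, inv_mul_cancel₀ hα]
      simp
    obtain ⟨A, hA, e0, e1, e2⟩ := exists_memH2_adapt hS' hK
    have hFA : F * A ∈ H2 := (hH2 _).2 ⟨1, 0, 0, 1, 0, 0, α, β, one_mem _, zero_mem _, zero_mem _,
      one_mem _, zero_mem _, zero_mem _, ⟨1, one_ne_zero, by simp⟩, hα, by simp [e0],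
      by simp [e1], by rw [e2, e]⟩
    exact h2 ((Subgroup.mul_mem_cancel_right _ ((hH2 _).2 hA)).1 hFA)
  | @elem V V1 hN hlt hR ih =>
    intro F hS hF
    obtain ⟨a, b, c, φ, hG, hφ, hG', rfl, rfl⟩ := hN.exists_good
    rw [hG.vdeg_eq, hG'.vdeg_eq] at hlt
    obtain ⟨r, y, z, ev⟩ := hG.eq_combo_of_deg_eq_W (hS ▸ right_mem_Sp _ _ _) (hdeg hF) hG'.1
      (by linarith)
    have key : ∃ p, Pl b c = Pl p (F (X 2)) ∧ Keller a p (F (X 2)) := by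
      rcases eq_or_ne z 0 with rfl | hz
      · rcases eq_or_ne y 0 with rfl | hy
        · exfalso
          have h0 := hdeg hF
          rw [ev, zero_smul, zero_smul, add_zero, add_zero, ← zero_add (C r), deg_add_C,
            ← deg_X (k := k)] at h0
          exact (keller_X (k := k)).rot.rot.deg_pos.ne (by rw [← h0]; simp [deg])
        · refine ⟨c, ?_, (hG.1.of_Pl_eq hy 0 r (by rw [ev]; abel)).swap⟩
          rw [Pl_comm, Pl_le_of_combo hy (show F (X 2) = C r + 0 • c + y • b by rw [ev]; simp)]
      · exact ⟨b, Pl_le_of_combo hz ev,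
          (hG.1.swap.of_Pl_eq hz y r (by rw [ev]; abel)).swap⟩
    obtain ⟨p, hp, hK⟩ := key
    have hSp : ∀ a, Sp a b c = Sp p a (F (X 2)) := fun a => by
      rw [Sp_swap' p, Sp_eq_sup, Sp_eq_sup, hp]
    have hφ' : φ ∈ Algebra.adjoin k {p, F (X 2)} := by
      rwa [← adjoin_eq_of_Pl hp]
    obtain ⟨A, hA, e0, e1, e2⟩ := exists_memH2_adapt (hS.trans (hSp a)) hK.rot.swap
    rw [← e0, ← e2] at hφ'
    obtain ⟨E, hE, e0', e1', e2'⟩ := exists_shear_memH1 hφ'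
    have hmem := ih (F * A * E) (by rw [hSp, AutSp, e0', e1', e2', e0, e1, e2])
      (by rw [e2', e2]; exact hF)
    exact (Subgroup.mul_mem_cancel_right _ (h2 ((hH2 _).2 hA))).1
      ((Subgroup.mul_mem_cancel_right _ (h1 ((hH1 _).2 hE))).1 hmem)
  | @kur f1' f1 f2 f3 χ κ δ hK hR ih =>
    intro F hS hF
    exfalso
    have hv : F (X 2) ∈ Sp f1' f2 f3 := hS ▸ right_mem_Sp (F (X 0)) (F (X 1)) (F (X 2))
    obtain ⟨r, x, y, z, e⟩ := mem_Sp.1 hv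
    have h1 := hK.good.deg_combo r x y z
    rw [← e, hdeg hF] at h1
    have hlt := hK.lt
    have h3 := W_two_le_deg (hK.keller1.rot.rot.add_left hK.mem).deg_pos
    have h4 := hK.deg3
    have h5 := hK.deg2
    have h6 := hK.lt_deg1'
    have hx : x = 0 := by
      by_contra hx
      rw [deg_smul hx] at h1
      linarith [le_max_left (deg f1') (max (deg (y • f2)) (deg (z • f3)))]
    have hy : y = 0 := by
      by_contra hy
      rw [deg_smul hy] at h1
      linarith [le_max_right (deg (x • f1')) (max (deg f2) (deg (z • f3))),
        le_max_left (deg f2) (deg (z • f3))]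
    have hz : z = 0 := by
      by_contra hz
      rw [deg_smul hz] at h1
      linarith [le_max_right (deg (x • f1')) (max (deg (y • f2)) (deg f3)),
        le_max_right (deg (y • f2)) (deg f3)]
    rw [hx, hy, hz, zero_smul, zero_smul, zero_smul, max_self, max_self, ← deg_X (k := k)] at h1
    exact (keller_X (k := k)).rot.rot.deg_pos.ne (by rw [h1]; simp [deg])

end

section

variable {k : Type} [Field k]

theorem aut_ext {σ τ : Aut3 k} (h0 : σ (X 0) = τ (X 0)) (h1 : σ (X 1) = τ (X 1))
    (h2 : σ (X 2) = τ (X 2)) : σ = τ := by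
  have : (σ : Poly3 k →ₐ[k] Poly3 k) = τ := by
    refine MvPolynomial.algHom_ext fun i => ?_
    fin_cases i
    exacts [h0, h1, h2]
  exact AlgEquiv.ext fun f => DFunLike.congr_fun this f

theorem apply_C (σ : Aut3 k) (r : k) : σ (C r) = C r := σ.commutes r

theorem exists_swap (i j : Fin 3) :
    ∃ σ : Aut3 k, IsAffine k σ ∧ ∀ l, σ (X l) = X (Equiv.swap i j l) := by
  have hP : IsUnit ((Equiv.swap i j).toPEquiv.toMatrix : Matrix (Fin 3) (Fin 3) k) := by
    rw [Matrix.isUnit_iff_isUnit_det, ← Equiv.Perm.permMatrix, Matrix.det_permutation]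
    exact (Units.isUnit _).map (Int.castRingHom k)
  obtain ⟨σ, hσ⟩ := exists_affine _ hP 0
  refine ⟨σ, ⟨_, _, hP, hσ⟩, fun l => ?_⟩
  rw [hσ]
  simp [PEquiv.toMatrix_apply]

theorem shear_mem_tame {i : Fin 3} {P : Poly3 k} (hP : P ∈ supported k ({i}ᶜ : Set (Fin 3)))
    {σ : Aut3 k} (hi : σ (X i) = X i + P) (hj : ∀ j ≠ i, σ (X j) = X j) : σ ∈ Tame k := by
  obtain ⟨π, hπ, hX⟩ := exists_swap (k := k) 0 i
  have hππ : π * π = 1 := by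
    apply aut_ext <;> simp [AlgEquiv.mul_apply, hX]
  have hmem : π ∈ Tame k := Subgroup.subset_closure (Or.inl hπ)
  have hc : ∀ l, (π * σ * π) (X l) = π (σ (X (Equiv.swap 0 i l))) := fun l => by
    rw [AlgEquiv.mul_apply, hX, AlgEquiv.mul_apply]
  have hne : ∀ l ≠ 0, (π * σ * π) (X l) = X l := by
    intro l hl
    rw [hc, hj, hX, Equiv.swap_apply_self]
    intro h
    apply hl
    rw [← Equiv.swap_apply_self 0 i l, h, Equiv.swap_apply_right]
  have hel : IsElementary k (π * σ * π) := by
    refine ⟨π P, ?_, ?_, hne 1 (by simp), hne 2 (by simp)⟩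
    · have : π P ∈ (supported k ({i}ᶜ : Set (Fin 3))).map (π : Poly3 k →ₐ[k] Poly3 k) :=
        ⟨P, hP, rfl⟩
      rw [supported_eq_adjoin_X, AlgHom.map_adjoin] at this
      refine Algebra.adjoin_le ?_ this
      rintro _ ⟨_, ⟨l, hl, rfl⟩, rfl⟩
      have hl : l ≠ i := hl
      change π (X l) ∈ _
      rw [hX]
      refine X_mem_supported_of ?_
      have : Equiv.swap 0 i l ≠ 0 := fun h => hl (by
        rw [← Equiv.swap_apply_self 0 i l, h, Equiv.swap_apply_left])
      revert this
      generalize Equiv.swap 0 i l = m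
      fin_cases m <;> simp
    · rw [hc, Equiv.swap_apply_left, hi, map_add, hX, Equiv.swap_apply_right]
  have h1 : π * σ * π ∈ Tame k := Subgroup.subset_closure (Or.inr hel)
  exact (Subgroup.mul_mem_cancel_left _ hmem).1 ((Subgroup.mul_mem_cancel_right _ hmem).1 h1)

theorem exists_shear_mem_tame (i : Fin 3) {P : Poly3 k}
    (hP : P ∈ supported k ({i}ᶜ : Set (Fin 3))) :
    ∃ σ ∈ Tame k, σ (X i) = X i + P ∧ ∀ j ≠ i, σ (X j) = X j := by
  obtain ⟨σ, h1, h2⟩ := exists_shear i hP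
  exact ⟨σ, shear_mem_tame hP h1 h2, h1, h2⟩

theorem MemH1.mem_tame {σ : Aut3 k} (h : MemH1 k σ) : σ ∈ Tame k := by
  obtain ⟨a, d, α, β, t, P, ha, hd, hα, ht, hP, e0, e1, e2⟩ := h
  obtain ⟨D, hD⟩ := exists_affine (k := k) (Matrix.diagonal ![a, d, α])
    (by
      rw [Matrix.isUnit_iff_isUnit_det, isUnit_iff_ne_zero, Matrix.det_diagonal,
        Fin.prod_univ_three]
      simp [ha, hd, hα]) ![0, 0, β]
  have hDm : D ∈ Tame k := Subgroup.subset_closure (Or.inl ⟨_, _, by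
      rw [Matrix.isUnit_iff_isUnit_det, isUnit_iff_ne_zero, Matrix.det_diagonal,
        Fin.prod_univ_three]
      simp [ha, hd, hα], hD⟩)
  have ht2 : C a⁻¹ * t ∈ supported k ({2} : Set (Fin 3)) := mul_mem (C_mem_supported _ _) ht
  obtain ⟨T0, hT0, h0, h0'⟩ := exists_shear_mem_tame (k := k) 0
    (supported_mono (s := {2}) (by simp) ht2)
  obtain ⟨T1, hT1, h1, h1'⟩ := exists_shear_mem_tame (k := k) 1
    (supported_mono (s := {0, 2}) (by rintro i (rfl | rfl) <;> simp)
      (mul_mem (C_mem_supported _ d⁻¹) hP))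
  have : σ = T1 * (T0 * D) := by
    have hfix : T1 (C a⁻¹ * t) = C a⁻¹ * t :=
      apply_eq_self_of_mem_supported T1 ht2 (by rintro _ rfl; exact h1' 2 (by simp))
    apply aut_ext
    · rw [e0, AlgEquiv.mul_apply, AlgEquiv.mul_apply, hD, Fin.sum_univ_three]
      have : (C a * C a⁻¹ : Poly3 k) = 1 := by rw [← C_mul, mul_inv_cancel₀ ha, C_1]
      simp [Matrix.diagonal, apply_C, h0, h1' 0, hfix]
      linear_combination - t * this
    · rw [e1, AlgEquiv.mul_apply, AlgEquiv.mul_apply, hD, Fin.sum_univ_three]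
      have : (C d * C d⁻¹ : Poly3 k) = 1 := by rw [← C_mul, mul_inv_cancel₀ hd, C_1]
      simp [Matrix.diagonal, apply_C, h0' 1, h1]
      linear_combination - P * this
    · rw [e2, AlgEquiv.mul_apply, AlgEquiv.mul_apply, hD, Fin.sum_univ_three]
      simp [Matrix.diagonal, apply_C, h0' 2, h1' 2]
  rw [this]
  exact mul_mem hT1 (mul_mem hT0 hDm)

theorem mem_supported_two {a : Poly3 k} :
    a ∈ supported k ({2} : Set (Fin 3)) ↔ ∃ A : Polynomial k, Polynomial.aeval (X 2) A = a := by
  rw [supported_eq_adjoin_X, Set.image_singleton, Algebra.adjoin_singleton_eq_range_aeval]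
  rfl

theorem H2_mem_tame_aux (A B : Polynomial k) : ∀ (σ : Aut3 k) (c d t t' : Poly3 k) (α β u : k),
    c ∈ supported k ({2} : Set (Fin 3)) → d ∈ supported k ({2} : Set (Fin 3)) →
    t ∈ supported k ({2} : Set (Fin 3)) → t' ∈ supported k ({2} : Set (Fin 3)) →
    u ≠ 0 → Polynomial.aeval (X 2 : Poly3 k) A * d - Polynomial.aeval (X 2 : Poly3 k) B * c = C u →
    α ≠ 0 → σ (X 0) = Polynomial.aeval (X 2) A * X 0 + Polynomial.aeval (X 2) B * X 1 + t →
    σ (X 1) = c * X 0 + d * X 1 + t' → σ (X 2) = C α * X 2 + C β → σ ∈ Tame k := by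
  obtain ⟨S, hS, hSX⟩ := exists_swap (k := k) 0 1
  have hSm : S ∈ Tame k := Subgroup.subset_closure (Or.inl hS)
  have hS0 : S (X 0) = X 1 := by simp [hSX]
  have hS1 : S (X 1) = X 0 := by simp [hSX]
  have hS2 : S (X 2) = X 2 := by rw [hSX, Equiv.swap_apply_of_ne_of_ne] <;> simp
  have hfix : ∀ {F : Aut3 k}, F (X 2) = X 2 → ∀ f ∈ supported k ({2} : Set (Fin 3)), F f = f :=
    fun h f hf => apply_eq_self_of_mem_supported _ hf (by rintro _ rfl; exact h)
  have hmem : ∀ A : Polynomial k,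
      Polynomial.aeval (X 2 : Poly3 k) A ∈ supported k ({2} : Set (Fin 3)) :=
    fun A => mem_supported_two.2 ⟨A, rfl⟩
  have hfixA : ∀ {F : Aut3 k}, F (X 2) = X 2 → ∀ A : Polynomial k,
    F (Polynomial.aeval (X 2 : Poly3 k) A) = Polynomial.aeval (X 2 : Poly3 k) A :=
    fun h A => hfix h _ (hmem A)
  induction A, B using EuclideanDomain.GCD.induction with
  | H0 B =>
    intro σ c d t t' α β u hc hd ht ht' hu hdet hα e0 e1 e2
    rw [map_zero, zero_mul, zero_sub] at hdet
    have hunit : IsUnit (Polynomial.aeval (X 2 : Poly3 k) B * c) := by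
      rw [← neg_neg (_ * c), hdet]
      exact ((isUnit_iff_ne_zero.2 hu).map C).neg
    obtain ⟨r, hr, e⟩ := MvPolynomial.isUnit_iff_eq_C_of_isReduced.1
      (isUnit_of_mul_isUnit_left hunit)
    obtain ⟨s, hs, e'⟩ := MvPolynomial.isUnit_iff_eq_C_of_isReduced.1
      (isUnit_of_mul_isUnit_right hunit)
    refine (Subgroup.mul_mem_cancel_left _ hSm).1 (MemH1.mem_tame (σ := S * σ)
      ⟨r, s, α, β, t, d * X 0 + t', hr.ne_zero, hs.ne_zero, hα, ht, ?_, ?_, ?_, ?_⟩)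
    · exact add_mem (mul_mem (supported_mono (by simp) hd) (X_mem_supported_of (by simp)))
        (supported_mono (by simp) ht')
    · rw [AlgEquiv.mul_apply, e0, e]
      simp [hS1, hfix hS2 t ht, apply_C]
    · rw [AlgEquiv.mul_apply, e1, e']
      simp [hS0, hS1, hfix hS2 t' ht', apply_C, hfix hS2 d hd]
      ring
    · rw [AlgEquiv.mul_apply, e2]
      simp [hS2, apply_C]
  | H1 A B hA ih =>
    intro σ c d t t' α β u hc hd ht ht' hu hdet hα e0 e1 e2
    obtain ⟨E, hE, hE0, hE'⟩ := exists_shear_mem_tame (k := k) 0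
      (P := - (Polynomial.aeval (X 2 : Poly3 k) (B / A) * X 1))
      (neg_mem (mul_mem (supported_mono (by simp) (hmem _)) (X_mem_supported_of (by simp))))
    have hE1 := hE' 1 (by simp)
    have hE2 := hE' 2 (by simp)
    have hBA := congrArg (Polynomial.aeval (X 2 : Poly3 k)) (EuclideanDomain.div_add_mod B A)
    rw [map_add, map_mul] at hBA
    refine (Subgroup.mul_mem_cancel_left _ hE).1 ((Subgroup.mul_mem_cancel_left _ hSm).1
      (ih (S * (E * σ)) (d - c * Polynomial.aeval (X 2 : Poly3 k) (B / A)) c t t' α β (-u)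
      (sub_mem hd (mul_mem hc (hmem _))) hc ht ht' (neg_ne_zero.2 hu) ?_ hα ?_ ?_ ?_))
    · rw [C_neg, ← hdet]
      linear_combination c * hBA
    · rw [AlgEquiv.mul_apply, AlgEquiv.mul_apply, e0]
      simp only [map_add, map_mul, map_neg, hfixA hE2, hfixA hS2, hE0, hE1, hS0, hS1, hfix hE2 t ht,
        hfix hS2 t ht]
      linear_combination -X 0 * hBA
    · rw [AlgEquiv.mul_apply, AlgEquiv.mul_apply, e1]
      simp only [map_add, map_mul, map_neg, hfixA hS2, hE0, hE1, hS0, hS1,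
        hfix hE2 t' ht', hfix hS2 t' ht', hfix hE2 c hc, hfix hS2 c hc, hfix hE2 d hd,
        hfix hS2 d hd]
      ring
    · rw [AlgEquiv.mul_apply, AlgEquiv.mul_apply, e2]
      simp only [map_add, map_mul, apply_C, hE2, hS2]

theorem MemH2.mem_tame {σ : Aut3 k} (h : MemH2 k σ) : σ ∈ Tame k := by
  obtain ⟨a, b, c, d, t, t', α, β, ha, hb, hc, hd, ht, ht', ⟨u, hu, hdet⟩, hα, e0, e1, e2⟩ := h
  obtain ⟨A, rfl⟩ := mem_supported_two.1 ha
  obtain ⟨B, rfl⟩ := mem_supported_two.1 hb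
  exact H2_mem_tame_aux A B σ c d t t' α β u hc hd ht ht' hu hdet hα e0 e1 e2

end

section

variable {k : Type} [Field k]

/-- Records the total degree in the first two variables as a degree in an extra variable. -/
noncomputable def homog : Poly3 k →ₐ[k] Polynomial (Poly3 k) :=
  aeval ![Polynomial.C (X 0) * Polynomial.X, Polynomial.C (X 1) * Polynomial.X, Polynomial.C (X 2)]

/-- The total degree in the first two variables. -/
noncomputable def xdeg (f : Poly3 k) : ℕ := (homog f).natDegree

theorem homog_of_mem {f : Poly3 k} (hf : f ∈ supported k ({2} : Set (Fin 3))) :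
    homog f = Polynomial.C f := by
  rw [supported_eq_adjoin_X] at hf
  refine AlgHom.adjoin_le_equalizer homog (Polynomial.CAlgHom (R := k) (A := Poly3 k)) ?_ hf
  rintro _ ⟨_, rfl, rfl⟩
  simp [homog]

/-- The automorphism scales the class of the third variable. -/
def FixX2 (F : Aut3 k) : Prop := ∃ α β : k, α ≠ 0 ∧ F (X 2) = C α * X 2 + C β

theorem FixX2.mem {F : Aut3 k} (hF : FixX2 F) {f : Poly3 k}
    (hf : f ∈ supported k ({2} : Set (Fin 3))) : F f ∈ supported k ({2} : Set (Fin 3)) := by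
  obtain ⟨α, β, -, e⟩ := hF
  have : F f ∈ (supported k ({2} : Set (Fin 3))).map (F : Poly3 k →ₐ[k] Poly3 k) := ⟨f, hf, rfl⟩
  rw [supported_eq_adjoin_X, AlgHom.map_adjoin] at this
  refine Algebra.adjoin_le ?_ this
  rintro _ ⟨_, ⟨_, rfl, rfl⟩, rfl⟩
  change F (X 2) ∈ _
  rw [e]
  exact add_mem (mul_mem (C_mem_supported _ _) (X_mem_supported_of rfl)) (C_mem_supported _ _)

theorem xdeg_combo_le (a b t f g : Poly3 k) (ha : a ∈ supported k ({2} : Set (Fin 3)))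
    (hb : b ∈ supported k ({2} : Set (Fin 3))) (ht : t ∈ supported k ({2} : Set (Fin 3))) :
    xdeg (a * f + b * g + t) ≤ max (xdeg f) (xdeg g) := by
  rw [xdeg, map_add, map_add, map_mul, map_mul, homog_of_mem ha, homog_of_mem hb, homog_of_mem ht,
    Polynomial.natDegree_add_C]
  exact (Polynomial.natDegree_add_le _ _).trans
    (max_le_max (Polynomial.natDegree_C_mul_le _ _) (Polynomial.natDegree_C_mul_le _ _))

theorem xdeg_combo_eq {a b t f g : Poly3 k} (ha : a ∈ supported k ({2} : Set (Fin 3)))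
    (hb : b ∈ supported k ({2} : Set (Fin 3))) (ht : t ∈ supported k ({2} : Set (Fin 3)))
    (h0 : b ≠ 0) (hlt : xdeg f < xdeg g) : xdeg (a * f + b * g + t) = xdeg g := by
  rw [xdeg, map_add, map_add, map_mul, map_mul, homog_of_mem ha, homog_of_mem hb, homog_of_mem ht,
    Polynomial.natDegree_add_C, Polynomial.natDegree_add_eq_right_of_natDegree_lt,
    Polynomial.natDegree_C_mul h0]
  · rfl
  · rw [Polynomial.natDegree_C_mul h0]
    exact (Polynomial.natDegree_C_mul_le _ _).trans_lt hlt

theorem exists_polynomial_of_mem {P : Poly3 k} (hP : P ∈ supported k ({0, 2} : Set (Fin 3))) :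
    ∃ Q : Polynomial (supported k ({2} : Set (Fin 3))), Polynomial.aeval (X 0 : Poly3 k) Q = P := by
  rw [supported_eq_adjoin_X, Set.image_pair] at hP
  have : Algebra.adjoin k {X 0, X 2} ≤ ((Polynomial.aeval (X 0 : Poly3 k)).restrictScalars k :
      Polynomial (supported k ({2} : Set (Fin 3))) →ₐ[k] Poly3 k).range := by
    refine Algebra.adjoin_le ?_
    rintro _ (rfl | rfl)
    · exact ⟨Polynomial.X, Polynomial.aeval_X _⟩
    · exact ⟨Polynomial.C ⟨X 2, X_mem_supported_of rfl⟩, Polynomial.aeval_C _ _⟩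
  exact this hP

theorem xdeg_apply_aeval {F : Aut3 k} (hF : FixX2 F)
    (Q : Polynomial (supported k ({2} : Set (Fin 3)))) :
    xdeg (F (Polynomial.aeval (X 0 : Poly3 k) Q)) = Q.natDegree * xdeg (F (X 0)) := by
  set R : supported k ({2} : Set (Fin 3)) →+* Poly3 k :=
    (F : Poly3 k →+* Poly3 k).comp (supported k ({2} : Set (Fin 3))).val.toRingHom with hR
  have hinj : Function.Injective R := F.injective.comp Subtype.val_injective
  have : homog (F (Polynomial.aeval (X 0 : Poly3 k) Q)) = (Q.map R).comp (homog (F (X 0))) := by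
    induction Q using Polynomial.induction_on' with
    | add p q hp hq => simp only [map_add, hp, hq, Polynomial.map_add, Polynomial.add_comp]
    | monomial n a =>
      rw [Polynomial.aeval_monomial, map_mul, map_mul, map_pow, map_pow, Polynomial.map_monomial,
        Polynomial.monomial_comp]
      congr 1
      exact homog_of_mem (hF.mem a.2)
  rw [xdeg, this, Polynomial.natDegree_comp, Polynomial.natDegree_map_eq_of_injective hinj]
  rfl

theorem MemH1.xdeg_zero {F σ : Aut3 k} (hF : FixX2 F) (h : MemH1 k σ) :
    xdeg ((F * σ) (X 0)) = xdeg (F (X 0)) := by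
  obtain ⟨a, d, α, β, t, P, ha, hd, hα, ht, hP, e0, e1, e2⟩ := h
  rw [AlgEquiv.mul_apply, e0, map_add, map_mul, apply_C, xdeg, map_add, map_mul,
    homog_of_mem (hF.mem ht), homog_of_mem (C_mem_supported _ _), Polynomial.natDegree_add_C,
    Polynomial.natDegree_C_mul (by simpa using ha)]
  rfl

theorem MemH1.lt_xdeg_one {F σ : Aut3 k} (hF : FixX2 F) (h : MemH1 k σ) (h2 : ¬ MemH2 k σ)
    (h1 : 1 ≤ xdeg (F (X 0))) (hle : xdeg (F (X 1)) ≤ xdeg (F (X 0))) :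
    xdeg ((F * σ) (X 0)) < xdeg ((F * σ) (X 1)) := by
  rw [MemH1.xdeg_zero hF h]
  obtain ⟨a, d, α, β, t, P, ha, hd, hα, ht, hP, e0, e1, e2⟩ := h
  obtain ⟨Q, rfl⟩ := exists_polynomial_of_mem hP
  have hQ : 2 ≤ Q.natDegree := by
    by_contra! hQ
    have e := Polynomial.eq_X_add_C_of_natDegree_le_one (Nat.lt_succ_iff.1 hQ)
    refine h2 ⟨C a, 0, Q.coeff 1, C d, t, Q.coeff 0, α, β, C_mem_supported _ _, zero_mem _,
      (Q.coeff 1).2, C_mem_supported _ _, ht, (Q.coeff 0).2, ⟨a * d, mul_ne_zero ha hd, by simp⟩,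
      hα, by rw [e0]; ring, ?_, e2⟩
    rw [e1]
    conv_lhs => rw [e]
    rw [map_add, map_mul, Polynomial.aeval_C, Polynomial.aeval_C, Polynomial.aeval_X]
    change C d * X 1 + ((Q.coeff 1 : Poly3 k) * X 0 + (Q.coeff 0 : Poly3 k)) = _
    ring
  have hd' := xdeg_apply_aeval hF Q
  have hlt : xdeg (F (X 0)) < Q.natDegree * xdeg (F (X 0)) := by nlinarith
  rw [AlgEquiv.mul_apply, e1, map_add, map_mul, apply_C]
  rw [show C d * F (X 1) + F (Polynomial.aeval (X 0 : Poly3 k) Q) =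
    C d * F (X 1) + 1 * F (Polynomial.aeval (X 0 : Poly3 k) Q) + 0 by ring,
    xdeg_combo_eq (C_mem_supported _ _) (one_mem _) (zero_mem _) one_ne_zero] <;>
  · rw [hd']
    omega

theorem MemH2.xdeg_one_le {F σ : Aut3 k} (hF : FixX2 F) (h : MemH2 k σ) :
    xdeg ((F * σ) (X 1)) ≤ max (xdeg (F (X 0))) (xdeg (F (X 1))) := by
  obtain ⟨a, b, c, d, t, t', α, β, ha, hb, hc, hd, ht, ht', ⟨u, hu, hdet⟩, hα, e0, e1, e2⟩ := h
  rw [AlgEquiv.mul_apply, e1, map_add, map_add, map_mul, map_mul]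
  exact xdeg_combo_le _ _ _ _ _ (hF.mem hc) (hF.mem hd) (hF.mem ht')

theorem MemH2.xdeg_zero {F σ : Aut3 k} (hF : FixX2 F) (h : MemH2 k σ) (h1 : ¬ MemH1 k σ)
    (hlt : xdeg (F (X 0)) < xdeg (F (X 1))) : xdeg ((F * σ) (X 0)) = xdeg (F (X 1)) := by
  obtain ⟨a, b, c, d, t, t', α, β, ha, hb, hc, hd, ht, ht', ⟨u, hu, hdet⟩, hα, e0, e1, e2⟩ := h
  have hb0 : b ≠ 0 := by
    rintro rfl
    rw [zero_mul, sub_zero] at hdet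
    have hunit : IsUnit (a * d) := by
      rw [hdet]
      exact (isUnit_iff_ne_zero.2 hu).map C
    obtain ⟨r, hr, rfl⟩ :=
      MvPolynomial.isUnit_iff_eq_C_of_isReduced.1 (isUnit_of_mul_isUnit_left hunit)
    obtain ⟨s, hs, rfl⟩ :=
      MvPolynomial.isUnit_iff_eq_C_of_isReduced.1 (isUnit_of_mul_isUnit_right hunit)
    refine h1 ⟨r, s, α, β, t, c * X 0 + t', hr.ne_zero, hs.ne_zero, hα, ht, ?_, ?_, ?_, e2⟩
    · exact add_mem (mul_mem (supported_mono (by simp) hc) (X_mem_supported_of (by simp)))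
        (supported_mono (by simp) ht')
    · rw [e0]
      ring
    · rw [e1]
      ring
  rw [AlgEquiv.mul_apply, e0, map_add, map_add, map_mul, map_mul]
  exact xdeg_combo_eq (hF.mem ha) (hF.mem hb) (hF.mem ht)
    ((map_ne_zero_iff _ F.injective).2 hb0) hlt

theorem MemH2.fixX2 {F : Aut3 k} (h : MemH2 k F) : FixX2 F := by
  obtain ⟨a, b, c, d, t, t', α, β, ha, hb, hc, hd, ht, ht', -, hα, e0, e1, e2⟩ := h
  exact ⟨α, β, hα, e2⟩

theorem MemH1.fixX2 {F : Aut3 k} (h : MemH1 k F) : FixX2 F := by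
  obtain ⟨a, d, α, β, t, P, ha, hd, hα, ht, hP, e0, e1, e2⟩ := h
  exact ⟨α, β, hα, e2⟩

theorem aeval_eq_self_of_mem {v : Fin 3 → Poly3 k} (hv : v 2 = X 2) {f : Poly3 k}
    (hf : f ∈ supported k ({2} : Set (Fin 3))) : aeval v f = f := by
  rw [supported_eq_adjoin_X] at hf
  refine AlgHom.adjoin_le_equalizer (aeval v) (AlgHom.id k _) ?_ hf
  rintro _ ⟨_, rfl, rfl⟩
  simp [hv]

theorem MemH2.xdeg_le_one {F : Aut3 k} (h : MemH2 k F) :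
    1 ≤ xdeg (F (X 0)) ∧ xdeg (F (X 1)) ≤ xdeg (F (X 0)) := by
  have h1 : xdeg (F (X 1)) ≤ 1 := by
    have := MemH2.xdeg_one_le (F := 1) ⟨1, 0, one_ne_zero, by simp⟩ h
    simpa [xdeg, homog, Polynomial.natDegree_C_mul_X] using this
  suffices h0 : 1 ≤ xdeg (F (X 0)) from ⟨h0, h1.trans h0⟩
  obtain ⟨a, b, c, d, t, t', α, β, ha, hb, hc, hd, ht, ht', ⟨u, hu, hdet⟩, hα, e0, e1, e2⟩ := h
  refine Polynomial.le_natDegree_of_ne_zero (n := 1) fun hz => ?_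
  rw [e0, map_add, map_add, map_mul, map_mul, homog_of_mem ha, homog_of_mem hb,
    homog_of_mem ht] at hz
  have hz : a * X 0 + b * X 1 = 0 := by
    simpa [homog, Polynomial.coeff_C_mul, Polynomial.coeff_C] using hz
  have ha0 : a = 0 := by
    have := congrArg (aeval (R := k) (![1, 0, X 2] : Fin 3 → Poly3 k)) hz
    rw [map_add, map_mul, map_mul, aeval_eq_self_of_mem (v := ![1, 0, X 2]) rfl ha] at this
    simpa using this
  have hb0 : b = 0 := by
    have := congrArg (aeval (R := k) (![0, 1, X 2] : Fin 3 → Poly3 k)) hz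
    rw [map_add, map_mul, map_mul, aeval_eq_self_of_mem (v := ![0, 1, X 2]) rfl hb] at this
    simpa using this
  rw [ha0, hb0, zero_mul, zero_mul, sub_zero, eq_comm, C_eq_zero] at hdet
  exact hu hdet

end

section

variable {k : Type} [Field k]

theorem FixX2.mul {F σ : Aut3 k} (hF : FixX2 F) (hσ : FixX2 σ) : FixX2 (F * σ) := by
  obtain ⟨α, β, hα, e⟩ := hF
  obtain ⟨α', β', hα', e'⟩ := hσ
  refine ⟨α' * α, α' * β + β', mul_ne_zero hα' hα, ?_⟩
  rw [AlgEquiv.mul_apply, e', map_add, map_mul, apply_C, apply_C, e]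
  simp only [C_mul, C_add]
  ring

/-- The form taken by the inverse of a product of letters of an amalgam word,
according to the factor containing the leftmost letter. -/
def WordInv (H1 H2 : Subgroup (Aut3 k)) (F : Aut3 k) : Option Bool → Prop
  | none => F ∈ H1 ⊓ H2
  | some true => 1 ≤ xdeg (F (X 0)) ∧ xdeg (F (X 0)) < xdeg (F (X 1))
  | some false => (xdeg (F (X 1)) ≤ xdeg (F (X 0)) ∧ 2 ≤ xdeg (F (X 0))) ∨ (F ∈ H2 ∧ F ∉ H1)

variable {H1 H2 : Subgroup (Aut3 k)} {F σ : Aut3 k}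

theorem WordInv.xdeg_le (hH2 : ∀ σ, σ ∈ H2 ↔ MemH2 k σ) {o : Option Bool}
    (h : WordInv H1 H2 F o) (ho : o ≠ some true) :
    1 ≤ xdeg (F (X 0)) ∧ xdeg (F (X 1)) ≤ xdeg (F (X 0)) := by
  match o, h with
  | none, h => exact MemH2.xdeg_le_one ((hH2 F).1 h.2)
  | some true, _ => exact absurd rfl ho
  | some false, .inl h => exact ⟨one_le_two.trans h.2, h.1⟩
  | some false, .inr h => exact MemH2.xdeg_le_one ((hH2 F).1 h.1)

theorem WordInv.mul_memH1 (hH1 : ∀ σ, σ ∈ H1 ↔ MemH1 k σ) (hH2 : ∀ σ, σ ∈ H2 ↔ MemH2 k σ)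
    (hF : FixX2 F) {o : Option Bool} (h : WordInv H1 H2 F o) (ho : o ≠ some true)
    (h1 : σ ∈ H1) (h2 : σ ∉ H2) : WordInv H1 H2 (F * σ) (some true) := by
  obtain ⟨hp, hle⟩ := WordInv.xdeg_le hH2 h ho
  rw [hH1] at h1
  rw [hH2] at h2
  refine ⟨?_, MemH1.lt_xdeg_one hF h1 h2 hp hle⟩
  rwa [MemH1.xdeg_zero hF h1]

theorem WordInv.mul_memH2 (hH1 : ∀ σ, σ ∈ H1 ↔ MemH1 k σ) (hH2 : ∀ σ, σ ∈ H2 ↔ MemH2 k σ)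
    (hF : FixX2 F) {o : Option Bool} (h : WordInv H1 H2 F o) (ho : o ≠ some false)
    (h2 : σ ∈ H2) (h1 : σ ∉ H1) : WordInv H1 H2 (F * σ) (some false) := by
  match o, h with
  | none, h => exact .inr ⟨mul_mem h.2 h2, fun h' => h1 ((Subgroup.mul_mem_cancel_left _ h.1).1 h')⟩
  | some false, _ => exact absurd rfl ho
  | some true, ⟨hp, hlt⟩ =>
    rw [hH2] at h2
    rw [hH1] at h1
    have e0 := MemH2.xdeg_zero hF h2 h1 hlt
    have e1 := MemH2.xdeg_one_le hF h2
    rw [max_eq_right hlt.le] at e1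
    exact .inl ⟨e0 ▸ e1, by omega⟩

theorem WordInv.mul_memInf (hH1 : ∀ σ, σ ∈ H1 ↔ MemH1 k σ) (hH2 : ∀ σ, σ ∈ H2 ↔ MemH2 k σ)
    (hF : FixX2 F) {o : Option Bool} (h : WordInv H1 H2 F o) (hσ : σ ∈ H1 ⊓ H2) :
    WordInv H1 H2 (F * σ) o := by
  have e0 := MemH1.xdeg_zero hF ((hH1 σ).1 hσ.1)
  have e1 := MemH2.xdeg_one_le hF ((hH2 σ).1 hσ.2)
  match o, h with
  | none, h => exact mul_mem h hσ
  | some true, h =>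
    have e2 := MemH2.xdeg_one_le (hF.mul (MemH2.fixX2 ((hH2 σ).1 hσ.2)))
      ((hH2 _).1 (inv_mem hσ.2))
    rw [mul_inv_cancel_right, e0] at e2
    obtain ⟨hp, hlt⟩ := h
    exact ⟨e0 ▸ hp, by omega⟩
  | some false, .inl h => exact .inl ⟨by omega, e0 ▸ h.2⟩
  | some false, .inr h =>
    exact .inr ⟨mul_mem h.1 hσ.2, fun h' => h.2 ((Subgroup.mul_mem_cancel_right _ hσ.1).1 h')⟩

theorem WordInv.eq_none_of_one (hH2 : ∀ σ, σ ∈ H2 ↔ MemH2 k σ) {o : Option Bool}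
    (h : WordInv H1 H2 1 o) : o = none := by
  match o, h with
  | none, _ => rfl
  | some true, h => exact absurd (MemH2.xdeg_le_one ((hH2 1).1 (one_mem _))).2 h.2.not_ge
  | some false, .inl h =>
    have : xdeg (X 0 : Poly3 k) ≤ 1 := by simp [xdeg, homog]
    exact absurd h.2 (by simpa using Nat.lt_succ_iff.2 this)
  | some false, .inr h => exact absurd (one_mem _) h.2

theorem amalgIncl_injective {G : Type*} [Group G] (A B : Subgroup G) (i : Bool) :
    Function.Injective (amalgIncl A B i) := by
  cases i
  · exact Subgroup.inclusion_injective inf_le_right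
  · exact Subgroup.inclusion_injective inf_le_left

open Monoid.PushoutI in
theorem wordInv_prod (hH1 : ∀ σ, σ ∈ H1 ↔ MemH1 k σ) (hH2 : ∀ σ, σ ∈ H2 ↔ MemH2 k σ)
    {d : NormalWord.Transversal (amalgIncl H1 H2)} (w : NormalWord d) :
    FixX2 (amalgToGroup H1 H2 w.prod)⁻¹ ∧
      WordInv H1 H2 (amalgToGroup H1 H2 w.prod)⁻¹ w.fstIdx := by
  classical
  induction w using NormalWord.consRecOn with
  | empty =>
    have : (amalgToGroup H1 H2 (NormalWord.empty (d := d)).prod) = 1 := by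
      rw [NormalWord.prod_empty]; exact map_one _
    rw [this, inv_one]
    exact ⟨⟨1, 0, one_ne_zero, by simp⟩, one_mem _⟩
  | cons i g w hmw hgn hgr hw1 ih =>
    have hfst : (NormalWord.cons g w hmw hgr).fstIdx = some i := by
      simp [NormalWord.cons, Monoid.CoprodI.Word.fstIdx_cons]
    have hp : amalgToGroup H1 H2 (NormalWord.cons g w hmw hgr).prod =
        amalgToGroup H1 H2 (of (φ := amalgIncl H1 H2) i g) * amalgToGroup H1 H2 w.prod := by
      rw [NormalWord.prod_cons]
      exact map_mul (amalgToGroup H1 H2) _ _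
    rw [hfst, hp, mul_inv_rev]
    cases i with
    | false =>
      have hg : amalgToGroup H1 H2 (of (φ := amalgIncl H1 H2) false g) = H2.subtype g :=
        lift_of _ _ _ _
      rw [hg]
      have h2 : (H2.subtype g)⁻¹ ∈ H2 := inv_mem (Subtype.prop (p := (· ∈ H2)) g)
      refine ⟨ih.1.mul (MemH2.fixX2 ((hH2 _).1 h2)), WordInv.mul_memH2 hH1 hH2 ih.1 ih.2 hmw h2 ?_⟩
      intro h1
      exact hgr ⟨⟨_, H1.inv_mem_iff.1 h1, H2.inv_mem_iff.1 h2⟩, rfl⟩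
    | true =>
      have hg : amalgToGroup H1 H2 (of (φ := amalgIncl H1 H2) true g) = H1.subtype g :=
        lift_of _ _ _ _
      rw [hg]
      have h1 : (H1.subtype g)⁻¹ ∈ H1 := inv_mem (Subtype.prop (p := (· ∈ H1)) g)
      refine ⟨ih.1.mul (MemH1.fixX2 ((hH1 _).1 h1)), WordInv.mul_memH1 hH1 hH2 ih.1 ih.2 hmw h1 ?_⟩
      intro h2
      exact hgr ⟨⟨_, H1.inv_mem_iff.1 h1, H2.inv_mem_iff.1 h2⟩, rfl⟩
  | base h w hw1 ih =>
    have hp : amalgToGroup H1 H2 (base (amalgIncl H1 H2) h • w).prod =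
        h * amalgToGroup H1 H2 w.prod := by
      rw [NormalWord.prod_smul]
      refine (map_mul (amalgToGroup H1 H2) _ _).trans ?_
      congr 1
    have hfst : (base (amalgIncl H1 H2) h • w).fstIdx = w.fstIdx := by
      rw [NormalWord.base_smul_def]
    have hm := inv_mem h.2
    rw [hfst, hp, mul_inv_rev]
    exact ⟨ih.1.mul (MemH2.fixX2 ((hH2 _).1 hm.2)), WordInv.mul_memInf hH1 hH2 ih.1 ih.2 hm⟩

open Monoid.PushoutI in
theorem amalgToGroup_injective (hH1 : ∀ σ, σ ∈ H1 ↔ MemH1 k σ) (hH2 : ∀ σ, σ ∈ H2 ↔ MemH2 k σ) :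
    Function.Injective (amalgToGroup H1 H2) := by
  classical
  rw [injective_iff_map_eq_one]
  intro x hx
  obtain ⟨d⟩ := NormalWord.transversal_nonempty (amalgIncl H1 H2) (amalgIncl_injective H1 H2)
  obtain ⟨w, rfl⟩ : ∃ w : NormalWord d, w.prod = x :=
    (NormalWord.equiv (d := d)).symm.surjective x
  have h := (wordInv_prod hH1 hH2 w).2
  rw [hx, inv_one] at h
  have hnil : w.toList = [] := by
    simpa [Monoid.CoprodI.Word.fstIdx] using WordInv.eq_none_of_one hH2 h
  have hw : w.prod = base (amalgIncl H1 H2) w.head := by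
    simp [NormalWord.prod, Monoid.CoprodI.Word.prod, hnil]
  have hh : amalgToGroup H1 H2 w.prod = w.head := by
    rw [hw]
    exact lift_base _ _ _ _
  have : w.head = 1 := Subtype.ext (hh.symm.trans hx)
  rw [hw, this]
  exact map_one _

theorem range_amalgToGroup {G : Type*} [Group G] (A B : Subgroup G) :
    (amalgToGroup A B).range = A ⊔ B := by
  apply le_antisymm
  · rintro _ ⟨x, rfl⟩
    induction x using Monoid.PushoutI.induction_on with
    | of i g =>
      cases i with
      | false =>
        have hg : amalgToGroup A B (Monoid.PushoutI.of (φ := amalgIncl A B) false g) =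
          B.subtype g := Monoid.PushoutI.lift_of _ _ _ _
        rw [hg]
        exact (le_sup_right : B ≤ A ⊔ B) (Subtype.prop (p := (· ∈ B)) g)
      | true =>
        have hg : amalgToGroup A B (Monoid.PushoutI.of (φ := amalgIncl A B) true g) =
          A.subtype g := Monoid.PushoutI.lift_of _ _ _ _
        rw [hg]
        exact (le_sup_left : A ≤ A ⊔ B) (Subtype.prop (p := (· ∈ A)) g)
    | base h =>
      have hh : amalgToGroup A B (Monoid.PushoutI.base (amalgIncl A B) h) = h :=
        Monoid.PushoutI.lift_base _ _ _ _
      rw [hh]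
      exact (le_sup_left : A ≤ A ⊔ B) h.2.1
    | mul x y hx hy =>
      have : amalgToGroup A B (x * y) = amalgToGroup A B x * amalgToGroup A B y := map_mul _ x y
      rw [this]
      exact mul_mem hx hy
  · refine sup_le (fun a ha => ?_) (fun b hb => ?_)
    · exact ⟨Monoid.PushoutI.of (φ := amalgIncl A B) true (⟨a, ha⟩ : A),
        Monoid.PushoutI.lift_of _ _ _ _⟩
    · exact ⟨Monoid.PushoutI.of (φ := amalgIncl A B) false (⟨b, hb⟩ : B),
        Monoid.PushoutI.lift_of _ _ _ _⟩

theorem FixX2.inv {F : Aut3 k} (hF : FixX2 F) : FixX2 F⁻¹ := by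
  obtain ⟨α, β, hα, e⟩ := hF
  refine ⟨α⁻¹, -(α⁻¹ * β), inv_ne_zero hα, ?_⟩
  apply F.injective
  rw [← AlgEquiv.mul_apply, mul_inv_cancel, map_add, map_mul, apply_C, apply_C, e, mul_add,
    ← mul_assoc, ← C_mul, ← C_mul, inv_mul_cancel₀ hα, C_neg]
  simp

/-- The tame automorphisms preserving the class of the third variable. -/
noncomputable def tameStab (k : Type) [Field k] : Subgroup (Aut3 k) where
  carrier := {σ | σ ∈ Tame k ∧ FixX2 σ}
  one_mem' := ⟨one_mem _, 1, 0, one_ne_zero, by simp⟩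
  mul_mem' h h' := ⟨mul_mem h.1 h'.1, h.2.mul h'.2⟩
  inv_mem' h := ⟨inv_mem h.1, h.2.inv⟩

end

end TameStab

/-- `Stab([x3]) = H1 *_{H1 ∩ H2} H2`: the canonical homomorphism from the amalgamated
product of `H1` and `H2` over their intersection to `Aut(R)` is injective, with image
`Stab([x3]) = {σ ∈ Tame(k^3) : σ(x3) = α·x3 + β, α ∈ k^*}`. -/
theorem stab_eq_amalgam_H1_H2 (k : Type) [Field k] [CharZero k]
    (H1 H2 : Subgroup (Aut3 k))
    (hH1 : ∀ σ, σ ∈ H1 ↔ MemH1 k σ) (hH2 : ∀ σ, σ ∈ H2 ↔ MemH2 k σ) :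
    Function.Injective (amalgToGroup H1 H2) ∧
    ∀ σ : Aut3 k, σ ∈ (amalgToGroup H1 H2).range ↔
      (σ ∈ Tame k ∧ ∃ α β : k, α ≠ 0 ∧ σ (X 2) = C α * X 2 + C β) := by
  refine ⟨TameStab.amalgToGroup_injective hH1 hH2, fun σ => ?_⟩
  rw [TameStab.range_amalgToGroup]
  constructor
  · have : H1 ⊔ H2 ≤ TameStab.tameStab k := sup_le
      (fun τ hτ => ⟨TameStab.MemH1.mem_tame ((hH1 τ).1 hτ), TameStab.MemH1.fixX2 ((hH1 τ).1 hτ)⟩)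
      (fun τ hτ => ⟨TameStab.MemH2.mem_tame ((hH2 τ).1 hτ), TameStab.MemH2.fixX2 ((hH2 τ).1 hτ)⟩)
    exact fun h => this h
  · rintro ⟨hσ, h⟩
    exact TameStab.Red.mem_sup hH1 hH2 (TameStab.Red.of_mem_tame hσ).2 σ rfl h
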